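/- arXiv:math/9805065 — 3 statements merged into one kernel-verified Lean document; each statement's English description precedes it below -/
import Mathlib

section
/- Let n = 2 and N ≥ 1, let U ⊆ ℝ² be open and connected, and let (A₁, A₂, V) be a semilinear elliptic first-order system respecting the zero section on U. Let φ : U → ℝ^N be a smooth solution of ∑ⱼ Aⱼ(x)(∂φ/∂xⱼ)(x) + V(x, φ(x)) = 0. Then every zero of φ of finite order is an isolated point of the zero set N(φ); that is, N_fin(φ) consists of points isolated in N(φ). -/
open MeasureTheory Metric Set Filter Topology ENNReal NNReal

noncomputable section

/-- `m`-dimensional Euclidean space. -/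
abbrev Euc (m : ℕ) := EuclideanSpace ℝ (Fin m)

/-- The semilinear first-order differential operator `φ ↦ ∑ⱼ Aⱼ(x) ∂φ/∂xⱼ + V(x, φ(x))`
applied to `φ` at the point `x`. -/
def semilinApply {n N : ℕ} (A : Fin n → Euc n → Matrix (Fin N) (Fin N) ℝ)
    (V : Euc n → (Fin N → ℝ) → (Fin N → ℝ)) (φ : Euc n → (Fin N → ℝ)) (x : Euc n) :
    Fin N → ℝ :=
  (∑ j, (A j x).mulVec (fderiv ℝ φ x (EuclideanSpace.single j 1))) + V x (φ x)

/-- Ellipticity of the principal symbol `ξ ↦ ∑ⱼ ξⱼ Aⱼ(x)` at every point of `U`. -/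
def IsElliptic {n N : ℕ} (A : Fin n → Euc n → Matrix (Fin N) (Fin N) ℝ)
    (U : Set (Euc n)) : Prop :=
  ∀ x ∈ U, ∀ ξ : Euc n, ξ ≠ 0 → IsUnit (∑ j, ξ j • A j x)

/-- A set `S ⊆ ℝⁿ` is countably `m`-`C^∞`-rectifiable if it is contained in a countable
union of ranges of smooth maps `ℝᵐ → ℝⁿ`. -/
def CountablyCinfRectifiable {n : ℕ} (m : ℕ) (S : Set (Euc n)) : Prop :=
  ∃ g : ℕ → (Euc m → Euc n), (∀ i, ContDiff ℝ (⊤ : ℕ∞) (g i)) ∧ S ⊆ ⋃ i, range (g i)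

/-- The `(n + 1)`-st derivative of `f` evaluated on vectors ending with `u` is the `n`-th
derivative of the directional derivative of `f` in direction `u`. -/
theorem iteratedFDeriv_snoc_apply {E F : Type*} [NormedAddCommGroup E] [NormedSpace ℝ E]
    [NormedAddCommGroup F] [NormedSpace ℝ F] {f : E → F} {p : E}
    (hf : ContDiffAt ℝ (⊤ : ℕ∞) f p) (n : ℕ) (v : Fin (n + 1) → E) :
    iteratedFDeriv ℝ (n + 1) f p v =
      iteratedFDeriv ℝ n (fun x => fderiv ℝ f x (v (Fin.last n))) p (Fin.init v) := by
  have h1 : ContDiffAt ℝ (⊤ : ℕ∞) (fderiv ℝ f) p := hf.fderiv_right (by simp)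
  have h2 := (ContinuousLinearMap.apply ℝ F (v (Fin.last n))).iteratedFDeriv_comp_left h1
    (i := n) (by exact_mod_cast le_top)
  rw [iteratedFDeriv_succ_apply_right]
  exact (congrArg (fun T => T (Fin.init v)) h2).symm

/-- If the `n`-th derivative of `f` at `p` vanishes on the diagonal at some `h ≠ 0` and `f` solves
an elliptic constant coefficient equation to the relevant order at `p`, then it vanishes. -/
theorem iteratedFDeriv_eq_zero_of_apply_diag_eq_zero {E F : Type*}
    [NormedAddCommGroup E] [NormedSpace ℝ E] [NormedAddCommGroup F] [NormedSpace ℝ F]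
    (S : (E →L[ℝ] F) →L[ℝ] F) {p h : E} (hS : ∀ l : E →L[ℝ] F, S l = 0 → l h = 0 → l = 0)
    (n : ℕ) (f : E → F) (hf : ContDiffAt ℝ (⊤ : ℕ∞) f p)
    (hflat : ∀ m, n = m + 1 → iteratedFDeriv ℝ m (fun x => S (fderiv ℝ f x)) p = 0)
    (hh : iteratedFDeriv ℝ n f p (fun _ => h) = 0) :
    iteratedFDeriv ℝ n f p = 0 := by
  induction n generalizing f with
  | zero =>
    ext v
    simpa using hh
  | succ m ih =>
    have hdf : ContDiffAt ℝ (⊤ : ℕ∞) (fderiv ℝ f) p := hf.fderiv_right (by simp)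
    have hflat' := hflat m rfl
    have hcomp := S.iteratedFDeriv_comp_left hdf (i := m) (by exact_mod_cast le_top)
    have hl : iteratedFDeriv ℝ m (fderiv ℝ f) p (fun _ => h) = 0 := by
      apply hS
      · have := congrArg (fun T => T (fun _ => h)) (hcomp.symm.trans hflat')
        simpa using this
      · rw [iteratedFDeriv_succ_apply_right] at hh
        exact hh
    have key : ∀ u : E, iteratedFDeriv ℝ m (fun x => fderiv ℝ f x u) p = 0 := by
      intro u
      apply ih
      · exact hdf.clm_apply contDiffAt_const
      · rintro k rfl
        have hev : (fun x => S (fderiv ℝ (fun y => fderiv ℝ f y u) x)) =ᶠ[𝓝 p]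
            fun x => fderiv ℝ (fun y => S (fderiv ℝ f y)) x u := by
          have h2 : ∀ᶠ x in 𝓝 p, ContDiffAt ℝ 2 f x :=
            (contDiffAt_infty.1 hf 2).eventually (by simp)
          filter_upwards [h2] with x hx
          have hd : DifferentiableAt ℝ (fderiv ℝ f) x :=
            (hx.fderiv_right (m := 1) (by norm_num)).differentiableAt (by simp)
          have hsymm : IsSymmSndFDerivAt ℝ f x := hx.isSymmSndFDerivAt (by simp)
          have e1 : fderiv ℝ (fun y => fderiv ℝ f y u) x = fderiv ℝ (fderiv ℝ f) x u := by
            ext w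
            rw [fderiv_clm_apply hd (by fun_prop)]
            simpa using hsymm.eq w u
          have e2 : fderiv ℝ (fun y => S (fderiv ℝ f y)) x = S ∘L fderiv ℝ (fderiv ℝ f) x :=
            (S.hasFDerivAt.comp x hd.hasFDerivAt).fderiv
          rw [e1, e2]
          rfl
        rw [(hev.iteratedFDeriv ℝ k).eq_of_nhds]
        ext v
        have hg : ContDiffAt ℝ (⊤ : ℕ∞) (fun y => S (fderiv ℝ f y)) p :=
          S.contDiff.contDiffAt.comp p hdf
        have := iteratedFDeriv_snoc_apply hg k (Fin.snoc v u)
        rw [hflat'] at this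
        simpa using this.symm
      · have := iteratedFDeriv_snoc_apply hf m (Fin.snoc (fun _ => h) u)
        rw [iteratedFDeriv_succ_apply_right] at this
        simp only [Fin.init_snoc, Fin.snoc_last] at this
        rw [← this, hl]
        rfl
    ext v
    rw [iteratedFDeriv_snoc_apply hf, key]
    rfl

/-- If the `n`-th derivative of `f` at `p` is the first nonzero one and does not vanish on nonzero
diagonal vectors, then `f` has no other zero near `p`. -/
theorem eventually_ne_zero_of_iteratedFDeriv_diag_ne_zero {E F : Type*}
    [NormedAddCommGroup E] [NormedSpace ℝ E] [FiniteDimensional ℝ E]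
    [NormedAddCommGroup F] [NormedSpace ℝ F] [CompleteSpace F] {f : E → F} {p : E}
    (hf : ContDiffAt ℝ (⊤ : ℕ∞) f p) (n : ℕ) (hlow : ∀ k < n, iteratedFDeriv ℝ k f p = 0)
    (hn : ∀ h ≠ 0, iteratedFDeriv ℝ n f p (fun _ => h) ≠ 0) :
    ∃ ε > 0, ∀ x ∈ ball p ε, x ≠ p → f x ≠ 0 := by
  have : ProperSpace E := FiniteDimensional.proper ℝ E
  set T := iteratedFDeriv ℝ n f p with hT
  obtain ⟨c, hc, hcT⟩ : ∃ c, 0 < c ∧ ∀ h ∈ sphere (0 : E) 1, c ≤ ‖T fun _ => h‖ := by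
    apply (isCompact_sphere (0 : E) 1).exists_forall_le'
    · have : Continuous fun h : E => T fun _ => h := T.cont.comp (by fun_prop)
      exact this.norm.continuousOn
    · intro h hh
      exact norm_pos_iff.2 (hn h (ne_zero_of_mem_unit_sphere ⟨h, hh⟩))
  have hlower : ∀ y : E, y ≠ 0 → c * ‖y‖ ^ n ≤ ‖T fun _ => y‖ := by
    intro y hy
    have hy' : 0 < ‖y‖ := norm_pos_iff.2 hy
    have := hcT (‖y‖⁻¹ • y) (by simp [norm_smul, hy])
    have e := T.map_smul_univ (fun _ => ‖y‖⁻¹) (fun _ => y)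
    simp only [Finset.prod_const, Finset.card_univ, Fintype.card_fin] at e
    rw [e, norm_smul, norm_pow, norm_inv, norm_norm, inv_pow] at this
    rwa [inv_mul_eq_div, le_div_iff₀ (by positivity)] at this
  obtain ⟨C, hC0, δ, hδ, hbd⟩ : ∃ C > 0, ∃ δ > 0, ∀ x ∈ ball p δ,
      ContDiffAt ℝ (n + 1) f x ∧ ‖iteratedFDeriv ℝ (n + 1) f x‖ ≤ C := by
    have h1 : ∀ᶠ x in 𝓝 p, ContDiffAt ℝ (n + 1) f x :=
      (hf.of_le (by exact_mod_cast le_top)).eventually (by exact_mod_cast WithTop.coe_ne_top)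
    have h2 : ContinuousAt (fun x => ‖iteratedFDeriv ℝ (n + 1) f x‖) p :=
      (hf.iteratedFDeriv_right (m := 0) (i := n + 1) (by exact_mod_cast le_top)).continuousAt.norm
    have h3 := h2.eventually_lt_const (lt_add_one _)
    obtain ⟨δ, hδ, h⟩ := Metric.eventually_nhds_iff_ball.1 (h1.and h3)
    exact ⟨‖iteratedFDeriv ℝ (n + 1) f p‖ + 1, by positivity, δ, hδ,
      fun x hx => ⟨(h x hx).1, (h x hx).2.le⟩⟩
  refine ⟨min δ (c / C), lt_min hδ (div_pos hc hC0), fun x hx hxp hfx => ?_⟩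
  obtain ⟨hxδ, hxc⟩ := lt_min_iff.1 (mem_ball.1 hx)
  set y := x - p with hy
  have hy0 : y ≠ 0 := sub_ne_zero.2 hxp
  rw [dist_eq_norm, ← hy] at hxδ hxc
  have hseg : ∀ t ∈ Set.Icc (0 : ℝ) 1, p + t • y ∈ ball p δ := by
    intro t ht
    rw [mem_ball, dist_eq_norm, add_sub_cancel_left, norm_smul, Real.norm_of_nonneg ht.1]
    exact (mul_le_of_le_one_left (norm_nonneg _) ht.2).trans_lt hxδ
  have htaylor := map_add_eq_sum_add_integral_iteratedFDeriv (f := f) (x := p) (y := y) (n := n)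
    fun t ht => (hbd _ (hseg t ht)).1
  have hsum : ∑ k ∈ Finset.range (n + 1),
      (k.factorial : ℝ)⁻¹ • iteratedFDeriv ℝ k f p (fun _ => y) =
        (n.factorial : ℝ)⁻¹ • T fun _ => y := by
    rw [Finset.sum_range_succ, Finset.sum_eq_zero, zero_add]
    intro k hk
    rw [hlow k (Finset.mem_range.1 hk)]
    simp
  rw [hsum, hy, add_sub_cancel, hfx, ← hy, ← smul_add, eq_comm, smul_eq_zero] at htaylor
  have hrem := eq_neg_of_add_eq_zero_left (htaylor.resolve_left (by positivity))
  have hint : ‖∫ t in (0 : ℝ)..1, (1 - t) ^ n • iteratedFDeriv ℝ (n + 1) f (p + t • y)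
      (fun _ => y)‖ ≤ C * ‖y‖ ^ (n + 1) * |1 - 0| := by
    apply intervalIntegral.norm_integral_le_of_norm_le_const
    intro t ht
    rw [uIoc_of_le zero_le_one] at ht
    have h1 := (hbd _ (hseg t ⟨ht.1.le, ht.2⟩)).2
    have h2 : ‖iteratedFDeriv ℝ (n + 1) f (p + t • y) (fun _ => y)‖ ≤ C * ‖y‖ ^ (n + 1) := by
      refine ((iteratedFDeriv ℝ (n + 1) f (p + t • y)).le_opNorm _).trans ?_
      simp only [Finset.prod_const, Finset.card_univ, Fintype.card_fin]
      gcongr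
    rw [norm_smul, norm_pow, Real.norm_of_nonneg (by linarith [ht.2])]
    exact (mul_le_of_le_one_left (norm_nonneg _)
      (pow_le_one₀ (by linarith [ht.2]) (by linarith [ht.1]))).trans h2
  have hlo := hlower y hy0
  rw [hrem, norm_neg] at hlo
  have hyp : 0 < ‖y‖ ^ n := pow_pos (norm_pos_iff.2 hy0) n
  rw [lt_div_iff₀ hC0] at hxc
  have h4 := hlo.trans hint
  rw [sub_zero, abs_one, mul_one, pow_succ] at h4
  nlinarith

/-- The `m`-th derivative at `p` of `x ↦ f x (g x)` vanishes if `f p = 0` and `g` vanishes to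
order `m` at `p`. -/
theorem iteratedFDeriv_clm_apply_eq_zero {E F G : Type*}
    [NormedAddCommGroup E] [NormedSpace ℝ E] [NormedAddCommGroup F] [NormedSpace ℝ F]
    [NormedAddCommGroup G] [NormedSpace ℝ G] {f : E → F →L[ℝ] G} {g : E → F} {U : Set E} {p : E}
    (hU : IsOpen U) (hp : p ∈ U) (hf : ContDiffOn ℝ (⊤ : ℕ∞) f U)
    (hg : ContDiffOn ℝ (⊤ : ℕ∞) g U) (m : ℕ) (hfp : f p = 0)
    (hgp : ∀ k < m, iteratedFDeriv ℝ k g p = 0) :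
    iteratedFDeriv ℝ m (fun x => f x (g x)) p = 0 := by
  have h := norm_iteratedFDerivWithin_clm_apply (n := m) hf hg hU.uniqueDiffOn hp
    (by exact_mod_cast le_top)
  rw [iteratedFDerivWithin_of_isOpen _ hU hp] at h
  rw [← norm_le_zero_iff]
  refine h.trans (Finset.sum_nonpos fun i hi => ?_)
  rw [iteratedFDerivWithin_of_isOpen _ hU hp, iteratedFDerivWithin_of_isOpen _ hU hp]
  rcases Nat.eq_zero_or_pos i with rfl | hi0
  · simp [hfp]
  · have : i ≤ m := Nat.lt_succ_iff.1 (Finset.mem_range.1 hi)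
    simp [hgp (m - i) (by omega)]

/-- Derivatives of a composition depend only on the jet of the inner function. -/
theorem iteratedFDeriv_comp_congr {E F G : Type*}
    [NormedAddCommGroup E] [NormedSpace ℝ E] [NormedAddCommGroup F] [NormedSpace ℝ F]
    [NormedAddCommGroup G] [NormedSpace ℝ G] {g : F → G} {f₁ f₂ : E → F} {p : E}
    (hg : ContDiffAt ℝ (⊤ : ℕ∞) g (f₁ p)) (hf₁ : ContDiffAt ℝ (⊤ : ℕ∞) f₁ p)
    (hf₂ : ContDiffAt ℝ (⊤ : ℕ∞) f₂ p) (h0 : f₁ p = f₂ p) (m : ℕ)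
    (h : ∀ k ≤ m, iteratedFDeriv ℝ k f₁ p = iteratedFDeriv ℝ k f₂ p) :
    iteratedFDeriv ℝ m (g ∘ f₁) p = iteratedFDeriv ℝ m (g ∘ f₂) p := by
  rw [iteratedFDeriv_comp hg hf₁ (by exact_mod_cast le_top),
    iteratedFDeriv_comp (h0 ▸ hg) hf₂ (by exact_mod_cast le_top), h0]
  refine Finset.sum_congr rfl fun c _ => ?_
  have : (fun i => ftaylorSeries ℝ f₁ p (c.partSize i)) =
      fun i => ftaylorSeries ℝ f₂ p (c.partSize i) :=
    funext fun i => h _ (c.partSize_le i)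
  exact congrArg (c.compAlongOrderedFinpartition (ftaylorSeries ℝ g (f₂ p) c.length)) this

/-- If `V` vanishes along the zero section, then `x ↦ V x (φ x)` vanishes at `p` to the order
of `φ`. -/
theorem iteratedFDeriv_zero_section_comp_eq_zero {E F G : Type*}
    [NormedAddCommGroup E] [NormedSpace ℝ E] [NormedAddCommGroup F] [NormedSpace ℝ F]
    [NormedAddCommGroup G] [NormedSpace ℝ G] {V : E → F → G} {φ : E → F} {p : E}
    (hV : ContDiffAt ℝ (⊤ : ℕ∞) (fun q : E × F => V q.1 q.2) (p, 0))
    (hV0 : ∀ᶠ x in 𝓝 p, V x 0 = 0) (hφ : ContDiffAt ℝ (⊤ : ℕ∞) φ p) (m : ℕ)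
    (h : ∀ k ≤ m, iteratedFDeriv ℝ k φ p = 0) :
    iteratedFDeriv ℝ m (fun x => V x (φ x)) p = 0 := by
  have hφp : φ p = 0 := by
    have := congrArg (fun T => T 0) (h 0 (Nat.zero_le m))
    simpa using this
  have hinl : ContDiffAt ℝ (⊤ : ℕ∞) (fun x : E => (x, (0 : F))) p :=
    contDiffAt_id.prodMk contDiffAt_const
  have hinr : ContDiffAt ℝ (⊤ : ℕ∞) (ContinuousLinearMap.inr ℝ E F ∘ φ) p :=
    (ContinuousLinearMap.inr ℝ E F).contDiff.contDiffAt.comp p hφ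
  have hgraph : (fun x => (x, φ x)) =
      (fun x : E => (x, (0 : F))) + ContinuousLinearMap.inr ℝ E F ∘ φ := by
    ext x <;> simp
  have hcongr := iteratedFDeriv_comp_congr (g := fun q : E × F => V q.1 q.2)
    (f₁ := fun x => (x, φ x)) (f₂ := fun x => (x, 0)) (p := p) (by simpa [hφp] using hV)
    (contDiffAt_id.prodMk hφ) hinl (by simp [hφp]) m fun k hk => by
      rw [hgraph, iteratedFDeriv_add_apply (hinl.of_le (by exact_mod_cast le_top))
        (hinr.of_le (by exact_mod_cast le_top)),
        (ContinuousLinearMap.inr ℝ E F).iteratedFDeriv_comp_left hφ (by exact_mod_cast le_top),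
        h k hk]
      ext v <;> simp
  have hzero : (fun q : E × F => V q.1 q.2) ∘ (fun x => (x, 0)) =ᶠ[𝓝 p] fun _ => 0 := hV0
  exact hcongr.trans ((hzero.iteratedFDeriv ℝ m).eq_of_nhds.trans (by simp))

/-- The principal part `l ↦ ∑ⱼ Aⱼ(x) l(eⱼ)` at `x`, acting on first derivatives. -/
def principalPart {n N : ℕ} (A : Fin n → Euc n → Matrix (Fin N) (Fin N) ℝ) (x : Euc n) :
    (Euc n →L[ℝ] (Fin N → ℝ)) →L[ℝ] (Fin N → ℝ) :=
  ∑ j, (LinearMap.toContinuousLinearMap (A j x).mulVecLin) ∘L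
    ContinuousLinearMap.apply ℝ (Fin N → ℝ) (EuclideanSpace.single j (1 : ℝ))

theorem principalPart_apply {n N : ℕ} (A : Fin n → Euc n → Matrix (Fin N) (Fin N) ℝ)
    (x : Euc n) (l : Euc n →L[ℝ] (Fin N → ℝ)) :
    principalPart A x l = ∑ j, (A j x).mulVec (l (EuclideanSpace.single j 1)) := by
  simp [principalPart]

theorem contDiffOn_principalPart {n N : ℕ} {A : Fin n → Euc n → Matrix (Fin N) (Fin N) ℝ}
    {U : Set (Euc n)} (hA : ∀ j i l, ContDiffOn ℝ (⊤ : ℕ∞) (fun x => A j x i l) U) :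
    ContDiffOn ℝ (⊤ : ℕ∞) (principalPart A) U := by
  rw [contDiffOn_clm_apply]
  intro l
  simp only [principalPart_apply]
  refine ContDiffOn.sum fun j _ => contDiffOn_pi.2 fun i => ?_
  simp only [Matrix.mulVec, dotProduct]
  exact ContDiffOn.sum fun k _ => (hA j i k).mul contDiffOn_const

/-- In dimension two, a linear map annihilated by the principal part of an elliptic operator and
vanishing on a nonzero vector is zero. -/
theorem IsElliptic.eq_zero_of_principalPart_eq_zero {N : ℕ}
    {A : Fin 2 → Euc 2 → Matrix (Fin N) (Fin N) ℝ} {U : Set (Euc 2)} (hell : IsElliptic A U)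
    {p h : Euc 2} (hp : p ∈ U) (hh : h ≠ 0) {l : Euc 2 →L[ℝ] (Fin N → ℝ)}
    (hl : principalPart A p l = 0) (hlh : l h = 0) : l = 0 := by
  have hdecomp (v : Euc 2) :
      v = v 0 • EuclideanSpace.single 0 (1 : ℝ) + v 1 • EuclideanSpace.single 1 (1 : ℝ) := by
    ext i
    fin_cases i <;> simp
  have hξ : !₂[-h 1, h 0] ≠ (0 : Euc 2) := by
    intro h0
    apply hh
    have e0 := congrArg (fun v : Euc 2 => v 0) h0
    have e1 := congrArg (fun v : Euc 2 => v 1) h0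
    simp at e0 e1
    ext i
    fin_cases i <;> simp [e0, e1]
  have hunit := hell p hp _ hξ
  simp only [Fin.sum_univ_two, Matrix.cons_val_zero, Matrix.cons_val_one] at hunit
  have hinj := Matrix.mulVec_injective_iff_isUnit.2 hunit
  rw [principalPart_apply, Fin.sum_univ_two] at hl
  rw [hdecomp h, map_add, map_smul, map_smul] at hlh
  set a := l (EuclideanSpace.single 0 1)
  set b := l (EuclideanSpace.single 1 1)
  have hA0 : h 0 • (A 0 p).mulVec a + h 1 • (A 0 p).mulVec b = 0 := by
    rw [← Matrix.mulVec_smul, ← Matrix.mulVec_smul, ← Matrix.mulVec_add, hlh, Matrix.mulVec_zero]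
  have hA1 : h 0 • (A 1 p).mulVec a + h 1 • (A 1 p).mulVec b = 0 := by
    rw [← Matrix.mulVec_smul, ← Matrix.mulVec_smul, ← Matrix.mulVec_add, hlh, Matrix.mulVec_zero]
  have ha : a = 0 := by
    apply hinj
    rw [Matrix.mulVec_zero, Matrix.add_mulVec, Matrix.smul_mulVec, Matrix.smul_mulVec]
    linear_combination (norm := module) hA1 - h 1 • hl
  have hb : b = 0 := by
    apply hinj
    rw [Matrix.mulVec_zero, Matrix.add_mulVec, Matrix.smul_mulVec, Matrix.smul_mulVec]
    linear_combination (norm := module) h 0 • hl - hA0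
  ext1 v
  rw [hdecomp v, map_add, map_smul, map_smul]
  change v 0 • a + v 1 • b = _
  simp [ha, hb]

/-- For a smooth solution `φ` of a semilinear elliptic first-order system
respecting the zero section on an open connected `U ⊆ ℝ²`, every zero of `φ` of finite
order is an isolated point of the zero set `N(φ)`. -/
theorem finite_order_zeros_isolated_dim_two
    (N : ℕ) (hN : 1 ≤ N)
    (U : Set (Euc 2)) (hUopen : IsOpen U) (hUconn : IsConnected U)
    (A : Fin 2 → Euc 2 → Matrix (Fin N) (Fin N) ℝ)
    (hA : ∀ j i l, ContDiffOn ℝ (⊤ : ℕ∞) (fun x => A j x i l) U)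
    (hell : IsElliptic A U)
    (V : Euc 2 → (Fin N → ℝ) → (Fin N → ℝ))
    (hV : ContDiffOn ℝ (⊤ : ℕ∞) (fun p : Euc 2 × (Fin N → ℝ) => V p.1 p.2) (U ×ˢ univ))
    (hV0 : ∀ x ∈ U, V x 0 = 0)
    (φ : Euc 2 → (Fin N → ℝ)) (hφ : ContDiffOn ℝ (⊤ : ℕ∞) φ U)
    (heq : ∀ x ∈ U, semilinApply A V φ x = 0)
    (p : Euc 2) (hp : p ∈ U) (hp0 : φ p = 0)
    (hfin : ∃ k, iteratedFDeriv ℝ k φ p ≠ 0) :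
    ∃ ε > 0, {x ∈ U | φ x = 0} ∩ ball p ε = {p} := by
  classical
  have hUp : U ∈ 𝓝 p := hUopen.mem_nhds hp
  have hφp : ContDiffAt ℝ (⊤ : ℕ∞) φ p := hφ.contDiffAt hUp
  have hlow : ∀ k < Nat.find hfin, iteratedFDeriv ℝ k φ p = 0 :=
    fun k hk => not_not.1 (Nat.find_min hfin hk)
  have hn := Nat.find_spec hfin
  set n := Nat.find hfin
  have hdφ : ContDiffOn ℝ (⊤ : ℕ∞) (fderiv ℝ φ) U := hφ.fderiv_of_isOpen hUopen (by simp)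
  have hS := contDiffOn_principalPart hA
  have hflat : ∀ m, n = m + 1 →
      iteratedFDeriv ℝ m (fun x => principalPart A p (fderiv ℝ φ x)) p = 0 := by
    intro m hm
    have h1 : iteratedFDeriv ℝ m
        (fun x => (principalPart A p - principalPart A x) (fderiv ℝ φ x)) p = 0 := by
      refine iteratedFDeriv_clm_apply_eq_zero hUopen hp (contDiffOn_const.sub hS) hdφ m
        (sub_self _) fun k hk => ?_
      rw [← norm_eq_zero, norm_iteratedFDeriv_fderiv, hlow (k + 1) (by omega), norm_zero]
    have hVp : ContDiffAt ℝ (⊤ : ℕ∞) (fun q : Euc 2 × (Fin N → ℝ) => V q.1 q.2) (p, 0) :=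
      hV.contDiffAt (prod_mem_nhds hUp univ_mem)
    have h2 : iteratedFDeriv ℝ m (fun x => V x (φ x)) p = 0 :=
      iteratedFDeriv_zero_section_comp_eq_zero hVp (Filter.mem_of_superset hUp hV0) hφp m
        fun k hk => hlow k (by omega)
    have hev : (fun x => principalPart A p (fderiv ℝ φ x)) =ᶠ[𝓝 p]
        (fun x => (principalPart A p - principalPart A x) (fderiv ℝ φ x)) -
          fun x => V x (φ x) := by
      filter_upwards [hUp] with x hx
      have hx0 := heq x hx
      rw [semilinApply, ← principalPart_apply] at hx0
      simp only [Pi.sub_apply, _root_.sub_apply]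
      rw [sub_sub, hx0, sub_zero]
    have hc1 : ContDiffAt ℝ (⊤ : ℕ∞)
        (fun x => (principalPart A p - principalPart A x) (fderiv ℝ φ x)) p :=
      ((contDiffOn_const.sub hS).clm_apply hdφ).contDiffAt hUp
    have hc2 : ContDiffAt ℝ (⊤ : ℕ∞) (fun x => V x (φ x)) p := by
      rw [← hp0] at hVp
      exact hVp.comp p (contDiffAt_id.prodMk hφp)
    rw [(hev.iteratedFDeriv ℝ m).eq_of_nhds,
      iteratedFDeriv_sub_apply (hc1.of_le (by exact_mod_cast le_top))
        (hc2.of_le (by exact_mod_cast le_top)), h1, h2, sub_zero]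
  obtain ⟨ε, hε, h⟩ := eventually_ne_zero_of_iteratedFDeriv_diag_ne_zero hφp n hlow
    fun h hh h0 => hn (iteratedFDeriv_eq_zero_of_apply_diag_eq_zero (principalPart A p)
      (fun _ hl hlh => hell.eq_zero_of_principalPart_eq_zero hp hh hl hlh) n φ hφp hflat h0)
  refine ⟨ε, hε, Set.Subset.antisymm (fun x hx => ?_) ?_⟩
  · by_contra hxp
    exact h x hx.2 hxp hx.1.2
  · rintro x rfl
    exact ⟨⟨hp, hp0⟩, mem_ball_self hε⟩
end
end

section
/- Let n ≥ 2 and N ≥ 1, let U ⊆ ℝⁿ be open and connected, and let (A₁,…,A_n, V) be a semilinear elliptic first-order system respecting the zero section on U which has the strong unique continuation property. Let φ : U → ℝ^N be a smooth solution of ∑ⱼ Aⱼ(x)(∂φ/∂xⱼ)(x) + V(x, φ(x)) = 0 with φ not identically zero. Then the full zero set N(φ) is countably (n−2)-C∞-rectifiable and has locally finite (n−2)-dimensional Hausdorff measure: every p ∈ U admits r > 0 with μH^{n−2}(N(φ) ∩ B(p,r)) < ∞. In particular dimH(N(φ)) ≤ n − 2. -/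
open MeasureTheory Metric Set Filter Topology ENNReal NNReal

noncomputable section

/-- The strong unique continuation property for a semilinear system on `U`:
every smooth local solution on an open connected `W ⊆ U` vanishing to infinite
order at some point of `W` vanishes identically on `W`. -/
def HasSUCP {n N : ℕ} (A : Fin n → Euc n → Matrix (Fin N) (Fin N) ℝ)
    (V : Euc n → (Fin N → ℝ) → (Fin N → ℝ)) (U : Set (Euc n)) : Prop :=
  ∀ W ⊆ U, IsOpen W → IsConnected W → ∀ ψ : Euc n → (Fin N → ℝ),
    ContDiffOn ℝ (⊤ : ℕ∞) ψ W → (∀ x ∈ W, semilinApply A V ψ x = 0) →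
    (∃ p ∈ W, ∀ k, iteratedFDeriv ℝ k ψ p = 0) → ∀ x ∈ W, ψ x = 0

section Symmetry

variable {E F : Type*} [NormedAddCommGroup E] [NormedSpace ℝ E]
  [NormedAddCommGroup F] [NormedSpace ℝ F]

/-- A multilinear map all of whose arguments may be permuted. -/
def IsSymmMultilinear {j : ℕ} (T : E [×j]→L[ℝ] F) : Prop :=
  ∀ (σ : Equiv.Perm (Fin j)) (w : Fin j → E), T (w ∘ σ) = T w

lemma ContDiff.iteratedFDeriv_smooth {f : E → F} (hf : ContDiff ℝ (⊤ : ℕ∞) f) (k : ℕ) :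
    ContDiff ℝ (⊤ : ℕ∞) (iteratedFDeriv ℝ k f) :=
  hf.iteratedFDeriv_right (by exact_mod_cast le_top)

lemma ContDiff.iteratedFDeriv_differentiable {f : E → F} (hf : ContDiff ℝ (⊤ : ℕ∞) f) (k : ℕ) :
    Differentiable ℝ (iteratedFDeriv ℝ k f) :=
  (hf.iteratedFDeriv_smooth k).differentiable (by simp)

lemma iteratedFDeriv_swap_zero_one {f : E → F} (hf : ContDiff ℝ (⊤ : ℕ∞) f) (k : ℕ) (x : E)
    (a b : E) (w : Fin k → E) :
    iteratedFDeriv ℝ (k + 2) f x (Fin.cons a (Fin.cons b w : Fin (k + 1) → E))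
      = iteratedFDeriv ℝ (k + 2) f x (Fin.cons b (Fin.cons a w : Fin (k + 1) → E)) := by
  have key : ∀ a b : E, iteratedFDeriv ℝ (k + 2) f x (Fin.cons a (Fin.cons b w : Fin (k + 1) → E))
      = fderiv ℝ (fderiv ℝ (iteratedFDeriv ℝ k f)) x a b w := by
    intro a b
    rw [iteratedFDeriv_succ_apply_left]
    simp only [Fin.cons_zero, Fin.tail_cons]
    have h1 : HasFDerivAt (iteratedFDeriv ℝ (k + 1) f)
        (fderiv ℝ (iteratedFDeriv ℝ (k + 1) f) x) x :=
      (hf.iteratedFDeriv_differentiable (k + 1) x).hasFDerivAt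
    have h2 := h1.continuousMultilinear_apply_const (Fin.cons b w : Fin (k + 1) → E)
    have h3 : (fun y => iteratedFDeriv ℝ (k + 1) f y (Fin.cons b w : Fin (k + 1) → E))
        = fun y => fderiv ℝ (iteratedFDeriv ℝ k f) y b w := by
      funext y
      rw [iteratedFDeriv_succ_apply_left]
      simp
    rw [h3] at h2
    have h4 : DifferentiableAt ℝ (fderiv ℝ (iteratedFDeriv ℝ k f)) x :=
      ((hf.iteratedFDeriv_smooth k).fderiv_right (m := (⊤ : ℕ∞)) (by simp)).differentiable
        (by simp) x
    have h5 := (h4.hasFDerivAt.clm_apply (hasFDerivAt_const b x)).continuousMultilinear_apply_const w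
    have := congrArg (fun L => L a) (h2.unique h5)
    simpa using this
  rw [key, key]
  have := ((hf.iteratedFDeriv_smooth k).contDiffAt (x := x)).isSymmSndFDerivAt
    (by simpa using WithTop.coe_le_coe.2 (le_top : (2 : ℕ∞) ≤ ⊤))
  rw [this a b]

theorem isSymmMultilinear_iteratedFDeriv {f : E → F} (hf : ContDiff ℝ (⊤ : ℕ∞) f) (k : ℕ) (x : E) :
    IsSymmMultilinear (iteratedFDeriv ℝ k f x) := by
  cases k with
  | zero => intro σ w; congr 1; exact Subsingleton.elim _ _
  | succ k =>
  have adj : ∀ (k : ℕ) (x : E) (i : Fin k) (w : Fin (k + 1) → E),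
      iteratedFDeriv ℝ (k + 1) f x (w ∘ Equiv.swap i.castSucc i.succ)
        = iteratedFDeriv ℝ (k + 1) f x w := by
    intro k
    induction k with
    | zero => intro x i; exact i.elim0
    | succ k ih =>
      intro x i w
      refine Fin.cases ?_ (fun i => ?_) i
      · obtain ⟨a, w, rfl⟩ : ∃ a w', w = (Fin.cons a w' : Fin (k + 2) → E) :=
          ⟨w 0, Fin.tail w, (Fin.cons_self_tail w).symm⟩
        obtain ⟨b, w, rfl⟩ : ∃ a w', w = (Fin.cons a w' : Fin (k + 1) → E) :=
          ⟨w 0, Fin.tail w, (Fin.cons_self_tail w).symm⟩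
        rw [iteratedFDeriv_swap_zero_one hf]
        congr 1
        funext s
        refine Fin.cases ?_ (fun s => ?_) s
        · simp
        · refine Fin.cases ?_ (fun s => ?_) s
          · simp
          · simp only [Function.comp_apply, Fin.cons_succ]
            rw [Equiv.swap_apply_of_ne_of_ne]
            · simp
            · simp
            · simp [Fin.ext_iff]
      · have h1 : ∀ u : Fin (k + 2) → E, iteratedFDeriv ℝ (k + 2) f x u
            = fderiv ℝ (fun y => iteratedFDeriv ℝ (k + 1) f y (Fin.tail u)) x (u 0) := by
          intro u
          rw [iteratedFDeriv_succ_apply_left]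
          rw [((hf.iteratedFDeriv_differentiable (k + 1)
            x).hasFDerivAt.continuousMultilinear_apply_const (Fin.tail u)).fderiv]
          rfl
        rw [h1, h1]
        have h2 : Fin.tail (w ∘ Equiv.swap i.succ.castSucc i.succ.succ)
            = Fin.tail w ∘ Equiv.swap i.castSucc i.succ := by
          funext s
          simp only [Fin.tail, Function.comp_apply]
          congr 1
          rw [← Fin.succ_castSucc]
          exact (Fin.succ_injective _).swap_apply _ _ _
        rw [h2]
        simp only [ih]
        congr 2
  intro σ
  have hσ : σ ∈ Submonoid.closure (Set.range fun i : Fin k => Equiv.swap i.castSucc i.succ) := by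
    rw [Equiv.Perm.mclosure_swap_castSucc_succ]; trivial
  induction hσ using Submonoid.closure_induction with
  | mem σ h => obtain ⟨i, rfl⟩ := h; exact adj k x i
  | one => intro w; rfl
  | mul σ τ _ _ h1 h2 =>
    intro w
    have : w ∘ ⇑(σ * τ) = (w ∘ σ) ∘ τ := rfl
    rw [this, h2, h1]

end Symmetry

section Algebra

variable {F : Type*} [NormedAddCommGroup F] [NormedSpace ℝ F] {n : ℕ}

/-- Injectivity of the symbol `∑ ξₗ aₗ` for all nonzero covectors `ξ`. -/
def EllipticSymbol (a : Fin n → F →L[ℝ] F) : Prop :=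
  ∀ ξ : Euc n, ξ ≠ 0 → ∀ b : F, ∑ l, ξ l • a l b = 0 → b = 0

lemma linearMap_eq_zero_of_symbol {a : Fin n → F →L[ℝ] F} (ha : EllipticSymbol a)
    (L : Euc n →ₗ[ℝ] F) (hL : ∑ l, a l (L (EuclideanSpace.single l 1)) = 0)
    (K : Submodule ℝ (Euc n)) (hK : K ≤ LinearMap.ker L) (hKn : n ≤ Module.finrank ℝ K + 1) :
    L = 0 := by
  have h1 := L.finrank_range_add_finrank_ker
  rw [finrank_euclideanSpace_fin] at h1
  have h2 := Submodule.finrank_mono hK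
  have h3 : Module.finrank ℝ (LinearMap.range L) ≤ 1 := by omega
  obtain ⟨b, hb⟩ := finrank_le_one_iff.1 h3
  choose c hc using fun l : Fin n => hb ⟨L (EuclideanSpace.single l 1), LinearMap.mem_range_self _ _⟩
  have hc' : ∀ l, L (EuclideanSpace.single l 1) = c l • (b : F) := fun l => by
    have := congrArg Subtype.val (hc l)
    simpa using this.symm
  have hzero : ∀ l, L (EuclideanSpace.single l 1) = 0 := by
    intro l
    by_cases hξ : WithLp.toLp 2 c = (0 : Euc n)
    · have : c l = 0 := by simpa using congrArg (fun v : Euc n => v l) hξ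
      rw [hc', this, zero_smul]
    · have hb0 : (b : F) = 0 := by
        apply ha _ hξ
        rw [← hL]
        refine Finset.sum_congr rfl fun l _ => ?_
        rw [hc', map_smul]
      rw [hc', hb0, smul_zero]
  refine (EuclideanSpace.basisFun (Fin n) ℝ).toBasis.ext fun l => ?_
  simpa using hzero l

/-- The vectors annihilating a multilinear map when inserted in its first argument. -/
def multilinearKer {j : ℕ} (T : Euc n [×(j + 1)]→L[ℝ] F) : Submodule ℝ (Euc n) :=
  LinearMap.ker (T.curryLeft : Euc n →ₗ[ℝ] (Euc n [×j]→L[ℝ] F))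

lemma mem_multilinearKer {j : ℕ} {T : Euc n [×(j + 1)]→L[ℝ] F} {v : Euc n} :
    v ∈ multilinearKer T ↔ ∀ w : Fin j → Euc n, T (Fin.cons v w) = 0 := by
  simp only [multilinearKer, LinearMap.mem_ker]
  constructor
  · intro h w
    have := congrArg (fun S => S w) h
    simpa using this
  · intro h
    ext w
    simpa using h w

lemma finrank_multilinearKer_le {a : Fin n → F →L[ℝ] F} (ha : EllipticSymbol a) {j : ℕ}
    {T : Euc n [×(j + 1)]→L[ℝ] F} (hT : T ≠ 0)
    (heq : ∀ w : Fin j → Euc n,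
      ∑ l, a l (T (Fin.cons (EuclideanSpace.single l 1) w)) = 0) :
    Module.finrank ℝ (multilinearKer T) + 2 ≤ n := by
  by_contra hcon
  apply hT
  ext w
  have := linearMap_eq_zero_of_symbol ha
    ((ContinuousMultilinearMap.apply ℝ (fun _ : Fin j => Euc n) F (Fin.tail w)).toLinearMap ∘ₗ
      (T.curryLeft : Euc n →ₗ[ℝ] (Euc n [×j]→L[ℝ] F))) (by simpa using heq (Fin.tail w))
    (multilinearKer T) (fun v hv => by simpa using mem_multilinearKer.1 hv _) (by omega)
  have := congrArg (fun L => L (w 0)) this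
  simpa using this

lemma IsSymmMultilinear.update_eq {j : ℕ} {T : Euc n [×(j + 1)]→L[ℝ] F}
    (hT : IsSymmMultilinear T) (f : Fin (j + 1) → Euc n) (s : Fin (j + 1)) (u : Euc n) :
    T (Function.update f s u) = T (Fin.cons u (Fin.tail (f ∘ Equiv.swap 0 s))) := by
  rw [← hT (Equiv.swap 0 s) (Function.update f s u)]
  congr 1
  funext i
  refine Fin.cases ?_ (fun i => ?_) i
  · simp
  · simp only [Function.comp_apply, Fin.cons_succ, Fin.tail]
    rw [Function.update_of_ne]
    intro h
    have := congrArg (Equiv.swap 0 s) h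
    simp at this

lemma mem_multilinearKer_of_apply_diag {a : Fin n → F →L[ℝ] F} (ha : EllipticSymbol a) {j : ℕ}
    {T : Euc n [×(j + 1)]→L[ℝ] F} (hsymm : IsSymmMultilinear T)
    (heq : ∀ w : Fin j → Euc n,
      ∑ l, a l (T (Fin.cons (EuclideanSpace.single l 1) w)) = 0)
    (hrank : n ≤ Module.finrank ℝ (multilinearKer T) + 2)
    {v : Euc n} (hv : T (fun _ => v) = 0) : v ∈ multilinearKer T := by
  by_contra hvK
  have key : ∀ (d : ℕ) (f : Fin (j + 1) → Euc n),
      (Finset.univ.filter fun s => f s ≠ v).card ≤ d → T f = 0 := by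
    intro d
    induction d with
    | zero =>
      intro f hf
      have : f = fun _ => v := by
        funext s
        simp only [nonpos_iff_eq_zero, Finset.card_eq_zero, Finset.filter_eq_empty_iff] at hf
        simpa using hf (Finset.mem_univ s)
      rw [this, hv]
    | succ d ih =>
      intro f hf
      by_cases hfv : ∃ s, f s ≠ v
      · obtain ⟨s, hs⟩ := hfv
        set L : Euc n →ₗ[ℝ] F := T.toMultilinearMap.toLinearMap f s with hLdef
        have hLapp : ∀ u, L u = T (Function.update f s u) := fun u => rfl
        have hLv : L v = 0 := by
          rw [hLapp]
          apply ih
          have hsub : (Finset.univ.filter fun i => Function.update f s v i ≠ v)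
              ⊆ (Finset.univ.filter fun i => f i ≠ v).erase s := by
            intro i hi
            simp only [Finset.mem_filter, Finset.mem_univ, true_and, Finset.mem_erase] at hi ⊢
            by_cases his : i = s
            · subst his; simp at hi
            · rw [Function.update_of_ne his] at hi; exact ⟨his, hi⟩
          have h1 := Finset.card_le_card hsub
          rw [Finset.card_erase_of_mem (by simpa using hs)] at h1
          omega
        have hL0 : L = 0 := by
          refine linearMap_eq_zero_of_symbol ha L ?_ (multilinearKer T ⊔ ℝ ∙ v) ?_ ?_
          · simp only [hLapp, hsymm.update_eq]
            exact heq _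
          · refine sup_le ?_ ?_
            · intro u hu
              rw [LinearMap.mem_ker, hLapp, hsymm.update_eq]
              exact mem_multilinearKer.1 hu _
            · rw [Submodule.span_singleton_le_iff_mem]
              exact hLv
          · have hlt : multilinearKer T < multilinearKer T ⊔ ℝ ∙ v := by
              refine lt_of_le_of_ne le_sup_left fun h => hvK ?_
              rw [h]
              exact Submodule.mem_sup_right (Submodule.mem_span_singleton_self v)
            have := Submodule.finrank_lt_finrank_of_lt hlt
            omega
        have := hLapp (f s)
        rw [hL0, Function.update_eq_self] at this
        simpa using this.symm
      · push Not at hfv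
        rw [show f = fun _ => v from funext hfv, hv]
  exact hvK (mem_multilinearKer.2 fun w => key (j + 1) _ ((Finset.card_le_univ _).trans (by simp)))

lemma exists_continuousLinearMap_injOn (K : Submodule ℝ (Euc n)) {d : ℕ}
    (hd : Module.finrank ℝ K ≤ d) :
    ∃ π : Euc n →L[ℝ] (Fin d → ℝ), ∀ v ∈ K, π v = 0 → v = 0 := by
  have e : K ≃ₗ[ℝ] (Fin (Module.finrank ℝ K) → ℝ) := (Module.finBasis ℝ K).equivFun
  let L : K →ₗ[ℝ] (Fin d → ℝ) :=
    (Function.ExtendByZero.linearMap ℝ (Fin.castLE hd)) ∘ₗ e.toLinearMap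
  obtain ⟨π, hπ⟩ := L.exists_extend
  refine ⟨LinearMap.toContinuousLinearMap π, fun v hv h => ?_⟩
  have h1 : L ⟨v, hv⟩ = 0 := by
    rw [← hπ]; simpa using h
  have h2 : e ⟨v, hv⟩ = 0 := by
    funext i
    have := congrFun h1 (Fin.castLE hd i)
    simpa [L, (Fin.castLE_injective hd).extend_apply] using this
  simpa using h2

end Algebra

section Covering

lemma tsum_ofReal_pow_le_of_pairwiseDisjoint {X : Type*} {d : ℕ} {u : Set X} (hu : u.Countable)
    {f : X → Fin d → ℝ} {s : X → ℝ} (hs : ∀ b ∈ u, 0 ≤ s b) {z : Fin d → ℝ} {R : ℝ} (hR : 0 ≤ R)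
    (hdisj : u.PairwiseDisjoint fun b => closedBall (f b) (s b))
    (hsub : ∀ b ∈ u, closedBall (f b) (s b) ⊆ closedBall z R) :
    ∑' b : u, ENNReal.ofReal (s b) ^ d ≤ ENNReal.ofReal R ^ d := by
  have hvol : ∀ (y : Fin d → ℝ) (r : ℝ), 0 ≤ r →
      volume (closedBall y r) = 2 ^ d * ENNReal.ofReal r ^ d := by
    intro y r hr
    rw [Real.volume_pi_closedBall y hr, ENNReal.ofReal_pow (by positivity),
      ENNReal.ofReal_mul (by norm_num), mul_pow]
    simp
  have h1 : volume (⋃ b ∈ u, closedBall (f b) (s b)) ≤ volume (closedBall z R) :=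
    measure_mono (iUnion₂_subset hsub)
  rw [measure_biUnion hu hdisj (fun b _ => measurableSet_closedBall), hvol z R hR] at h1
  have h2 : ∑' b : u, volume (closedBall (f b) (s b))
      = 2 ^ d * ∑' b : u, ENNReal.ofReal (s b) ^ d := by
    rw [← ENNReal.tsum_mul_left]
    exact tsum_congr fun b => hvol _ _ (hs b b.2)
  rw [h2] at h1
  exact (ENNReal.mul_le_mul_iff_right (by positivity) (by simp)).1 h1

/-- A Vitali-type covering estimate: a set carrying a scale function `s`, whose pieces of size
comparable to `s` have controlled measure and whose projections `f` separate points at scale `s`,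
has measure controlled by a sum over a family with disjoint projected balls. -/
lemma exists_measure_le_tsum_of_scale {n : ℕ} (μ : Measure (Euc n)) (m : ℕ) {c c₁ : ℝ}
    (hc : 0 < c) (hc₁ : 0 < c₁) (K : ℝ) :
    ∃ M : ℝ≥0∞, M ≠ ⊤ ∧ ∀ {d : ℕ} (S : Set (Euc n)) (s : Euc n → ℝ) (f : Euc n → Fin d → ℝ)
      (a R : ℝ) (C : ℝ≥0∞), 0 < a → (∀ y ∈ S, 0 < s y) → (∀ y ∈ S, s y ≤ R) →
      (∀ y ∈ S, μ (S ∩ ball y (c * s y)) ≤ C * ENNReal.ofReal (s y) ^ m) →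
      (∀ y ∈ S, ∀ y' ∈ S, dist (f y) (f y') ≤ 3 * a * s y' → s y ≤ 2 * s y' →
        dist y y' ≤ K * s y' ∧ c₁ * s y' ≤ s y) →
      ∃ u ⊆ S, u.Countable ∧ u.PairwiseDisjoint (fun b => closedBall (f b) (a * s b)) ∧
        μ S ≤ C * M * ∑' b : u, ENNReal.ofReal (s b) ^ m := by
  set ε := c * c₁ / 2 with hε
  have hεpos : 0 < ε := by positivity
  obtain ⟨t, -, htf, ht⟩ := (isCompact_closedBall (0 : Euc n) K).finite_cover_balls hεpos
  refine ⟨(htf.toFinset.card : ℝ≥0∞) * 2 ^ m, ?_, ?_⟩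
  · exact ENNReal.mul_ne_top (by simp) (by simp)
  intro d S s f a R C ha hs hsR hμ hd
  obtain ⟨u, huS, hudisj, hucov⟩ := Vitali.exists_disjoint_subfamily_covering_enlargement
    (fun b => closedBall (f b) (a * s b)) S s 2 (by norm_num) (fun y hy => (hs y hy).le) R hsR
    (fun y hy => ⟨f y, mem_closedBall_self (mul_nonneg ha.le (hs y hy).le)⟩)
  have hucount : u.Countable := by
    refine hudisj.countable_of_nonempty_interior fun b hb => ?_
    refine ⟨f b, ball_subset_interior_closedBall (mem_ball_self (mul_pos ha (hs b (huS hb))))⟩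
  refine ⟨u, huS, hucount, hudisj, ?_⟩
  set G : Euc n → Set (Euc n) := fun b => {y ∈ S | dist y b ≤ K * s b ∧ c₁ * s b ≤ s y ∧
    s y ≤ 2 * s b} with hG
  have hcov : S ⊆ ⋃ b ∈ u, G b := by
    intro y hy
    obtain ⟨b, hb, ⟨z, hz1, hz2⟩, hyb⟩ := hucov y hy
    have h1 : dist (f y) (f b) ≤ 3 * a * s b := by
      have := dist_triangle_left (f y) (f b) z
      have h3 := mem_closedBall.1 hz1
      have h4 := mem_closedBall.1 hz2
      nlinarith [mul_le_mul_of_nonneg_left hyb ha.le]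
    obtain ⟨h2, h3⟩ := hd y hy b (huS hb) h1 hyb
    exact mem_biUnion hb ⟨hy, h2, h3, hyb⟩
  have hGb : ∀ b ∈ u, μ (G b) ≤ C * (htf.toFinset.card * 2 ^ m) * ENNReal.ofReal (s b) ^ m := by
    intro b hb
    have hsb := hs b (huS hb)
    have hGcov : G b ⊆ ⋃ z ∈ htf.toFinset, G b ∩ ball (b + s b • z) (ε * s b) := by
      intro y hy
      have h1 : (s b)⁻¹ • (y - b) ∈ closedBall (0 : Euc n) K := by
        rw [mem_closedBall_zero_iff, norm_smul, norm_inv, Real.norm_eq_abs, abs_of_pos hsb,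
          ← dist_eq_norm, inv_mul_le_iff₀ hsb, mul_comm]
        exact hy.2.1
      obtain ⟨z, hz, hz'⟩ := mem_iUnion₂.1 (ht h1)
      refine mem_iUnion₂.2 ⟨z, htf.mem_toFinset.2 hz, hy, ?_⟩
      rw [mem_ball, dist_eq_norm] at hz' ⊢
      have : y - (b + s b • z) = s b • ((s b)⁻¹ • (y - b) - z) := by
        rw [smul_sub, smul_smul, mul_inv_cancel₀ hsb.ne', one_smul]; abel
      rw [this, norm_smul, Real.norm_eq_abs, abs_of_pos hsb, mul_comm]
      exact mul_lt_mul_of_pos_right hz' hsb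
    have hpiece : ∀ z ∈ htf.toFinset, μ (G b ∩ ball (b + s b • z) (ε * s b))
        ≤ C * 2 ^ m * ENNReal.ofReal (s b) ^ m := by
      intro z _
      rcases (G b ∩ ball (b + s b • z) (ε * s b)).eq_empty_or_nonempty with h | ⟨y, hy, hyz⟩
      · rw [h]; simp
      · have hsub : G b ∩ ball (b + s b • z) (ε * s b) ⊆ S ∩ ball y (c * s y) := by
          rintro y' ⟨hy', hyz'⟩
          refine ⟨hy'.1, ?_⟩
          rw [mem_ball] at hyz hyz' ⊢
          have h1 := dist_triangle_right y' y (b + s b • z)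
          have h2 := mul_le_mul_of_nonneg_left hy.2.2.1 hc.le
          have h3 : ε * s b = c * (c₁ * s b) / 2 := by rw [hε]; ring
          linarith
        calc μ (G b ∩ ball (b + s b • z) (ε * s b)) ≤ μ (S ∩ ball y (c * s y)) := measure_mono hsub
          _ ≤ C * ENNReal.ofReal (s y) ^ m := hμ y hy.1
          _ ≤ C * ENNReal.ofReal (2 * s b) ^ m := by gcongr; exact hy.2.2.2
          _ = C * 2 ^ m * ENNReal.ofReal (s b) ^ m := by
            rw [ENNReal.ofReal_mul (by norm_num), mul_pow, mul_assoc]; simp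
    calc μ (G b) ≤ μ (⋃ z ∈ htf.toFinset, G b ∩ ball (b + s b • z) (ε * s b)) :=
          measure_mono hGcov
      _ ≤ ∑ z ∈ htf.toFinset, μ (G b ∩ ball (b + s b • z) (ε * s b)) :=
          measure_biUnion_finset_le _ _
      _ ≤ ∑ z ∈ htf.toFinset, C * 2 ^ m * ENNReal.ofReal (s b) ^ m := Finset.sum_le_sum hpiece
      _ = C * (htf.toFinset.card * 2 ^ m) * ENNReal.ofReal (s b) ^ m := by
        rw [Finset.sum_const, nsmul_eq_mul]; ring
  calc μ S ≤ μ (⋃ b ∈ u, G b) := measure_mono hcov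
    _ ≤ ∑' b : u, μ (G b) := measure_biUnion_le μ hucount _
    _ ≤ ∑' b : u, C * (htf.toFinset.card * 2 ^ m) * ENNReal.ofReal (s b) ^ m :=
        ENNReal.tsum_le_tsum fun b => hGb b b.2
    _ = _ := ENNReal.tsum_mul_left

end Covering

section Jets

variable {F : Type*} [NormedAddCommGroup F] [NormedSpace ℝ F] {n : ℕ}

/-- `g` is a smooth function, vanishing on zero jets, of finitely many derivatives of `φ`
of order at most `i`. -/
def JetControlled (Ω : Set (Euc n)) (φ : Euc n → F) (i : ℕ) (g : Euc n → F) : Prop :=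
  ∃ (ι : Type) (_ : Fintype ι) (k : ι → ℕ) (w : (s : ι) → Fin (k s) → Euc n)
    (H : Euc n × (ι → F) → F), (∀ s, k s ≤ i) ∧
    ContDiffOn ℝ (⊤ : ℕ∞) H (Ω ×ˢ univ) ∧ (∀ x ∈ Ω, H (x, 0) = 0) ∧
    ∀ x ∈ Ω, g x = H (x, fun s => iteratedFDeriv ℝ (k s) φ x (w s))

lemma hasFDerivAt_iteratedFDeriv_apply {φ : Euc n → F} (hφ : ContDiff ℝ (⊤ : ℕ∞) φ) (k : ℕ)
    (w : Fin k → Euc n) (x : Euc n) :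
    DifferentiableAt ℝ (fun y => iteratedFDeriv ℝ k φ y w) x ∧
    ∀ v, fderiv ℝ (fun y => iteratedFDeriv ℝ k φ y w) x v
      = iteratedFDeriv ℝ (k + 1) φ x (Fin.cons v w) := by
  have h := (hφ.iteratedFDeriv_differentiable k
    x).hasFDerivAt.continuousMultilinear_apply_const w
  refine ⟨h.differentiableAt, fun v => ?_⟩
  rw [h.fderiv, iteratedFDeriv_succ_apply_left]
  simp

lemma JetControlled.sub {Ω : Set (Euc n)} {φ : Euc n → F} {i : ℕ} {g₁ g₂ : Euc n → F}
    (h₁ : JetControlled Ω φ i g₁) (h₂ : JetControlled Ω φ i g₂) :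
    JetControlled Ω φ i (fun x => g₁ x - g₂ x) := by
  obtain ⟨ι₁, _, k₁, w₁, H₁, hk₁, hH₁, hz₁, he₁⟩ := h₁
  obtain ⟨ι₂, _, k₂, w₂, H₂, hk₂, hH₂, hz₂, he₂⟩ := h₂
  refine ⟨ι₁ ⊕ ι₂, inferInstance, Sum.elim k₁ k₂, fun s => match s with
    | .inl s => w₁ s
    | .inr s => w₂ s,
    fun p => H₁ (p.1, fun s => p.2 (.inl s)) - H₂ (p.1, fun s => p.2 (.inr s)), ?_, ?_, ?_, ?_⟩
  · rintro (s | s)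
    exacts [hk₁ s, hk₂ s]
  · refine ContDiffOn.sub ?_ ?_
    · exact hH₁.comp (t := Ω ×ˢ univ) (by fun_prop) fun p hp => ⟨hp.1, trivial⟩
    · exact hH₂.comp (t := Ω ×ˢ univ) (by fun_prop) fun p hp => ⟨hp.1, trivial⟩
  · intro x hx
    have e1 := hz₁ x hx
    have e2 := hz₂ x hx
    simp only [Pi.zero_apply]
    rw [show (fun _ : ι₁ => (0 : F)) = 0 from rfl, show (fun _ : ι₂ => (0 : F)) = 0 from rfl,
      e1, e2, sub_zero]
  · intro x hx
    exact congrArg₂ (· - ·) (he₁ x hx) (he₂ x hx)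

lemma JetControlled.fderiv_apply {Ω : Set (Euc n)} (hΩ : IsOpen Ω) {φ : Euc n → F}
    (hφ : ContDiff ℝ (⊤ : ℕ∞) φ) {i : ℕ} {g : Euc n → F}
    (h : JetControlled Ω φ i g) (v : Euc n) :
    JetControlled Ω φ (i + 1) (fun x => fderiv ℝ g x v) := by
  obtain ⟨ι, _, k, w, H, hk, hH, hz, he⟩ := h
  have hO : IsOpen (Ω ×ˢ (univ : Set (ι → F))) := hΩ.prod isOpen_univ
  refine ⟨ι ⊕ ι, inferInstance, Sum.elim k (fun s => k s + 1), fun s => match s with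
    | .inl s => w s
    | .inr s => Fin.cons v (w s),
    fun p => fderiv ℝ H (p.1, fun s => p.2 (.inl s)) (v, fun s => p.2 (.inr s)), ?_, ?_, ?_, ?_⟩
  · rintro (s | s)
    · exact (hk s).trans (Nat.le_succ i)
    · exact Nat.succ_le_succ (hk s)
  · refine ContDiffOn.clm_apply ?_ (by fun_prop)
    exact (hH.fderiv_of_isOpen (m := (⊤ : ℕ∞)) hO (by simp)).comp (t := Ω ×ˢ univ)
      (by fun_prop) fun p hp => ⟨hp.1, trivial⟩
  · intro x hx
    have h1 : DifferentiableAt ℝ H (x, 0) :=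
      (hH.differentiableOn (by simp)).differentiableAt (hO.mem_nhds ⟨hx, trivial⟩)
    have h2 : HasFDerivAt (fun y : Euc n => H (y, (0 : ι → F)))
        ((fderiv ℝ H (x, 0)).comp ((ContinuousLinearMap.id ℝ (Euc n)).prod 0)) x :=
      h1.hasFDerivAt.comp x ((hasFDerivAt_id x).prodMk (hasFDerivAt_const (0 : ι → F) x))
    have h3 : (fun y : Euc n => H (y, (0 : ι → F))) =ᶠ[𝓝 x] fun _ => 0 := by
      filter_upwards [hΩ.mem_nhds hx] with y hy using hz y hy
    have h4 := h2.unique ((hasFDerivAt_const (0 : F) x).congr_of_eventuallyEq h3)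
    have h5 : fderiv ℝ H (x, 0) (v, 0) = 0 := by simpa using congrArg (fun L => L v) h4
    exact h5
  · intro x hx
    set J : Euc n → ι → F := fun x s => iteratedFDeriv ℝ (k s) φ x (w s) with hJ
    have h1 : DifferentiableAt ℝ H (x, J x) :=
      (hH.differentiableOn (by simp)).differentiableAt (hO.mem_nhds ⟨hx, trivial⟩)
    have hJd : HasFDerivAt J (ContinuousLinearMap.pi fun s =>
        fderiv ℝ (fun y => iteratedFDeriv ℝ (k s) φ y (w s)) x) x :=
      hasFDerivAt_pi.2 fun s =>
        (hasFDerivAt_iteratedFDeriv_apply hφ (k s) (w s) x).1.hasFDerivAt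
    have h2 : HasFDerivAt (fun y : Euc n => H (y, J y)) _ x :=
      h1.hasFDerivAt.comp x ((hasFDerivAt_id x).prodMk hJd)
    have h3 : g =ᶠ[𝓝 x] fun y => H (y, J y) := by
      filter_upwards [hΩ.mem_nhds hx] with y hy using he y hy
    have h4 : fderiv ℝ g x v = fderiv ℝ H (x, J x)
        (v, fun s => iteratedFDeriv ℝ (k s + 1) φ x (Fin.cons v (w s))) := by
      rw [(h2.congr_of_eventuallyEq h3).fderiv]
      simp only [ContinuousLinearMap.comp_apply, ContinuousLinearMap.prod_apply,
        ContinuousLinearMap.id_apply]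
      congr 2
      funext s
      simpa using (hasFDerivAt_iteratedFDeriv_apply hφ (k s) (w s) x).2 v
    exact h4

lemma JetControlled.norm_le {Ω : Set (Euc n)} (hΩ : IsOpen Ω) {φ : Euc n → F}
    (hφ : ContDiff ℝ (⊤ : ℕ∞) φ) {i : ℕ} {g : Euc n → F}
    (h : JetControlled Ω φ i g) {K : Set (Euc n)} (hK : IsCompact K) (hKΩ : K ⊆ Ω) :
    ∃ C : ℝ, 0 ≤ C ∧ ∀ x ∈ K,
      ‖g x‖ ≤ C * ∑ l ∈ Finset.range (i + 1), ‖iteratedFDeriv ℝ l φ x‖ := by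
  obtain ⟨ι, _, k, w, H, hk, hH, hz, he⟩ := h
  have hO : IsOpen (Ω ×ˢ (univ : Set (ι → F))) := hΩ.prod isOpen_univ
  set J : Euc n → ι → F := fun x s => iteratedFDeriv ℝ (k s) φ x (w s) with hJ
  have hJc : Continuous J := continuous_pi fun s => continuous_iff_continuousAt.2 fun x =>
    (hasFDerivAt_iteratedFDeriv_apply hφ (k s) (w s) x).1.continuousAt
  have hcomp : IsCompact ((fun q : Euc n × ℝ => (q.1, q.2 • J q.1)) '' (K ×ˢ Icc (0 : ℝ) 1)) :=
    (hK.prod isCompact_Icc).image (by fun_prop)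
  have hsub : ((fun q : Euc n × ℝ => (q.1, q.2 • J q.1)) '' (K ×ˢ Icc (0 : ℝ) 1))
      ⊆ Ω ×ˢ (univ : Set (ι → F)) := by
    rintro _ ⟨q, hq, rfl⟩
    exact ⟨hKΩ hq.1, trivial⟩
  obtain ⟨M, hM⟩ := hcomp.exists_bound_of_continuousOn
    (((hH.continuousOn_fderiv_of_isOpen hO (by simp))).mono hsub)
  set W : ℝ := ∑ s, ∏ t, ‖w s t‖ with hW
  have hW0 : 0 ≤ W := Finset.sum_nonneg fun s _ => Finset.prod_nonneg fun t _ => norm_nonneg _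
  refine ⟨|M| * W, by positivity, fun x hx => ?_⟩
  have hJle : ‖J x‖ ≤ W * ∑ l ∈ Finset.range (i + 1), ‖iteratedFDeriv ℝ l φ x‖ := by
    have h0 : 0 ≤ ∑ l ∈ Finset.range (i + 1), ‖iteratedFDeriv ℝ l φ x‖ :=
      Finset.sum_nonneg fun _ _ => norm_nonneg _
    refine (pi_norm_le_iff_of_nonneg (mul_nonneg hW0 h0)).2 fun s => ?_
    refine (ContinuousMultilinearMap.le_opNorm _ _).trans ?_
    rw [mul_comm]
    refine mul_le_mul ?_ ?_ (norm_nonneg _) hW0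
    · exact Finset.single_le_sum (f := fun s => ∏ t, ‖w s t‖)
        (fun s _ => Finset.prod_nonneg fun t _ => norm_nonneg _) (Finset.mem_univ s)
    · exact Finset.single_le_sum (f := fun l => ‖iteratedFDeriv ℝ l φ x‖)
        (fun _ _ => norm_nonneg _) (Finset.mem_range.2 (Nat.lt_succ_of_le (hk s)))
  have hseg : ∀ t ∈ Icc (0 : ℝ) 1, HasDerivWithinAt (fun t : ℝ => H (x, t • J x))
      (fderiv ℝ H (x, t • J x) (0, J x)) (Icc 0 1) t := by
    intro t _
    have h1 : DifferentiableAt ℝ H (x, t • J x) :=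
      (hH.differentiableOn (by simp)).differentiableAt (hO.mem_nhds ⟨hKΩ hx, trivial⟩)
    have h2 : HasDerivAt (fun t : ℝ => (x, t • J x)) ((0 : Euc n), J x) t := by
      refine (hasDerivAt_const t x).prodMk ?_
      simpa using (hasDerivAt_id t).smul_const (J x)
    exact (h1.hasFDerivAt.comp_hasDerivAt t h2).hasDerivWithinAt
  have hb : ∀ t ∈ Ico (0 : ℝ) 1, ‖fderiv ℝ H (x, t • J x) (0, J x)‖ ≤ |M| * ‖J x‖ := by
    intro t ht
    refine (ContinuousLinearMap.le_opNorm _ _).trans ?_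
    refine mul_le_mul ((hM _ ⟨(x, t), ⟨hx, ht.1, ht.2.le⟩, rfl⟩).trans (le_abs_self M)) ?_
      (norm_nonneg _) (abs_nonneg M)
    simp [Prod.norm_def]
  have h1 := norm_image_sub_le_of_norm_deriv_le_segment' hseg hb 1 (by simp)
  simp only [one_smul, zero_smul, hz x (hKΩ hx), sub_zero, mul_one] at h1
  rw [he x (hKΩ hx)]
  calc _ ≤ |M| * ‖J x‖ := h1
    _ ≤ |M| * (W * ∑ l ∈ Finset.range (i + 1), ‖iteratedFDeriv ℝ l φ x‖) := by gcongr
    _ = _ := by ring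

/-- Prolongation: the principal symbol applied to the derivatives of a solution of order `i + 1`
is controlled by the derivatives of order at most `i`. -/
lemma jetControlled_symbol {Ω : Set (Euc n)} (hΩ : IsOpen Ω) {φ : Euc n → F}
    (hφ : ContDiff ℝ (⊤ : ℕ∞) φ) {a : Fin n → Euc n → F →L[ℝ] F}
    (ha : ∀ l, ContDiffOn ℝ (⊤ : ℕ∞) (a l) Ω) {V : Euc n → F → F}
    (hV : ContDiffOn ℝ (⊤ : ℕ∞) (fun p : Euc n × F => V p.1 p.2) (Ω ×ˢ univ))
    (hV0 : ∀ x ∈ Ω, V x 0 = 0)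
    (heq : ∀ x ∈ Ω, ∑ l, a l x (fderiv ℝ φ x (EuclideanSpace.single l 1)) + V x (φ x) = 0) :
    ∀ (i : ℕ) (w : Fin i → Euc n), JetControlled Ω φ i (fun x =>
      ∑ l, a l x (iteratedFDeriv ℝ (i + 1) φ x (Fin.cons (EuclideanSpace.single l 1) w))) := by
  intro i
  induction i with
  | zero =>
    intro w
    refine ⟨Unit, inferInstance, fun _ => 0, fun _ => w, fun p => - V p.1 (p.2 ()), fun _ => le_rfl,
      ?_, ?_, ?_⟩
    · exact (hV.comp (t := Ω ×ˢ univ) (f := fun p : Euc n × (Unit → F) => (p.1, p.2 ()))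
        (by fun_prop) fun p hp => ⟨hp.1, trivial⟩).neg
    · intro x hx
      simp [hV0 x hx]
    · intro x hx
      rw [eq_neg_iff_add_eq_zero, ← heq x hx]
      simp
  | succ i ih =>
    intro w
    obtain ⟨v, w, rfl⟩ : ∃ v w', w = (Fin.cons v w' : Fin (i + 1) → Euc n) :=
      ⟨w 0, Fin.tail w, (Fin.cons_self_tail w).symm⟩
    have h1 := (ih w).fderiv_apply hΩ hφ v
    have h2 : JetControlled Ω φ (i + 1) (fun x => ∑ l, fderiv ℝ (a l) x v
        (iteratedFDeriv ℝ (i + 1) φ x (Fin.cons (EuclideanSpace.single l 1) w))) := by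
      refine ⟨Fin n, inferInstance, fun _ => i + 1,
        fun l => Fin.cons (EuclideanSpace.single l 1) w,
        fun p => ∑ l, fderiv ℝ (a l) p.1 v (p.2 l), fun _ => le_rfl, ?_, ?_, fun x _ => rfl⟩
      · refine ContDiffOn.sum fun l _ => ?_
        refine ContDiffOn.clm_apply (ContDiffOn.clm_apply ?_ contDiffOn_const) (by fun_prop)
        exact ((ha l).fderiv_of_isOpen (m := (⊤ : ℕ∞)) hΩ (by simp)).comp (t := Ω)
          (by fun_prop) fun p hp => hp.1
      · intro x _
        simp
    obtain ⟨ι, iι, k, w', H, hk, hH, hz, he⟩ := h1.sub h2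
    refine ⟨ι, iι, k, w', H, hk, hH, hz, fun x hx => ?_⟩
    rw [← he x hx]
    have h3 : HasFDerivAt (fun x => ∑ l, a l x
        (iteratedFDeriv ℝ (i + 1) φ x (Fin.cons (EuclideanSpace.single l 1) w))) _ x :=
      HasFDerivAt.fun_sum fun l _ =>
        HasFDerivAt.clm_apply (((ha l).differentiableOn (by simp)).differentiableAt
          (hΩ.mem_nhds hx)).hasFDerivAt
          (hasFDerivAt_iteratedFDeriv_apply hφ (i + 1)
            (Fin.cons (EuclideanSpace.single l 1) w) x).1.hasFDerivAt
    beta_reduce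
    rw [h3.fderiv, sum_apply, ← Finset.sum_sub_distrib]
    refine Finset.sum_congr rfl fun l _ => ?_
    simp only [add_apply, ContinuousLinearMap.comp_apply,
      ContinuousLinearMap.flip_apply, add_sub_cancel_right]
    rw [(hasFDerivAt_iteratedFDeriv_apply hφ (i + 1)
      (Fin.cons (EuclideanSpace.single l 1) w) x).2 v, iteratedFDeriv_swap_zero_one hφ]

end Jets

section Rectifiability

lemma CountablyCinfRectifiable.mono {n m : ℕ} {S T : Set (Euc n)}
    (h : CountablyCinfRectifiable m T) (hST : S ⊆ T) : CountablyCinfRectifiable m S := by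
  obtain ⟨g, hg, hT⟩ := h
  exact ⟨g, hg, hST.trans hT⟩

lemma countablyCinfRectifiable_iUnion {n m : ℕ} {S : ℕ → Set (Euc n)}
    (h : ∀ k, CountablyCinfRectifiable m (S k)) : CountablyCinfRectifiable m (⋃ k, S k) := by
  choose g hg hS using h
  refine ⟨fun i => g i.unpair.1 i.unpair.2, fun i => hg _ _, iUnion_subset fun k x hx => ?_⟩
  obtain ⟨i, hi⟩ := mem_iUnion.1 (hS k hx)
  exact mem_iUnion.2 ⟨Nat.pair k i, by simpa using hi⟩

lemma countablyCinfRectifiable_of_local {n m : ℕ} {S : Set (Euc n)}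
    (h : ∀ y ∈ S, ∃ O ∈ 𝓝 y, CountablyCinfRectifiable m (S ∩ O)) :
    CountablyCinfRectifiable m S := by
  choose! O hO hrect using h
  obtain ⟨t, htS, htc, hcov⟩ := TopologicalSpace.countable_cover_nhdsWithin
    (s := S) (f := O) fun y hy => mem_nhdsWithin_of_mem_nhds (hO y hy)
  rcases t.eq_empty_or_nonempty with rfl | hne
  · exact ⟨fun _ _ => 0, fun _ => contDiff_const, fun x hx => by simpa using hcov hx⟩
  · obtain ⟨e, he⟩ := htc.exists_eq_range hne
    have := countablyCinfRectifiable_iUnion (m := m) (S := fun i => S ∩ O (e i)) fun i =>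
      hrect _ (htS (he ▸ mem_range_self i))
    refine this.mono fun x hx => ?_
    obtain ⟨y, hy, hxy⟩ := mem_iUnion₂.1 (hcov hx)
    rw [he] at hy
    obtain ⟨i, rfl⟩ := hy
    exact mem_iUnion.2 ⟨i, hx, hxy⟩

lemma CountablyCinfRectifiable.dimH_le {n m : ℕ} {S : Set (Euc n)}
    (h : CountablyCinfRectifiable m S) : dimH S ≤ m := by
  obtain ⟨g, hg, hS⟩ := h
  refine (dimH_mono hS).trans ?_
  rw [dimH_iUnion]
  refine iSup_le fun i => ?_
  simpa using ((hg i).of_le (by exact_mod_cast le_top)).dimH_range_le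

variable {F : Type*} [NormedAddCommGroup F] [NormedSpace ℝ F] {n : ℕ}

instance finiteDimensional_continuousMultilinearMap [FiniteDimensional ℝ F] (k : ℕ) :
    FiniteDimensional ℝ (Euc n [×k]→L[ℝ] F) :=
  Module.Finite.of_injective
    (ContinuousMultilinearMap.toMultilinearMapLinear (A := ℝ) (R' := ℝ)
      (M₁ := fun _ : Fin k => Euc n) (M₂ := F))
    ContinuousMultilinearMap.toMultilinearMap_injective

lemma exists_smooth_param [FiniteDimensional ℝ F] {φ : Euc n → F}
    (hφ : ContDiff ℝ (⊤ : ℕ∞) φ) {k d : ℕ} {y : Euc n} (hy : iteratedFDeriv ℝ k φ y = 0)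
    (hd : Module.finrank ℝ (multilinearKer (iteratedFDeriv ℝ (k + 1) φ y)) ≤ d) :
    ∃ O ∈ 𝓝 y, ∃ g : Euc d → Euc n, ContDiff ℝ (⊤ : ℕ∞) g ∧
      {z ∈ O | iteratedFDeriv ℝ k φ z = 0} ⊆ range g := by
  obtain ⟨π₀, hπ₀⟩ := exists_continuousLinearMap_injOn _ hd
  set π : Euc n →L[ℝ] Euc d :=
    ((EuclideanSpace.equiv (Fin d) ℝ).symm : (Fin d → ℝ) →L[ℝ] Euc d).comp π₀ with hπdef
  have hπ : ∀ v ∈ multilinearKer (iteratedFDeriv ℝ (k + 1) φ y), π v = 0 → v = 0 := by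
    intro v hv h
    refine hπ₀ v hv ?_
    simpa [hπdef] using h
  set T : Euc n →L[ℝ] (Euc n [×k]→L[ℝ] F) := fderiv ℝ (iteratedFDeriv ℝ k φ) y with hT
  have hTd : HasFDerivAt (iteratedFDeriv ℝ k φ) T y :=
    (hφ.iteratedFDeriv_differentiable k y).hasFDerivAt
  have hinj : LinearMap.ker (π.prod T : Euc n →ₗ[ℝ] Euc d × (Euc n [×k]→L[ℝ] F)) = ⊥ := by
    rw [LinearMap.ker_eq_bot']
    intro v hv
    have hv' : π v = 0 ∧ T v = 0 := by simpa using hv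
    refine hπ v ?_ hv'.1
    rw [mem_multilinearKer]
    intro w
    rw [iteratedFDeriv_succ_apply_left]
    simp only [Fin.cons_zero, Fin.tail_cons, ← hT, hv'.2]
    rfl
  obtain ⟨L₀, hL₀⟩ := LinearMap.exists_leftInverse_of_injective _ hinj
  set L : Euc d × (Euc n [×k]→L[ℝ] F) →L[ℝ] Euc n := LinearMap.toContinuousLinearMap L₀ with hL
  have hLid : ∀ v, L (π v, T v) = v := fun v => by
    have := congrArg (fun M => M v) hL₀
    exact this
  set f : Euc n → Euc n := fun z => L (π z, iteratedFDeriv ℝ k φ z) with hf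
  have hfs : ContDiff ℝ (⊤ : ℕ∞) f :=
    L.contDiff.comp (π.contDiff.prodMk (hφ.iteratedFDeriv_smooth k))
  have hfd : HasFDerivAt f ((ContinuousLinearEquiv.refl ℝ (Euc n) : Euc n ≃L[ℝ] Euc n) :
      Euc n →L[ℝ] Euc n) y := by
    have h1 := L.hasFDerivAt.comp y (π.hasFDerivAt.prodMk hTd)
    refine h1.congr_fderiv ?_
    ext1 v
    simpa using hLid v
  have hne : ((⊤ : ℕ∞) : WithTop ℕ∞) ≠ 0 := by simp
  set e := hfs.contDiffAt.toOpenPartialHomeomorph f hfd hne with he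
  have hecoe : (e : Euc n → Euc n) = f := rfl
  have hye : y ∈ e.source := hfs.contDiffAt.mem_toOpenPartialHomeomorph_source hfd hne
  have hinv : {z | fderiv ℝ f z ∈ range ((↑) : (Euc n ≃L[ℝ] Euc n) → Euc n →L[ℝ] Euc n)} ∈ 𝓝 y := by
    refine (hfs.continuous_fderiv hne).continuousAt.preimage_mem_nhds ?_
    rw [hfd.fderiv]
    exact ContinuousLinearEquiv.nhds _
  have hsymm : e.symm (f y) = y := e.left_inv hye
  have hfy : f y ∈ e.target := e.map_source hye
  have h1 : ∀ᶠ q in 𝓝 (f y), q ∈ e.target ∧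
      fderiv ℝ f (e.symm q) ∈ range ((↑) : (Euc n ≃L[ℝ] Euc n) → Euc n →L[ℝ] Euc n) := by
    refine Filter.Eventually.and (e.open_target.mem_nhds hfy) ?_
    have := (e.continuousAt_symm hfy)
    rw [ContinuousAt, hsymm] at this
    exact this.eventually hinv
  have hfy' : f y = L (π y, 0) := by rw [hf]; simp only [hy]
  set ℓ : Euc d → Euc n := fun w => L (w, 0) with hℓ
  have hℓs : ContDiff ℝ (⊤ : ℕ∞) ℓ := L.contDiff.comp (contDiff_id.prodMk contDiff_const)
  have h2 : ∀ᶠ w in 𝓝 (π y), ℓ w ∈ e.target ∧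
      fderiv ℝ f (e.symm (ℓ w)) ∈ range ((↑) : (Euc n ≃L[ℝ] Euc n) → Euc n →L[ℝ] Euc n) := by
    have := hℓs.continuous.continuousAt (x := π y)
    rw [ContinuousAt, show ℓ (π y) = f y from hfy'.symm] at this
    exact this.eventually h1
  obtain ⟨δ, hδ, hball⟩ := Metric.eventually_nhds_iff_ball.1 h2
  set B := OpenPartialHomeomorph.univBall (π y) δ with hB
  have hBmem : ∀ w, B w ∈ ball (π y) δ := fun w => by
    rw [← OpenPartialHomeomorph.univBall_target (π y) hδ]
    exact B.map_source (by simp [hB])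
  refine ⟨e.source ∩ π ⁻¹' ball (π y) δ, inter_mem (e.open_source.mem_nhds hye)
    (π.continuous.continuousAt.preimage_mem_nhds (ball_mem_nhds _ hδ)),
    fun w => e.symm (ℓ (B w)), ?_, ?_⟩
  · rw [contDiff_iff_contDiffAt]
    intro w
    obtain ⟨h3, e', h4⟩ := hball _ (hBmem w)
    have h5 : ContDiffAt ℝ (⊤ : ℕ∞) e.symm (ℓ (B w)) := by
      refine e.contDiffAt_symm h3 (f₀' := e') ?_ (by rw [hecoe]; exact hfs.contDiffAt)
      rw [hecoe, h4]
      exact (hfs.differentiable hne _).hasFDerivAt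
    exact h5.comp w (hℓs.comp OpenPartialHomeomorph.contDiff_univBall).contDiffAt
  · rintro z ⟨⟨hz1, hz2⟩, hz3⟩
    have hz2' : π z ∈ B.target := by rwa [hB, OpenPartialHomeomorph.univBall_target _ hδ]
    refine ⟨B.symm (π z), ?_⟩
    beta_reduce
    rw [B.right_inv hz2']
    have : ℓ (π z) = f z := by
      simp only [hℓ, hf, hz3]
    rw [this]
    exact e.left_inv hz1

end Rectifiability

section LocalSystem

variable {F : Type*} [NormedAddCommGroup F] [NormedSpace ℝ F] {n : ℕ}

/-- A globally smooth map solving a semilinear elliptic system on the open set `Ω`. -/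
structure LocalSolution (Ω : Set (Euc n)) (a : Fin n → Euc n → F →L[ℝ] F) (V : Euc n → F → F)
    (φ : Euc n → F) : Prop where
  isOpen : IsOpen Ω
  contDiff : ContDiff ℝ (⊤ : ℕ∞) φ
  contDiffOn_symbol : ∀ l, ContDiffOn ℝ (⊤ : ℕ∞) (a l) Ω
  contDiffOn_potential : ContDiffOn ℝ (⊤ : ℕ∞) (fun p : Euc n × F => V p.1 p.2) (Ω ×ˢ univ)
  potential_zero : ∀ x ∈ Ω, V x 0 = 0
  elliptic : ∀ x ∈ Ω, EllipticSymbol fun l => a l x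
  equation : ∀ x ∈ Ω, ∑ l, a l x (fderiv ℝ φ x (EuclideanSpace.single l 1)) + V x (φ x) = 0

variable {Ω : Set (Euc n)} {a : Fin n → Euc n → F →L[ℝ] F} {V : Euc n → F → F} {φ : Euc n → F}

lemma LocalSolution.norm_symbol_le (h : LocalSolution Ω a V φ) (i : ℕ) (w : Fin i → Euc n)
    {K : Set (Euc n)} (hK : IsCompact K) (hKΩ : K ⊆ Ω) :
    ∃ C : ℝ, 0 ≤ C ∧ ∀ x ∈ K,
      ‖∑ l, a l x (iteratedFDeriv ℝ (i + 1) φ x (Fin.cons (EuclideanSpace.single l 1) w))‖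
        ≤ C * ∑ l ∈ Finset.range (i + 1), ‖iteratedFDeriv ℝ l φ x‖ :=
  (jetControlled_symbol h.isOpen h.contDiff h.contDiffOn_symbol h.contDiffOn_potential
    h.potential_zero h.equation i w).norm_le h.isOpen h.contDiff hK hKΩ

lemma LocalSolution.finrank_ker_le (h : LocalSolution Ω a V φ) {k : ℕ} {y : Euc n} (hy : y ∈ Ω)
    (hlow : ∀ l ≤ k, iteratedFDeriv ℝ l φ y = 0) (hk : iteratedFDeriv ℝ (k + 1) φ y ≠ 0) :
    Module.finrank ℝ (multilinearKer (iteratedFDeriv ℝ (k + 1) φ y)) + 2 ≤ n := by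
  refine finrank_multilinearKer_le (h.elliptic y hy) hk fun w => ?_
  obtain ⟨C, -, hC⟩ := h.norm_symbol_le k w (K := {y}) isCompact_singleton (by simpa using hy)
  have h1 := hC y rfl
  have h2 : ∑ l ∈ Finset.range (k + 1), ‖iteratedFDeriv ℝ l φ y‖ = 0 :=
    Finset.sum_eq_zero fun l hl => by
      rw [hlow l (Nat.lt_succ_iff.1 (Finset.mem_range.1 hl)), norm_zero]
  rw [h2, mul_zero] at h1
  exact norm_le_zero_iff.1 h1

lemma LocalSolution.countablyCinfRectifiable [FiniteDimensional ℝ F] (h : LocalSolution Ω a V φ)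
    (hord : ∀ y ∈ Ω, ∃ k, iteratedFDeriv ℝ k φ y ≠ 0) :
    CountablyCinfRectifiable (n - 2) {y ∈ Ω | φ y = 0} := by
  set S : ℕ → Set (Euc n) := fun k => {y ∈ Ω | (∀ l ≤ k, iteratedFDeriv ℝ l φ y = 0) ∧
    iteratedFDeriv ℝ (k + 1) φ y ≠ 0} with hS
  have hcov : {y ∈ Ω | φ y = 0} ⊆ ⋃ k, S k := by
    rintro y ⟨hy, hy0⟩
    classical
    have hex := hord y hy
    have h1 := Nat.find_spec hex
    obtain ⟨k, hk⟩ : ∃ k, Nat.find hex = k + 1 := by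
      refine Nat.exists_eq_succ_of_ne_zero fun h0 => ?_
      rw [h0] at h1
      apply h1
      ext w
      simp [hy0]
    rw [hk] at h1
    refine mem_iUnion.2 ⟨k, hy, fun l hl => ?_, h1⟩
    by_contra hne
    have := Nat.find_min' hex hne
    omega
  refine (countablyCinfRectifiable_iUnion fun k => ?_).mono hcov
  refine countablyCinfRectifiable_of_local fun y hy => ?_
  have hr := h.finrank_ker_le hy.1 hy.2.1 hy.2.2
  obtain ⟨O, hO, g, hg, hsub⟩ := exists_smooth_param h.contDiff (d := n - 2) (hy.2.1 k le_rfl)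
    (by omega)
  refine ⟨O, hO, fun _ => g, fun _ => hg, fun z hz => mem_iUnion.2 ⟨0, hsub ⟨hz.2, ?_⟩⟩⟩
  exact hz.1.2.1 k le_rfl

end LocalSystem

section ScaleMeasure

lemma hausdorffMeasure_le_of_dist_le {X Y : Type*} [MetricSpace X] [MeasurableSpace X]
    [BorelSpace X] [MetricSpace Y] [MeasurableSpace Y] [BorelSpace Y] {S : Set X} {f : X → Y}
    {K : ℝ} (m : ℕ) (h : ∀ y ∈ S, ∀ y' ∈ S, dist y y' ≤ K * dist (f y) (f y')) :
    μH[(m : ℝ)] S ≤ ENNReal.ofReal K ^ m * μH[(m : ℝ)] (f '' S) := by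
  have hanti : AntilipschitzWith K.toNNReal (fun y : S => f y) := by
    refine AntilipschitzWith.of_le_mul_dist fun y y' => ?_
    refine (h y y.2 y' y'.2).trans ?_
    gcongr
    exact Real.le_coe_toNNReal K
  have h1 := hanti.le_hausdorffMeasure_image (d := (m : ℝ)) (by positivity) univ
  have h2 : μH[(m : ℝ)] (univ : Set S) = μH[(m : ℝ)] S := by
    rw [← (isometry_subtype_coe (s := S)).hausdorffMeasure_image (Or.inl (by positivity)) univ]
    simp
  have h3 : (fun y : S => f y) '' univ = f '' S := by
    ext z; simp
  rw [h2, h3] at h1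
  simpa [ENNReal.ofReal] using h1

variable {n : ℕ}

/-- Measure bound for a set which is graph-like over an `m`-dimensional space at scales above
the scale function `s`. -/
lemma exists_hausdorffMeasure_le_of_graph_scale (m : ℕ) (π : Euc n →L[ℝ] (Fin m → ℝ))
    {c κ θ K : ℝ} (hc : 0 < c) (hκ : 0 < κ) (hθ : 0 < θ) (hK : 0 < K) :
    ∃ M : ℝ≥0∞, M ≠ ⊤ ∧ ∀ (X : Set (Euc n)) (s : Euc n → ℝ) (x : Euc n) (r : ℝ) (C : ℝ≥0∞),
      0 < r → X ⊆ ball x r → (∀ y ∈ X, 0 ≤ s y ∧ s y ≤ r) →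
      (∀ y ∈ X, 0 < s y → μH[(m : ℝ)] (X ∩ ball y (c * s y)) ≤ C * ENNReal.ofReal (s y) ^ m) →
      (∀ y ∈ X, ∀ y' ∈ X, dist y y' ≤ K * dist (π y) (π y') + κ * s y) →
      (∀ y ∈ X, ∀ y' ∈ X, dist y y' ≤ θ * s y → s y ≤ 2 * s y') →
      μH[(m : ℝ)] X ≤ (C + 1) * M * ENNReal.ofReal r ^ m := by
  set a : ℝ := θ / (6 * K) with ha
  have hapos : 0 < a := by positivity
  set c₁ : ℝ := min (1 / 4) (θ / (2 * κ)) with hc₁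
  have hc₁pos : 0 < c₁ := by positivity
  obtain ⟨M₀, hM₀, hgroup⟩ := exists_measure_le_tsum_of_scale (n := n) μH[(m : ℝ)] m hc hc₁pos
    (3 * a * K + κ)
  set R : ℝ := ‖π‖ + a with hR
  have hRpos : 0 < R := by positivity
  set M₁ : ℝ≥0∞ := M₀ * ((ENNReal.ofReal a ^ m)⁻¹ * ENNReal.ofReal R ^ m) with hM₁
  set M₂ : ℝ≥0∞ := ENNReal.ofReal K ^ m * (2 ^ m * ENNReal.ofReal R ^ m) with hM₂
  refine ⟨M₁ + M₂, ?_, ?_⟩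
  · refine ENNReal.add_ne_top.2 ⟨ENNReal.mul_ne_top hM₀ (ENNReal.mul_ne_top ?_ (by simp)),
      ENNReal.mul_ne_top (by simp) (ENNReal.mul_ne_top (by simp) (by simp))⟩
    simp [hapos]
  intro X s x r C hr hX hs hμ hdist hscale
  set S₀ := {y ∈ X | s y = 0} with hS₀
  set S := {y ∈ X | 0 < s y} with hS
  have hcover : X ⊆ S₀ ∪ S := by
    intro y hy
    rcases (hs y hy).1.eq_or_lt with h | h
    · exact Or.inl ⟨hy, h.symm⟩
    · exact Or.inr ⟨hy, h⟩
  have hπ : ∀ y ∈ X, dist (π y) (π x) ≤ ‖π‖ * r := by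
    intro y hy
    rw [dist_eq_norm, ← map_sub]
    refine (π.le_opNorm _).trans ?_
    gcongr
    rw [← dist_eq_norm]
    exact (mem_ball.1 (hX hy)).le
  have h0 : μH[(m : ℝ)] S₀ ≤ M₂ * ENNReal.ofReal r ^ m := by
    have h1 := hausdorffMeasure_le_of_dist_le (S := S₀) (f := π) (K := K) m fun y hy y' hy' => by
      simpa [hy.2] using hdist y hy.1 y' hy'.1
    have h2 : μH[(m : ℝ)] (π '' S₀) ≤ (2 ^ m * ENNReal.ofReal R ^ m) * ENNReal.ofReal r ^ m := by
      have h3 : π '' S₀ ⊆ closedBall (π x) (R * r) := by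
        rintro _ ⟨y, hy, rfl⟩
        rw [mem_closedBall]
        refine (hπ y hy.1).trans ?_
        gcongr
        rw [hR]; linarith
      refine (measure_mono h3).trans ?_
      have h4 : μH[(m : ℝ)] = (volume : Measure (Fin m → ℝ)) := by
        simpa using hausdorffMeasure_pi_real (ι := Fin m)
      rw [h4, Real.volume_pi_closedBall _ (by positivity), Fintype.card_fin,
        ENNReal.ofReal_pow (by positivity), ENNReal.ofReal_mul (by norm_num),
        ENNReal.ofReal_mul hRpos.le, mul_pow, mul_pow, mul_assoc]
      simp
    calc _ ≤ _ := h1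
      _ ≤ ENNReal.ofReal K ^ m * ((2 ^ m * ENNReal.ofReal R ^ m) * ENNReal.ofReal r ^ m) := by
        gcongr
      _ = _ := by rw [hM₂]; ring
  have h1 : μH[(m : ℝ)] S ≤ C * M₁ * ENNReal.ofReal r ^ m := by
    have hsep : ∀ y ∈ S, ∀ y' ∈ S, dist (π y) (π y') ≤ 3 * a * s y' → s y ≤ 2 * s y' →
        dist y y' ≤ (3 * a * K + κ) * s y' ∧ c₁ * s y' ≤ s y := by
      intro y hy y' hy' hyy hss
      have h3 := hdist y' hy'.1 y hy.1
      rw [dist_comm, dist_comm (π y')] at h3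
      have hs' := hy'.2
      have h4 := mul_le_mul_of_nonneg_left hyy hK.le
      refine ⟨by linarith, ?_⟩
      by_contra! hlt
      have h5 := hdist y hy.1 y' hy'.1
      have h6 : K * (3 * a * s y') = θ / 2 * s y' := by
        rw [ha]; field_simp; ring
      have h7 : κ * s y ≤ θ / 2 * s y' := by
        have h8 : κ * s y ≤ κ * (c₁ * s y') := by gcongr
        have h9 : κ * (c₁ * s y') ≤ κ * (θ / (2 * κ) * s y') := by
          gcongr; exact min_le_right _ _
        have h10 : κ * (θ / (2 * κ) * s y') = θ / 2 * s y' := by field_simp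
        linarith
      have h11 : s y' ≤ 2 * s y := hscale y' hy'.1 y hy.1 (by rw [dist_comm]; linarith)
      have h12 : c₁ * s y' ≤ 1 / 4 * s y' := by gcongr; exact min_le_left _ _
      linarith
    obtain ⟨u, huS, huc, hdisj, hle⟩ := hgroup S s π a r C hapos (fun y hy => hy.2)
      (fun y hy => (hs y hy.1).2)
      (fun y hy => (measure_mono (inter_subset_inter_left _ fun z hz => hz.1)).trans
        (hμ y hy.1 hy.2)) hsep
    have hsum := tsum_ofReal_pow_le_of_pairwiseDisjoint (s := fun b => a * s b) huc
      (fun b hb => (mul_pos hapos (huS hb).2).le) (z := π x) (R := R * r) (by positivity) hdisj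
      (fun b hb => by
        refine closedBall_subset_closedBall' ?_
        have h2 := hπ b (huS hb).1
        have h3 := mul_le_mul_of_nonneg_left (hs b (huS hb).1).2 hapos.le
        rw [hR]; linarith)
    have h2 : ∑' b : u, ENNReal.ofReal (a * s b) ^ m
        = ENNReal.ofReal a ^ m * ∑' b : u, ENNReal.ofReal (s b) ^ m := by
      rw [← ENNReal.tsum_mul_left]
      exact tsum_congr fun b => by rw [ENNReal.ofReal_mul hapos.le, mul_pow]
    rw [h2, ENNReal.ofReal_mul hRpos.le, mul_pow] at hsum
    have hane : ENNReal.ofReal a ^ m ≠ 0 := by simp [hapos]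
    have hsum' : ∑' b : u, ENNReal.ofReal (s b) ^ m
        ≤ (ENNReal.ofReal a ^ m)⁻¹ * (ENNReal.ofReal R ^ m * ENNReal.ofReal r ^ m) := by
      rw [mul_comm _ (_ * _), ← div_eq_mul_inv,
        ENNReal.le_div_iff_mul_le (Or.inl hane) (Or.inl (by simp)), mul_comm]
      exact hsum
    calc _ ≤ _ := hle
      _ ≤ C * M₀ * ((ENNReal.ofReal a ^ m)⁻¹ *
          (ENNReal.ofReal R ^ m * ENNReal.ofReal r ^ m)) := by gcongr
      _ = _ := by rw [hM₁]; ring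
  calc μH[(m : ℝ)] X ≤ μH[(m : ℝ)] (S₀ ∪ S) := measure_mono hcover
    _ ≤ μH[(m : ℝ)] S₀ + μH[(m : ℝ)] S := measure_union_le _ _
    _ ≤ M₂ * ENNReal.ofReal r ^ m + C * M₁ * ENNReal.ofReal r ^ m := add_le_add h0 h1
    _ ≤ (M₂ * ENNReal.ofReal r ^ m + C * M₁ * ENNReal.ofReal r ^ m) +
        (C * M₂ * ENNReal.ofReal r ^ m + M₁ * ENNReal.ofReal r ^ m) := le_self_add
    _ = _ := by ring

/-- Measure bound for a set whose points are separated, up to the scale function `s`, by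
projection to a space of dimension `d`, for the Hausdorff measure of dimension `d + 1`. -/
lemma exists_hausdorffMeasure_le_of_thin_scale (d : ℕ) (π : Euc n →L[ℝ] (Fin d → ℝ))
    {c K : ℝ} (hc : 0 < c) (hK : 0 < K) :
    ∃ M : ℝ≥0∞, M ≠ ⊤ ∧ ∀ (X : Set (Euc n)) (s : Euc n → ℝ) (x : Euc n) (r : ℝ) (C : ℝ≥0∞),
      0 < r → X ⊆ ball x r → (∀ y ∈ X, 0 ≤ s y ∧ s y ≤ r) →
      (∀ y ∈ X, 0 < s y →
        μH[((d + 1 : ℕ) : ℝ)] (X ∩ ball y (c * s y)) ≤ C * ENNReal.ofReal (s y) ^ (d + 1)) →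
      (∀ y ∈ X, ∀ y' ∈ X, dist y y' ≤ K * (dist (π y) (π y') + s y + s y')) →
      μH[((d + 1 : ℕ) : ℝ)] X ≤ (C + 1) * M * ENNReal.ofReal r ^ (d + 1) := by
  obtain ⟨M₀, hM₀, hgroup⟩ := exists_measure_le_tsum_of_scale (n := n) μH[((d + 1 : ℕ) : ℝ)] (d + 1)
    hc (c₁ := 1 / 2) (by norm_num) (6 * K)
  set R : ℝ := ‖π‖ + 1 with hR
  have hRpos : 0 < R := by positivity
  refine ⟨M₀ * ENNReal.ofReal R ^ d * 2, ?_, ?_⟩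
  · exact ENNReal.mul_ne_top (ENNReal.mul_ne_top hM₀ (by simp)) (by simp)
  intro X s x r C hr hX hs hμ hdist
  set S₀ := {y ∈ X | s y = 0} with hS₀
  set σ : ℕ → ℝ := fun i => (1 / 2) ^ i * r with hσ
  set G : ℕ → Set (Euc n) := fun i => {y ∈ X | σ (i + 1) < s y ∧ s y ≤ σ i} with hG
  have hσpos : ∀ i, 0 < σ i := fun i => by positivity
  have hσsucc : ∀ i, σ (i + 1) = σ i / 2 := fun i => by simp only [hσ, pow_succ]; ring
  have hcover : X ⊆ S₀ ∪ ⋃ i, G i := by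
    intro y hy
    rcases (hs y hy).1.eq_or_lt with h | h
    · exact Or.inl ⟨hy, h.symm⟩
    · refine Or.inr (mem_iUnion.2 ?_)
      obtain ⟨i, hi1, hi2⟩ := exists_nat_pow_near_of_lt_one (x := s y / r) (y := 1 / 2)
        (by positivity) ((div_le_one hr).2 (hs y hy).2) (by norm_num) (by norm_num)
      exact ⟨i, hy, (lt_div_iff₀ hr).1 hi1, (div_le_iff₀ hr).1 hi2⟩
  have hπ : ∀ y ∈ X, dist (π y) (π x) ≤ ‖π‖ * r := by
    intro y hy
    rw [dist_eq_norm, ← map_sub]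
    refine (π.le_opNorm _).trans ?_
    gcongr
    rw [← dist_eq_norm]
    exact (mem_ball.1 (hX hy)).le
  have h0 : μH[((d + 1 : ℕ) : ℝ)] S₀ = 0 := by
    have h1 := hausdorffMeasure_le_of_dist_le (S := S₀) (f := π) (K := K) (d + 1)
      fun y hy y' hy' => by simpa [hy.2, hy'.2] using hdist y hy.1 y' hy'.1
    have h2 : μH[((d + 1 : ℕ) : ℝ)] (π '' S₀) = 0 := by
      have h3 : dimH (π '' S₀) ≤ d := by
        refine (dimH_mono (subset_univ _)).trans ?_
        rw [Real.dimH_univ_pi_fin]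
      have h4 : dimH (π '' S₀) < ((d + 1 : ℕ) : ℝ≥0) := by
        refine h3.trans_lt ?_
        exact_mod_cast Nat.lt_succ_self d
      simpa using hausdorffMeasure_of_dimH_lt h4
    rw [h2, mul_zero] at h1
    exact nonpos_iff_eq_zero.1 h1
  have h1 : ∀ i, μH[((d + 1 : ℕ) : ℝ)] (G i) ≤
      C * M₀ * ENNReal.ofReal R ^ d * ENNReal.ofReal r ^ (d + 1) * (2⁻¹ : ℝ≥0∞) ^ i := by
    intro i
    have hsep : ∀ y ∈ G i, ∀ y' ∈ G i, dist (π y) (π y') ≤ 3 * 1 * s y' → s y ≤ 2 * s y' →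
        dist y y' ≤ 6 * K * s y' ∧ 1 / 2 * s y' ≤ s y := by
      intro y hy y' hy' hyy hss
      have h3 := hdist y hy.1 y' hy'.1
      have h4 := hy.2.1
      have h5 := hy'.2.2
      rw [hσsucc] at h4
      refine ⟨?_, by linarith⟩
      refine h3.trans ?_
      rw [mul_assoc, mul_comm 6, mul_assoc]
      refine mul_le_mul_of_nonneg_left ?_ hK.le
      linarith
    obtain ⟨u, huS, huc, hdisj, hle⟩ := hgroup (G i) s π 1 r C one_pos
      (fun y hy => (hσpos _).trans hy.2.1) (fun y hy => (hs y hy.1).2)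
      (fun y hy => (measure_mono (inter_subset_inter_left _ fun z hz => hz.1)).trans
        (hμ y hy.1 ((hσpos _).trans hy.2.1))) hsep
    simp only [one_mul] at hdisj
    have hsum := tsum_ofReal_pow_le_of_pairwiseDisjoint (s := s) huc
      (fun b hb => ((hσpos _).trans (huS hb).2.1).le) (z := π x) (R := R * r) (by positivity)
      hdisj (fun b hb => by
        refine closedBall_subset_closedBall' ?_
        have h2 := hπ b (huS hb).1
        have h3 := (hs b (huS hb).1).2
        rw [hR]; linarith)
    rw [ENNReal.ofReal_mul hRpos.le, mul_pow] at hsum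
    have hsum' : ∑' b : u, ENNReal.ofReal (s b) ^ (d + 1)
        ≤ (2⁻¹ : ℝ≥0∞) ^ i * ENNReal.ofReal r *
          (ENNReal.ofReal R ^ d * ENNReal.ofReal r ^ d) := by
      have h2 : ENNReal.ofReal (σ i) = (2⁻¹ : ℝ≥0∞) ^ i * ENNReal.ofReal r := by
        simp only [hσ]
        rw [ENNReal.ofReal_mul (by positivity), ENNReal.ofReal_pow (by norm_num), one_div,
          ENNReal.ofReal_inv_of_pos (by norm_num)]
        simp
      rw [← h2]
      refine le_trans ?_ (mul_le_mul_right hsum _)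
      rw [← ENNReal.tsum_mul_left]
      refine ENNReal.tsum_le_tsum fun b => ?_
      rw [pow_succ, mul_comm]
      gcongr
      exact (huS b.2).2.2
    calc _ ≤ _ := hle
      _ ≤ C * M₀ * ((2⁻¹ : ℝ≥0∞) ^ i * ENNReal.ofReal r *
          (ENNReal.ofReal R ^ d * ENNReal.ofReal r ^ d)) := by gcongr
      _ = _ := by ring
  calc μH[((d + 1 : ℕ) : ℝ)] X ≤ μH[((d + 1 : ℕ) : ℝ)] (S₀ ∪ ⋃ i, G i) := measure_mono hcover
    _ ≤ μH[((d + 1 : ℕ) : ℝ)] S₀ + μH[((d + 1 : ℕ) : ℝ)] (⋃ i, G i) := measure_union_le _ _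
    _ ≤ 0 + ∑' i, μH[((d + 1 : ℕ) : ℝ)] (G i) := add_le_add h0.le (measure_iUnion_le _)
    _ ≤ 0 + ∑' i, C * M₀ * ENNReal.ofReal R ^ d * ENNReal.ofReal r ^ (d + 1) *
        (2⁻¹ : ℝ≥0∞) ^ i := by gcongr with i; exact h1 i
    _ = C * (M₀ * ENNReal.ofReal R ^ d * 2) * ENNReal.ofReal r ^ (d + 1) := by
      rw [zero_add, ENNReal.tsum_mul_left, ENNReal.tsum_geometric, ENNReal.one_sub_inv_two, inv_inv]
      ring
    _ ≤ _ := by gcongr; exact le_self_add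

end ScaleMeasure

section Scales

lemma exists_max_scale {j : ℕ} (hj : 0 < j) (b : ℕ → ℝ) (hb : ∀ i, 0 ≤ b i) :
    ∃ S : ℝ, 0 ≤ S ∧ (∀ i < j, b i ≤ S ^ (j - i)) ∧ ∃ i < j, b i = S ^ (j - i) := by
  obtain ⟨i, hi, hmax⟩ := Finset.exists_max_image (Finset.range j)
    (fun i => b i ^ (((j - i : ℕ) : ℝ)⁻¹)) ⟨0, Finset.mem_range.2 hj⟩
  rw [Finset.mem_range] at hi
  have hpow : ∀ i < j, (b i ^ (((j - i : ℕ) : ℝ)⁻¹)) ^ (j - i) = b i := fun i hi =>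
    Real.rpow_inv_natCast_pow (hb i) (by omega)
  refine ⟨b i ^ (((j - i : ℕ) : ℝ)⁻¹), Real.rpow_nonneg (hb i) _, fun l hl => ?_, i, hi,
    (hpow i hi).symm⟩
  rw [← hpow l hl]
  exact pow_le_pow_left₀ (Real.rpow_nonneg (hb l) _) (hmax l (Finset.mem_range.2 hl)) _

variable {F : Type*} [NormedAddCommGroup F] [NormedSpace ℝ F] {n : ℕ} {φ : Euc n → F}

lemma norm_iteratedFDeriv_le_add (hφ : ContDiff ℝ (⊤ : ℕ∞) φ) {l : ℕ} {s : Set (Euc n)}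
    (hs : Convex ℝ s) {C : ℝ} (hC : ∀ z ∈ s, ‖iteratedFDeriv ℝ (l + 1) φ z‖ ≤ C)
    {y z : Euc n} (hy : y ∈ s) (hz : z ∈ s) :
    ‖iteratedFDeriv ℝ l φ z‖ ≤ ‖iteratedFDeriv ℝ l φ y‖ + C * dist z y := by
  have h := hs.norm_image_sub_le_of_norm_fderiv_le (𝕜 := ℝ)
    (fun u _ => hφ.iteratedFDeriv_differentiable l u)
    (fun u hu => by rw [norm_fderiv_iteratedFDeriv]; exact hC u hu) hy hz
  rw [dist_eq_norm]
  have := norm_le_norm_add_norm_sub' (iteratedFDeriv ℝ l φ z) (iteratedFDeriv ℝ l φ y)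
  linarith

lemma norm_iteratedFDeriv_sub_le (hφ : ContDiff ℝ (⊤ : ℕ∞) φ) {l : ℕ} {s : Set (Euc n)}
    (hs : Convex ℝ s) {C : ℝ} (T : Euc n [×(l + 1)]→L[ℝ] F)
    (hC : ∀ z ∈ s, ‖iteratedFDeriv ℝ (l + 1) φ z - T‖ ≤ C)
    {y z : Euc n} (hy : y ∈ s) (hz : z ∈ s) :
    ‖iteratedFDeriv ℝ l φ z - iteratedFDeriv ℝ l φ y - T.curryLeft (z - y)‖ ≤ C * dist z y := by
  rw [dist_eq_norm]
  refine hs.norm_image_sub_le_of_norm_fderiv_le' (𝕜 := ℝ) (φ := T.curryLeft)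
    (fun u _ => hφ.iteratedFDeriv_differentiable l u) (fun u hu => ?_) hy hz
  have h1 : fderiv ℝ (iteratedFDeriv ℝ l φ) u - T.curryLeft
      = (iteratedFDeriv ℝ (l + 1) φ u - T).curryLeft := by
    ext v w
    simp [iteratedFDeriv_succ_apply_left]
  rw [h1, ContinuousMultilinearMap.curryLeft_norm]
  exact hC u hu

/-- All derivatives of `φ` up to order `k + 1` on the ball `ball x r ⊆ D` are dominated, at
scale `r`, by the derivative of order `i` at the centre. -/
structure ScaleDominated (D : Set (Euc n)) (φ : Euc n → F) (k i : ℕ) (Λ : ℝ) (x : Euc n)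
    (r : ℝ) : Prop where
  pos : 0 < r
  subset : ball x r ⊆ D
  ne_zero : iteratedFDeriv ℝ i φ x ≠ 0
  bound : ∀ l ≤ k + 1, ∀ y ∈ ball x r,
    r ^ l * ‖iteratedFDeriv ℝ l φ y‖ ≤ Λ * r ^ i * ‖iteratedFDeriv ℝ i φ x‖

lemma ScaleDominated.one_le {D : Set (Euc n)} {k i : ℕ} {Λ r : ℝ} {x : Euc n}
    (h : ScaleDominated D φ k i Λ x r) (hi : i ≤ k) : 1 ≤ Λ := by
  have h1 := h.bound i (by omega) x (mem_ball_self h.pos)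
  have h2 : 0 < r ^ i * ‖iteratedFDeriv ℝ i φ x‖ :=
    mul_pos (pow_pos h.pos i) (norm_pos_iff.2 h.ne_zero)
  rw [mul_assoc] at h1
  exact (le_mul_iff_one_le_left h2).1 h1

lemma ScaleDominated.norm_le {D : Set (Euc n)} {k i : ℕ} {Λ r : ℝ} {x : Euc n}
    (h : ScaleDominated D φ k i Λ x r) (hi : i ≤ k) {l : ℕ} (hl : l ≤ i) {y : Euc n}
    (hy : y ∈ ball x r) :
    ‖iteratedFDeriv ℝ l φ y‖ ≤ Λ * r ^ (i - l) * ‖iteratedFDeriv ℝ i φ x‖ := by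
  have h1 := h.bound l (by omega) y hy
  have h2 : r ^ i = r ^ l * r ^ (i - l) := by rw [← pow_add]; congr 1; omega
  rw [h2] at h1
  have h3 : 0 < r ^ l := pow_pos h.pos l
  refine le_of_mul_le_mul_left (h1.trans_eq ?_) h3
  ring

lemma ScaleDominated.exists_scale (hφ : ContDiff ℝ (⊤ : ℕ∞) φ) {D : Set (Euc n)} {k j : ℕ}
    (hj : 0 < j) (hjk : j ≤ k) {Λ r : ℝ} {x : Euc n} (h : ScaleDominated D φ k j Λ x r) :
    ∃ s : Euc n → ℝ, ∀ y ∈ ball x (r / 2), 0 ≤ s y ∧ s y ≤ r / 2 ∧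
      (0 < s y → ∃ i < j, ScaleDominated D φ k i ((j + Λ) * (2 * Λ) ^ j) y (s y)) ∧
      (∀ l < j, ‖iteratedFDeriv ℝ l φ y‖
        ≤ (2 * Λ * s y) ^ (j - l) * ‖iteratedFDeriv ℝ j φ x‖) ∧
      ∀ y' ∈ ball x (r / 2), dist y y' ≤ 1 / (2 * (j + Λ)) * s y → s y ≤ 2 * s y' := by
  have hr := h.pos
  have hΛ := h.one_le hjk
  set τ := ‖iteratedFDeriv ℝ j φ x‖ with hτdef
  have hτ : 0 < τ := norm_pos_iff.2 h.ne_zero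
  have hj1 : (1 : ℝ) ≤ j := by exact_mod_cast hj
  choose S hS0 hSle i₀ hi₀ hi₀eq using fun y : Euc n =>
    exists_max_scale hj (fun i => ‖iteratedFDeriv ℝ i φ y‖ / τ) (fun i => by positivity)
  have hSle' : ∀ y, ∀ l < j, ‖iteratedFDeriv ℝ l φ y‖ ≤ S y ^ (j - l) * τ := fun y l hl =>
    (div_le_iff₀ hτ).1 (hSle y l hl)
  have hSeq : ∀ y, ‖iteratedFDeriv ℝ (i₀ y) φ y‖ = S y ^ (j - i₀ y) * τ := fun y =>
    (div_eq_iff hτ.ne').1 (hi₀eq y)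
  have hsubset : ball x (r / 2) ⊆ ball x r := ball_subset_ball (by linarith)
  have hSr : ∀ y ∈ ball x (r / 2), S y ≤ Λ * r := by
    intro y hy
    have h1 := h.norm_le hjk (hi₀ y).le (hsubset hy)
    rw [hSeq y] at h1
    have h2 : S y ^ (j - i₀ y) ≤ Λ * r ^ (j - i₀ y) := le_of_mul_le_mul_right h1 hτ
    have hne : j - i₀ y ≠ 0 := by have := hi₀ y; omega
    refine le_of_pow_le_pow_left₀ hne (by positivity) (h2.trans ?_)
    rw [mul_pow]
    gcongr
    exact le_self_pow₀ hΛ hne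
  have hball : ∀ y ∈ ball x (r / 2), ∀ s ≤ r / 2, ball y s ⊆ ball x r := by
    intro y hy s hs
    refine ball_subset_ball' ?_
    rw [mem_ball] at hy
    linarith
  have hdown : ∀ y ∈ ball x (r / 2), ∀ q : ℕ, q ≤ j → ∀ z ∈ ball y (S y / (2 * Λ)),
      ‖iteratedFDeriv ℝ (j - q) φ z‖ ≤ (q + Λ) * S y ^ q * τ := by
    intro y hy q
    have hs : S y / (2 * Λ) ≤ r / 2 := by
      rw [div_le_iff₀ (by positivity)]
      nlinarith [hSr y hy]
    induction q with
    | zero =>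
      intro _ z hz
      have := h.norm_le hjk le_rfl (hball y hy _ hs hz)
      simpa using this
    | succ q ih =>
      intro hq z hz
      have hspos : 0 < S y / (2 * Λ) := pos_of_mem_ball hz
      have e : j - (q + 1) + 1 = j - q := by omega
      have h1 := norm_iteratedFDeriv_le_add hφ (l := j - (q + 1)) (convex_ball y (S y / (2 * Λ)))
        (C := (q + Λ) * S y ^ q * τ) (fun u hu => by rw [e]; exact ih (by omega) u hu)
        (mem_ball_self hspos) hz
      have h2 := hSle' y (j - (q + 1)) (by omega)
      have e2 : j - (j - (q + 1)) = q + 1 := by omega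
      rw [e2] at h2
      have h3 : dist z y ≤ S y := by
        refine (mem_ball.1 hz).le.trans (div_le_self (hS0 y) (by linarith))
      have h4 : (q + Λ) * S y ^ q * τ * dist z y ≤ (q + Λ) * S y ^ q * τ * S y := by
        have := hS0 y
        gcongr
      push_cast
      calc _ ≤ _ := h1
        _ ≤ S y ^ (q + 1) * τ + (q + Λ) * S y ^ q * τ * S y := add_le_add h2 h4
        _ = _ := by ring
  refine ⟨fun y => S y / (2 * Λ), fun y hy => ?_⟩
  have hs0 : 0 ≤ S y / (2 * Λ) := div_nonneg (hS0 y) (by positivity)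
  have hsr : S y / (2 * Λ) ≤ r / 2 := by
    rw [div_le_iff₀ (by positivity)]
    nlinarith [hSr y hy]
  have hΛs : ∀ y, 2 * Λ * (S y / (2 * Λ)) = S y := fun y => by field_simp
  refine ⟨hs0, hsr, fun hpos => ⟨i₀ y, hi₀ y, hpos, ?_, ?_, ?_⟩, fun l hl => ?_, ?_⟩
  · exact (hball y hy _ hsr).trans h.subset
  · have hSpos : 0 < S y := by
      rw [← hΛs y]; positivity
    rw [← norm_pos_iff, hSeq y]
    positivity
  · intro l hl z hz
    set s := S y / (2 * Λ) with hsdef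
    have hi := hi₀ y
    have hkey : s ^ l * ‖iteratedFDeriv ℝ l φ z‖ ≤ (j + Λ) * (2 * Λ) ^ (i₀ y) * S y ^ (j - i₀ y)
        * s ^ (i₀ y) * τ := by
      have hrhs : (2 * Λ) ^ j * s ^ j = (2 * Λ) ^ (i₀ y) * S y ^ (j - i₀ y) * s ^ (i₀ y) := by
        rw [← mul_pow, hΛs y, mul_right_comm, ← mul_pow, hΛs y, ← pow_add]
        congr 1; omega
      have hmain : s ^ l * ‖iteratedFDeriv ℝ l φ z‖ ≤ (j + Λ) * ((2 * Λ) ^ j * s ^ j) * τ := by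
        rcases le_or_gt j l with hlj | hlj
        · have h1 := h.bound l hl z (hball y hy _ hsr hz)
          have e1 : r ^ l = r ^ j * r ^ (l - j) := by rw [← pow_add]; congr 1; omega
          have e2 : s ^ l = s ^ j * s ^ (l - j) := by rw [← pow_add]; congr 1; omega
          rw [e1] at h1
          have h2 : r ^ (l - j) * ‖iteratedFDeriv ℝ l φ z‖ ≤ Λ * τ := by
            refine le_of_mul_le_mul_left ?_ (pow_pos hr j)
            calc _ = r ^ j * r ^ (l - j) * ‖iteratedFDeriv ℝ l φ z‖ := by ring
              _ ≤ _ := h1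
              _ = _ := by ring
          have h3 : s ^ (l - j) ≤ r ^ (l - j) := by gcongr; linarith
          calc s ^ l * ‖iteratedFDeriv ℝ l φ z‖
              = s ^ j * (s ^ (l - j) * ‖iteratedFDeriv ℝ l φ z‖) := by rw [e2]; ring
            _ ≤ s ^ j * (r ^ (l - j) * ‖iteratedFDeriv ℝ l φ z‖) := by gcongr
            _ ≤ s ^ j * (Λ * τ) := by gcongr
            _ = Λ * (1 * s ^ j) * τ := by ring
            _ ≤ (j + Λ) * ((2 * Λ) ^ j * s ^ j) * τ := by
              gcongr
              · linarith
              · exact one_le_pow₀ (by linarith)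
        · have h1 := hdown y hy (j - l) (by omega) z hz
          have e1 : j - (j - l) = l := by omega
          rw [e1] at h1
          have e2 : s ^ j = s ^ l * s ^ (j - l) := by rw [← pow_add]; congr 1; omega
          calc s ^ l * ‖iteratedFDeriv ℝ l φ z‖
              ≤ s ^ l * (((j - l : ℕ) + Λ) * S y ^ (j - l) * τ) := by gcongr
            _ = ((j - l : ℕ) + Λ) * ((2 * Λ) ^ (j - l) * s ^ j) * τ := by
              rw [← hΛs y, ← hsdef, e2, mul_pow]; ring
            _ ≤ (j + Λ) * ((2 * Λ) ^ j * s ^ j) * τ := by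
              gcongr
              · exact Nat.sub_le _ _
              · linarith
              · exact Nat.sub_le _ _
      calc _ ≤ _ := hmain
        _ = _ := by rw [hrhs]; ring
    refine hkey.trans ?_
    rw [hSeq y]
    have h1 : (2 * Λ) ^ (i₀ y) ≤ (2 * Λ) ^ j := by
      gcongr
      linarith
    have hS0y := hS0 y
    calc _ ≤ (j + Λ) * (2 * Λ) ^ j * S y ^ (j - i₀ y) * s ^ (i₀ y) * τ := by gcongr
      _ = _ := by ring
  · rw [hΛs y]
    exact hSle' y l hl
  · intro y' hy' hdist
    beta_reduce at hdist ⊢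
    rcases hs0.eq_or_lt with h0 | hpos
    · rw [← h0]
      have := hS0 y'
      positivity
    have hi := hi₀ y
    set q := j - i₀ y - 1 with hq
    have e1 : i₀ y = j - (q + 1) := by omega
    have e2 : j - i₀ y = q + 1 := by omega
    have e3 : i₀ y + 1 = j - q := by omega
    have hcoef : 1 / (2 * (j + Λ)) < 1 := by
      rw [div_lt_one (by positivity)]
      linarith
    have hy'ball : y' ∈ ball y (S y / (2 * Λ)) := by
      rw [mem_ball, dist_comm]
      refine hdist.trans_lt ?_
      exact mul_lt_of_lt_one_left hpos hcoef
    have h1 := norm_iteratedFDeriv_le_add hφ (l := i₀ y) (convex_ball y (S y / (2 * Λ)))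
      (C := (q + Λ) * S y ^ q * τ) (fun u hu => by rw [e3]; exact hdown y hy q (by omega) u hu)
      hy'ball (mem_ball_self hpos)
    rw [hSeq y, e2] at h1
    have h2 := hSle' y' (i₀ y) hi
    rw [e2] at h2
    have hSpos : 0 < S y := by rw [← hΛs y]; positivity
    have h3 : (q + Λ) * S y ^ q * τ * dist y y' ≤ S y ^ (q + 1) * τ / 2 := by
      have hqj : (q : ℝ) ≤ j := by
        have : q ≤ j := by omega
        exact_mod_cast this
      have h4 : dist y y' ≤ 1 / (2 * (j + Λ)) * S y := hdist.trans (by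
        gcongr
        exact div_le_self hSpos.le (by linarith))
      calc (q + Λ) * S y ^ q * τ * dist y y'
          ≤ (j + Λ) * S y ^ q * τ * (1 / (2 * (j + Λ)) * S y) := by gcongr
        _ = _ := by rw [pow_succ]; field_simp
    have h5 : S y ^ (q + 1) / 2 ≤ S y' ^ (q + 1) := by
      refine le_of_mul_le_mul_right ?_ hτ
      linarith
    have h6 : (S y / 2) ^ (q + 1) ≤ S y' ^ (q + 1) := by
      refine le_trans ?_ h5
      rw [div_pow]
      refine div_le_div_of_nonneg_left (by positivity) (by norm_num) ?_
      exact le_self_pow₀ (by norm_num) (by omega)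
    have h7 : S y / 2 ≤ S y' := le_of_pow_le_pow_left₀ (by omega) (hS0 y') h6
    have h8 : S y ≤ 2 * S y' := by linarith
    calc S y / (2 * Λ) ≤ 2 * S y' / (2 * Λ) := by gcongr
      _ = _ := by ring

end Scales

section ZeroDistance

variable {F : Type*} [NormedAddCommGroup F] [NormedSpace ℝ F] {n : ℕ}

/-- Taylor's formula between two zeros of `φ`. -/
lemma norm_apply_diag_le_of_zeros {φ : Euc n → F} (hφ : ContDiff ℝ (⊤ : ℕ∞) φ) {j : ℕ}
    (hj : 0 < j) {s : Set (Euc n)} (hs : Convex ℝ s) (T : Euc n [×j]→L[ℝ] F) {ε : ℝ}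
    (hT : ∀ z ∈ s, ‖iteratedFDeriv ℝ j φ z - T‖ ≤ ε) {y v : Euc n} (hy : y ∈ s) (hyv : y + v ∈ s)
    (h0 : φ y = 0) (h1 : φ (y + v) = 0) :
    ‖T fun _ => v‖ ≤ j.factorial *
      (∑ l ∈ Finset.Ico 1 j, ‖iteratedFDeriv ℝ l φ y‖ * ‖v‖ ^ l + ε * ‖v‖ ^ j) := by
  set G : ℕ → ℝ → F := fun l t => iteratedFDeriv ℝ l φ (y + t • v) fun _ => v with hG
  have hmem : ∀ t ∈ Icc (0 : ℝ) 1, y + t • v ∈ s := fun t ht => by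
    have := hs.add_smul_sub_mem hy hyv ht
    simpa using this
  have hderiv : ∀ l t, HasDerivAt (G l) (G (l + 1) t) t := by
    intro l t
    obtain ⟨hd, hd'⟩ := hasFDerivAt_iteratedFDeriv_apply hφ l (fun _ => v) (y + t • v)
    have hline : HasDerivAt (fun t : ℝ => y + t • v) v t := by
      simpa using ((hasDerivAt_id t).smul_const v).const_add y
    have h := hd.hasFDerivAt.comp_hasDerivAt t hline
    have hcons : (Fin.cons v fun _ => v : Fin (l + 1) → Euc n) = fun _ => v := by
      funext i
      refine Fin.cases ?_ (fun i => ?_) i <;> simp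
    rw [hd' v, hcons] at h
    exact h
  have key : ∀ i ≤ j, ∀ t ∈ Icc (0 : ℝ) 1,
      ‖G (j - i) t - (t ^ i / i.factorial) • T fun _ => v‖
        ≤ ∑ l ∈ Finset.Ico (j - i) j, ‖G l 0‖ + ε * ‖v‖ ^ j := by
    intro i
    induction i with
    | zero =>
      intro _ t ht
      have h := (iteratedFDeriv ℝ j φ (y + t • v) - T).le_opNorm fun _ => v
      have h2 : ‖iteratedFDeriv ℝ j φ (y + t • v) - T‖ * ∏ _i : Fin j, ‖v‖ ≤ ε * ‖v‖ ^ j := by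
        rw [Finset.prod_const, Finset.card_univ, Fintype.card_fin]
        have := hT _ (hmem t ht)
        gcongr
      simpa [hG] using h.trans h2
    | succ i ih =>
      intro hi t ht
      have e : j - i = j - (i + 1) + 1 := by omega
      set C := ∑ l ∈ Finset.Ico (j - i) j, ‖G l 0‖ + ε * ‖v‖ ^ j with hC
      have hmv := norm_image_sub_le_of_norm_deriv_le_segment' (a := (0 : ℝ)) (b := 1) (C := C)
        (f := fun t => G (j - (i + 1)) t - (t ^ (i + 1) / (i + 1).factorial) • T fun _ => v)
        (f' := fun t => G (j - i) t - (t ^ i / i.factorial) • T fun _ => v)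
        (fun t _ => by
          refine HasDerivAt.hasDerivWithinAt ?_
          rw [e]
          refine (hderiv _ t).sub (HasDerivAt.smul_const ?_ _)
          refine ((hasDerivAt_pow (i + 1) t).div_const _).congr_deriv ?_
          rw [Nat.factorial_succ]
          push_cast
          field_simp) (fun t ht => ih (by omega) t (Ico_subset_Icc_self ht)) t ht
      have hC0 : 0 ≤ C := (norm_nonneg _).trans (ih (by omega) 0 (by simp))
      have h2 : C * (t - 0) ≤ C := by
        refine mul_le_of_le_one_right hC0 ?_
        linarith [ht.2]
      have h3 := hmv.trans h2
      rw [Finset.sum_eq_sum_Ico_succ_bot (by omega), ← e, add_assoc, ← hC]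
      have h4 := norm_le_norm_add_norm_sub'
        (G (j - (i + 1)) t - (t ^ (i + 1) / (i + 1).factorial) • T fun _ => v)
        (G (j - (i + 1)) 0)
      simp only [ne_eq, Nat.succ_ne_zero, not_false_eq_true, zero_pow, zero_div, zero_smul,
        sub_zero] at h3
      linarith
  have h := key j le_rfl 1 (by simp)
  have hG1 : G 0 1 = 0 := by simp [hG, h1]
  have hG0 : G 0 0 = 0 := by simp [hG, h0]
  rw [Nat.sub_self, hG1, Finset.sum_eq_sum_Ico_succ_bot hj, hG0, zero_sub, norm_neg, norm_smul,
    one_pow, Real.norm_of_nonneg (by positivity), norm_zero, zero_add, zero_add, one_div,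
    inv_mul_le_iff₀ (by positivity)] at h
  refine h.trans ?_
  gcongr with l hl
  have := (iteratedFDeriv ℝ l φ y).le_opNorm fun _ => v
  simpa [hG] using this

lemma exists_pow_le_add_norm_apply_diag {j d : ℕ} (hj : 0 < j) (t₀ : Euc n [×j]→L[ℝ] F)
    (π : Euc n →L[ℝ] (Fin d → ℝ)) (hπ : ∀ v, t₀ (fun _ => v) = 0 → π v = 0 → v = 0) :
    ∃ δ : ℝ, 0 < δ ∧ δ ≤ 1 ∧ ∀ t : Euc n [×j]→L[ℝ] F, ‖t - t₀‖ ≤ δ →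
      ∀ v, δ * ‖v‖ ^ j ≤ ‖π v‖ ^ j + ‖t fun _ => v‖ := by
  have hcont : Continuous fun v : Euc n => ‖π v‖ ^ j + ‖t₀ fun _ => v‖ := by fun_prop
  obtain ⟨δ, hδ, hmin⟩ := (isCompact_sphere (0 : Euc n) 1).exists_forall_le'
    (a := (0 : ℝ)) hcont.continuousOn (fun v hv => by
      have hv1 : ‖v‖ = 1 := by simpa using hv
      by_contra hcon
      have h1 : ‖π v‖ ^ j = 0 := le_antisymm (by linarith [norm_nonneg (t₀ fun _ => v)])
        (by positivity)
      have h2 : ‖t₀ fun _ => v‖ = 0 := le_antisymm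
        (by have : 0 ≤ ‖π v‖ ^ j := by positivity
            linarith) (norm_nonneg _)
      have := hπ v (norm_eq_zero.1 h2) (norm_eq_zero.1 (pow_eq_zero_iff hj.ne' |>.1 h1))
      simp [this] at hv1)
  refine ⟨min (δ / 2) 1, by positivity, min_le_right _ _, fun t ht v => ?_⟩
  rcases eq_or_ne v 0 with rfl | hv
  · simp [hj.ne']
  have hvpos : 0 < ‖v‖ := norm_pos_iff.2 hv
  have h1 := hmin (‖v‖⁻¹ • v) (by simp [norm_smul, hv])
  have h2 : (t₀ fun _ => ‖v‖⁻¹ • v) = ‖v‖⁻¹ ^ j • t₀ fun _ => v := by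
    simpa using t₀.map_smul_univ (fun _ => ‖v‖⁻¹) fun _ => v
  rw [h2, map_smul, norm_smul, norm_smul, norm_pow, norm_inv, norm_norm, mul_pow, ← mul_add,
    inv_pow, ← div_eq_inv_mul, le_div_iff₀ (by positivity)] at h1
  have h3 : ‖(t₀ - t) fun _ => v‖ ≤ δ / 2 * ‖v‖ ^ j := by
    refine ((t₀ - t).le_opNorm _).trans ?_
    rw [Finset.prod_const, Finset.card_univ, Fintype.card_fin, norm_sub_rev]
    gcongr
    exact ht.trans (min_le_left _ _)
  have h4 := norm_le_norm_add_norm_sub' (t₀ fun _ => v) (t fun _ => v)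
  have h5 : min (δ / 2) 1 * ‖v‖ ^ j ≤ δ / 2 * ‖v‖ ^ j := by
    gcongr
    exact min_le_left _ _
  have h6 : (t₀ - t) (fun _ => v) = t₀ (fun _ => v) - t fun _ => v := rfl
  rw [h6] at h3
  linarith

lemma ScaleDominated.norm_sub_le {D : Set (Euc n)} {φ : Euc n → F}
    (hφ : ContDiff ℝ (⊤ : ℕ∞) φ) {k j : ℕ} (hjk : j ≤ k)
    {Λ r : ℝ} {x : Euc n} (h : ScaleDominated D φ k j Λ x r) {θ : ℝ} (hθ : θ ≤ 1) {z : Euc n}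
    (hz : z ∈ ball x (θ * r)) :
    ‖iteratedFDeriv ℝ j φ z - iteratedFDeriv ℝ j φ x‖ ≤ Λ * θ * ‖iteratedFDeriv ℝ j φ x‖ := by
  have hr := h.pos
  have hΛ := h.one_le hjk
  have hzr : z ∈ ball x r := ball_subset_ball (mul_le_of_le_one_left hr.le hθ) hz
  have h1 := (convex_ball x r).norm_image_sub_le_of_norm_fderiv_le (𝕜 := ℝ)
    (f := iteratedFDeriv ℝ j φ) (C := Λ * ‖iteratedFDeriv ℝ j φ x‖ / r)
    (fun u _ => hφ.iteratedFDeriv_differentiable j u)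
    (fun u hu => by
      rw [norm_fderiv_iteratedFDeriv, le_div_iff₀ hr]
      have := h.bound (j + 1) (by omega) u hu
      refine le_of_mul_le_mul_left ?_ (pow_pos hr j)
      calc _ = r ^ (j + 1) * ‖iteratedFDeriv ℝ (j + 1) φ u‖ := by ring
        _ ≤ _ := this
        _ = _ := by ring) (mem_ball_self hr) hzr
  have h2 : ‖z - x‖ ≤ θ * r := by
    rw [← dist_eq_norm]; exact (mem_ball.1 hz).le
  calc _ ≤ _ := h1
    _ ≤ Λ * ‖iteratedFDeriv ℝ j φ x‖ / r * (θ * r) := by gcongr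
    _ = _ := by field_simp

/-- Zeros of `φ` are graph-like over `π` above the scale `s` if `π` is injective on the zeros
of the leading Taylor polynomial. -/
lemma exists_dist_le_of_zeros {j d : ℕ} (hj : 0 < j) (t₀ : Euc n [×j]→L[ℝ] F)
    (π : Euc n →L[ℝ] (Fin d → ℝ)) (hπ : ∀ v, t₀ (fun _ => v) = 0 → π v = 0 → v = 0)
    {Λ : ℝ} (hΛ : 1 ≤ Λ) :
    ∃ ε K κ θ : ℝ, 0 < ε ∧ 0 < K ∧ 0 < κ ∧ 0 < θ ∧ θ ≤ 1 / 2 ∧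
      ∀ (D : Set (Euc n)) (φ : Euc n → F) (k : ℕ) (x : Euc n) (r : ℝ),
        ContDiff ℝ (⊤ : ℕ∞) φ → j ≤ k → ScaleDominated D φ k j Λ x r →
        ‖‖iteratedFDeriv ℝ j φ x‖⁻¹ • iteratedFDeriv ℝ j φ x - t₀‖ ≤ ε →
        ∀ y ∈ ball x (θ * r), ∀ y' ∈ ball x (θ * r), φ y = 0 → φ y' = 0 → ∀ s : ℝ, 0 ≤ s →
        (∀ l < j, ‖iteratedFDeriv ℝ l φ y‖ ≤ (2 * Λ * s) ^ (j - l) * ‖iteratedFDeriv ℝ j φ x‖) →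
        dist y y' ≤ K * dist (π y) (π y') + κ * s := by
  obtain ⟨δ, hδ, hδ1, hdiag⟩ := exists_pow_le_add_norm_apply_diag hj t₀ π hπ
  set f : ℝ := (j.factorial : ℝ) with hf
  have hf1 : 1 ≤ f := by
    rw [hf]
    exact_mod_cast Nat.factorial_pos j
  have hj1 : (1 : ℝ) ≤ j := by exact_mod_cast hj
  set κ₀ : ℝ := δ / (4 * f * j * (2 * Λ)) with hκ₀
  set θ : ℝ := min (1 / 2) (δ / (4 * f * Λ)) with hθ
  have hκ₀pos : 0 < κ₀ := by positivity
  have hθpos : 0 < θ := by positivity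
  refine ⟨δ, 2 / δ, κ₀⁻¹, θ, hδ, by positivity, by positivity, hθpos, min_le_left _ _, ?_⟩
  intro D φ k x r hφ hjk h ht y hy y' hy' h0 h0' s hs hsl
  set τ := ‖iteratedFDeriv ℝ j φ x‖ with hτdef
  have hτ : 0 < τ := norm_pos_iff.2 h.ne_zero
  set v := y' - y with hv
  have hyv : y + v = y' := by simp [hv]
  have hdist : dist y y' = ‖v‖ := by rw [dist_comm, dist_eq_norm]
  have hdistπ : dist (π y) (π y') = ‖π v‖ := by rw [dist_comm, dist_eq_norm, hv, map_sub]
  rw [hdist, hdistπ]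
  rcases le_or_gt (‖v‖) (κ₀⁻¹ * s) with hle | hgt
  · have : 0 ≤ 2 / δ * ‖π v‖ := by positivity
    linarith
  have hsv : s ≤ κ₀ * ‖v‖ := by
    rw [inv_mul_lt_iff₀ hκ₀pos] at hgt
    exact hgt.le
  have htay := norm_apply_diag_le_of_zeros hφ hj (convex_ball x (θ * r)) (iteratedFDeriv ℝ j φ x)
    (fun z hz => h.norm_sub_le hφ hjk ((min_le_left _ _).trans (by norm_num)) hz) hy
    (by rw [hyv]; exact hy') h0 (by rw [hyv]; exact h0')
  have hqκ : 2 * Λ * κ₀ = δ / (4 * f * j) := by rw [hκ₀]; field_simp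
  have hqκ1 : 2 * Λ * κ₀ ≤ 1 := by
    rw [hqκ, div_le_one (by positivity)]
    nlinarith
  have hsum : ∑ l ∈ Finset.Ico 1 j, ‖iteratedFDeriv ℝ l φ y‖ * ‖v‖ ^ l
      ≤ j * (2 * Λ * κ₀ * ‖v‖ ^ j * τ) := by
    have hterm : ∀ l ∈ Finset.Ico 1 j, ‖iteratedFDeriv ℝ l φ y‖ * ‖v‖ ^ l
        ≤ 2 * Λ * κ₀ * ‖v‖ ^ j * τ := by
      intro l hl
      rw [Finset.mem_Ico] at hl
      have e : ‖v‖ ^ j = ‖v‖ ^ (j - l) * ‖v‖ ^ l := by rw [← pow_add]; congr 1; omega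
      calc ‖iteratedFDeriv ℝ l φ y‖ * ‖v‖ ^ l
          ≤ (2 * Λ * s) ^ (j - l) * τ * ‖v‖ ^ l := by
            gcongr
            exact hsl l hl.2
        _ ≤ (2 * Λ * (κ₀ * ‖v‖)) ^ (j - l) * τ * ‖v‖ ^ l := by gcongr
        _ = (2 * Λ * κ₀) ^ (j - l) * ‖v‖ ^ j * τ := by rw [e, ← mul_assoc, mul_pow]; ring
        _ ≤ _ := by
          gcongr
          exact pow_le_of_le_one (by positivity) hqκ1 (by omega)
    refine (Finset.sum_le_card_nsmul _ _ _ hterm).trans ?_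
    rw [nsmul_eq_mul, Nat.card_Ico]
    gcongr
    exact Nat.sub_le _ _
  have hd := hdiag _ ht v
  have e1 : ‖(τ⁻¹ • iteratedFDeriv ℝ j φ x) fun _ => v‖
      = τ⁻¹ * ‖iteratedFDeriv ℝ j φ x fun _ => v‖ := by
    rw [smul_apply, norm_smul, Real.norm_of_nonneg (by positivity)]
  have h3 : τ⁻¹ * ‖iteratedFDeriv ℝ j φ x fun _ => v‖ ≤ δ / 2 * ‖v‖ ^ j := by
    rw [inv_mul_le_iff₀ hτ]
    have hθ2 : Λ * θ ≤ δ / (4 * f) := by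
      calc Λ * θ ≤ Λ * (δ / (4 * f * Λ)) := by gcongr; exact min_le_right _ _
        _ = _ := by field_simp
    calc _ ≤ _ := htay
      _ ≤ f * (j * (δ / (4 * f * j) * ‖v‖ ^ j * τ) + δ / (4 * f) * τ * ‖v‖ ^ j) := by
        rw [← hqκ]
        gcongr
      _ = _ := by field_simp; ring
  rw [e1] at hd
  have h4 : (δ / 2 * ‖v‖) ^ j ≤ ‖π v‖ ^ j := by
    rw [mul_pow]
    have : (δ / 2) ^ j ≤ δ / 2 := pow_le_of_le_one (by positivity) (by linarith) hj.ne'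
    have : (δ / 2) ^ j * ‖v‖ ^ j ≤ δ / 2 * ‖v‖ ^ j := by gcongr
    linarith
  have h5 : δ / 2 * ‖v‖ ≤ ‖π v‖ := le_of_pow_le_pow_left₀ hj.ne' (norm_nonneg _) h4
  have h6 : ‖v‖ ≤ 2 / δ * ‖π v‖ := by
    calc ‖v‖ = 2 / δ * (δ / 2 * ‖v‖) := by field_simp
      _ ≤ _ := by gcongr
  have : 0 ≤ κ₀⁻¹ * s := by positivity
  linarith

/-- Points where the derivatives of order `j` are small lie, up to an error, in a thin
neighbourhood of a graph over `π` if `π` is injective on the kernel of the derivative of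
order `j + 1`. -/
lemma exists_dist_le_of_ker {j d : ℕ} (t₀ : Euc n [×(j + 1)]→L[ℝ] F)
    (π : Euc n →L[ℝ] (Fin d → ℝ)) (hπ : ∀ v ∈ multilinearKer t₀, π v = 0 → v = 0)
    {Λ : ℝ} (hΛ : 1 ≤ Λ) :
    ∃ ε K θ : ℝ, 0 < ε ∧ 0 < K ∧ 0 < θ ∧ θ ≤ 1 / 2 ∧
      ∀ (D : Set (Euc n)) (φ : Euc n → F) (k : ℕ) (x : Euc n) (r : ℝ),
        ContDiff ℝ (⊤ : ℕ∞) φ → j + 1 ≤ k → ScaleDominated D φ k (j + 1) Λ x r →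
        ‖‖iteratedFDeriv ℝ (j + 1) φ x‖⁻¹ • iteratedFDeriv ℝ (j + 1) φ x - t₀‖ ≤ ε →
        ∀ y ∈ ball x (θ * r), ∀ y' ∈ ball x (θ * r), ∀ s s' : ℝ, 0 ≤ s → 0 ≤ s' →
        ‖iteratedFDeriv ℝ j φ y‖ ≤ 2 * Λ * s * ‖iteratedFDeriv ℝ (j + 1) φ x‖ →
        ‖iteratedFDeriv ℝ j φ y'‖ ≤ 2 * Λ * s' * ‖iteratedFDeriv ℝ (j + 1) φ x‖ →
        dist y y' ≤ K * (dist (π y) (π y') + s + s') := by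
  have hinj : LinearMap.ker (π.prod t₀.curryLeft :
      Euc n →ₗ[ℝ] (Fin d → ℝ) × (Euc n [×j]→L[ℝ] F)) = ⊥ := by
    rw [LinearMap.ker_eq_bot']
    intro v hv
    have hv' : (π v, t₀.curryLeft v) = 0 := hv
    rw [Prod.mk_eq_zero] at hv'
    exact hπ v (by simpa [multilinearKer] using hv'.2) hv'.1
  obtain ⟨K₁, hK₁, hanti⟩ := LinearMap.exists_antilipschitzWith
    (π.prod t₀.curryLeft : Euc n →ₗ[ℝ] (Fin d → ℝ) × (Euc n [×j]→L[ℝ] F)) hinj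
  set K₀ : ℝ := (K₁ : ℝ) with hK₀
  have hK₀pos : 0 < K₀ := NNReal.coe_pos.2 hK₁
  have hbound : ∀ v, ‖v‖ ≤ K₀ * (‖π v‖ + ‖t₀.curryLeft v‖) := by
    intro v
    have h1 := hanti.le_mul_dist v 0
    rw [map_zero, dist_zero_right, dist_zero_right] at h1
    refine h1.trans ?_
    gcongr
    change max ‖π v‖ ‖t₀.curryLeft v‖ ≤ _
    exact max_le (by simp) (by simp)
  set θ : ℝ := min (1 / 2) (1 / (4 * K₀ * Λ)) with hθ
  have hθpos : 0 < θ := by positivity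
  refine ⟨1 / (4 * K₀), 4 * K₀ * Λ, θ, by positivity, by positivity, hθpos, min_le_left _ _, ?_⟩
  intro D φ k x r hφ hjk h ht y hy y' hy' s s' hs hs' hsy hsy'
  set τ := ‖iteratedFDeriv ℝ (j + 1) φ x‖ with hτdef
  have hτ : 0 < τ := norm_pos_iff.2 h.ne_zero
  set T := iteratedFDeriv ℝ (j + 1) φ x with hT
  set v := y' - y with hv
  have hdist : dist y y' = ‖v‖ := by rw [dist_comm, dist_eq_norm]
  have hdist' : dist y' y = ‖v‖ := by rw [dist_eq_norm]
  have hdistπ : dist (π y) (π y') = ‖π v‖ := by rw [dist_comm, dist_eq_norm, hv, map_sub]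
  rw [hdist, hdistπ]
  have h1 := norm_iteratedFDeriv_sub_le hφ (convex_ball x (θ * r)) T
    (fun z hz => h.norm_sub_le hφ hjk ((min_le_left _ _).trans (by norm_num)) hz) hy hy'
  rw [hdist'] at h1
  have h2 : ‖T.curryLeft v‖ ≤ 2 * Λ * (s + s') * τ + Λ * θ * τ * ‖v‖ := by
    have e : T.curryLeft v = iteratedFDeriv ℝ j φ y' - iteratedFDeriv ℝ j φ y
        - (iteratedFDeriv ℝ j φ y' - iteratedFDeriv ℝ j φ y - T.curryLeft v) := by abel
    rw [e]
    refine (norm_sub_le _ _).trans ?_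
    have := norm_sub_le (iteratedFDeriv ℝ j φ y') (iteratedFDeriv ℝ j φ y)
    linarith
  have h3 : ‖(τ⁻¹ • T).curryLeft v‖ ≤ 2 * Λ * (s + s') + Λ * θ * ‖v‖ := by
    have e : (τ⁻¹ • T).curryLeft v = τ⁻¹ • T.curryLeft v := rfl
    rw [e, norm_smul, Real.norm_of_nonneg (by positivity), inv_mul_le_iff₀ hτ]
    linarith
  have h4 : ‖t₀.curryLeft v‖ ≤ ‖(τ⁻¹ • T).curryLeft v‖ + 1 / (4 * K₀) * ‖v‖ := by
    have e : (τ⁻¹ • T).curryLeft v - t₀.curryLeft v = (τ⁻¹ • T - t₀).curryLeft v := rfl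
    have h5 := norm_le_norm_add_norm_sub ((τ⁻¹ • T).curryLeft v) (t₀.curryLeft v)
    rw [e] at h5
    have h6 := (τ⁻¹ • T - t₀).curryLeft.le_opNorm v
    rw [ContinuousMultilinearMap.curryLeft_norm] at h6
    have h7 : ‖τ⁻¹ • T - t₀‖ * ‖v‖ ≤ 1 / (4 * K₀) * ‖v‖ := by gcongr
    linarith
  have hθ2 : Λ * θ ≤ 1 / (4 * K₀) := by
    calc Λ * θ ≤ Λ * (1 / (4 * K₀ * Λ)) := by gcongr; exact min_le_right _ _
      _ = _ := by field_simp
  have h8 : ‖v‖ ≤ K₀ * (‖π v‖ + (2 * Λ * (s + s') + 1 / (4 * K₀) * ‖v‖ + 1 / (4 * K₀) * ‖v‖)) := by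
    refine (hbound v).trans ?_
    gcongr
    have : Λ * θ * ‖v‖ ≤ 1 / (4 * K₀) * ‖v‖ := by gcongr
    linarith
  have h9 : K₀ * (‖π v‖ + (2 * Λ * (s + s') + 1 / (4 * K₀) * ‖v‖ + 1 / (4 * K₀) * ‖v‖))
      = K₀ * ‖π v‖ + 2 * K₀ * Λ * (s + s') + ‖v‖ / 2 := by field_simp; ring
  rw [h9] at h8
  have h10 : K₀ * ‖π v‖ ≤ 2 * K₀ * Λ * ‖π v‖ := by
    gcongr
    nlinarith
  linarith

end ZeroDistance

section MeasureBound

variable {F : Type*} [NormedAddCommGroup F] [NormedSpace ℝ F] {n : ℕ}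

/-- The zeros of `φ` near the centre of a sufficiently small ball on which `φ` satisfies
`ScaleDominated` have measure bounded as for an `m`-dimensional set, where the ball satisfies
the further condition `P`. -/
def ZeroMeasureBound (D : Set (Euc n)) (φ : Euc n → F) (k m i : ℕ) (Λ : ℝ)
    (P : Euc n → Prop) : Prop :=
  ∃ c : ℝ, 0 < c ∧ ∃ C : ℝ≥0∞, C ≠ ⊤ ∧ ∃ r₀ : ℝ, 0 < r₀ ∧ ∀ x r, r ≤ r₀ → P x →
    ScaleDominated D φ k i Λ x r →
    μH[(m : ℝ)] ({y | φ y = 0} ∩ ball x (c * r)) ≤ C * ENNReal.ofReal r ^ m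

variable {D : Set (Euc n)} {φ : Euc n → F} {k m : ℕ} {Λ : ℝ}

lemma ZeroMeasureBound.mono {i : ℕ} {P Q : Euc n → Prop} (h : ZeroMeasureBound D φ k m i Λ Q)
    (hPQ : ∀ x, P x → Q x) : ZeroMeasureBound D φ k m i Λ P := by
  obtain ⟨c, hc, C, hC, r₀, hr₀, h⟩ := h
  exact ⟨c, hc, C, hC, r₀, hr₀, fun x r hr hP hs => h x r hr (hPQ x hP) hs⟩

lemma exists_uniform_bound {S : Set (Euc n)} {p q : Euc n → ℝ → Prop}
    (hp : ∃ c : ℝ, 0 < c ∧ ∃ C : ℝ≥0∞, C ≠ ⊤ ∧ ∃ r₀ : ℝ, 0 < r₀ ∧ ∀ x r, 0 < r → r ≤ r₀ → p x r →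
      μH[(m : ℝ)] (S ∩ ball x (c * r)) ≤ C * ENNReal.ofReal r ^ m)
    (hq : ∃ c : ℝ, 0 < c ∧ ∃ C : ℝ≥0∞, C ≠ ⊤ ∧ ∃ r₀ : ℝ, 0 < r₀ ∧ ∀ x r, 0 < r → r ≤ r₀ → q x r →
      μH[(m : ℝ)] (S ∩ ball x (c * r)) ≤ C * ENNReal.ofReal r ^ m) :
    ∃ c : ℝ, 0 < c ∧ ∃ C : ℝ≥0∞, C ≠ ⊤ ∧ ∃ r₀ : ℝ, 0 < r₀ ∧ ∀ x r, 0 < r → r ≤ r₀ →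
      (p x r ∨ q x r) →
      μH[(m : ℝ)] (S ∩ ball x (c * r)) ≤ C * ENNReal.ofReal r ^ m := by
  obtain ⟨c, hc, C, hC, r₀, hr₀, h⟩ := hp
  obtain ⟨c', hc', C', hC', r₀', hr₀', h'⟩ := hq
  refine ⟨min c c', lt_min hc hc', C + C', ENNReal.add_ne_top.2 ⟨hC, hC'⟩, min r₀ r₀',
    lt_min hr₀ hr₀', fun x r hr0 hr hpq => ?_⟩
  rcases hpq with hpx | hqx
  · calc _ ≤ μH[(m : ℝ)] (S ∩ ball x (c * r)) := by
          gcongr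
          exact min_le_left _ _
      _ ≤ C * ENNReal.ofReal r ^ m := h x r hr0 (hr.trans (min_le_left _ _)) hpx
      _ ≤ _ := by gcongr; exact le_self_add
  · calc _ ≤ μH[(m : ℝ)] (S ∩ ball x (c' * r)) := by
          gcongr
          exact min_le_right _ _
      _ ≤ C' * ENNReal.ofReal r ^ m := h' x r hr0 (hr.trans (min_le_right _ _)) hqx
      _ ≤ _ := by gcongr; exact le_add_self

lemma ZeroMeasureBound.or {i : ℕ} {P Q : Euc n → Prop} (hP : ZeroMeasureBound D φ k m i Λ P)
    (hQ : ZeroMeasureBound D φ k m i Λ Q) :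
    ZeroMeasureBound D φ k m i Λ fun x => P x ∨ Q x := by
  obtain ⟨c, hc, C, hC, r₀, hr₀, h⟩ := exists_uniform_bound (m := m) (S := {y | φ y = 0})
    (p := fun x r => P x ∧ ScaleDominated D φ k i Λ x r)
    (q := fun x r => Q x ∧ ScaleDominated D φ k i Λ x r)
    (by
      obtain ⟨c, hc, C, hC, r₀, hr₀, h⟩ := hP
      exact ⟨c, hc, C, hC, r₀, hr₀, fun x r _ hr hp => h x r hr hp.1 hp.2⟩)
    (by
      obtain ⟨c, hc, C, hC, r₀, hr₀, h⟩ := hQ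
      exact ⟨c, hc, C, hC, r₀, hr₀, fun x r _ hr hp => h x r hr hp.1 hp.2⟩)
  exact ⟨c, hc, C, hC, r₀, hr₀, fun x r hr hPQ hs =>
    h x r hs.pos hr (hPQ.imp (fun h => ⟨h, hs⟩) fun h => ⟨h, hs⟩)⟩

lemma exists_uniform_zeroMeasureBound {j : ℕ}
    (h : ∀ i < j, ZeroMeasureBound D φ k m i Λ fun _ => True) :
    ∃ c : ℝ, 0 < c ∧ ∃ C : ℝ≥0∞, C ≠ ⊤ ∧ ∃ r₀ : ℝ, 0 < r₀ ∧ ∀ x r, 0 < r → r ≤ r₀ →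
      (∃ i < j, ScaleDominated D φ k i Λ x r) →
      μH[(m : ℝ)] ({y | φ y = 0} ∩ ball x (c * r)) ≤ C * ENNReal.ofReal r ^ m := by
  induction j with
  | zero => exact ⟨1, one_pos, 0, by simp, 1, one_pos, by simp⟩
  | succ j ih =>
    obtain ⟨c, hc, C, hC, r₀, hr₀, h'⟩ := exists_uniform_bound (ih fun i hi => h i (by omega))
      (q := fun x r => ScaleDominated D φ k j Λ x r) (by
        obtain ⟨c, hc, C, hC, r₀, hr₀, h⟩ := h j (by omega)
        exact ⟨c, hc, C, hC, r₀, hr₀, fun x r _ hr hp => h x r hr trivial hp⟩)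
    refine ⟨c, hc, C, hC, r₀, hr₀, fun x r hr0 hr ⟨i, hi, hs⟩ => h' x r hr0 hr ?_⟩
    rcases Nat.lt_succ_iff_lt_or_eq.1 hi with hi | rfl
    · exact Or.inl ⟨i, hi, hs⟩
    · exact Or.inr hs

lemma zeroMeasureBound_zero (hφ : ContDiff ℝ (⊤ : ℕ∞) φ) (hΛ : 1 ≤ Λ) :
    ZeroMeasureBound D φ k m 0 Λ fun _ => True := by
  refine ⟨1 / (2 * Λ), by positivity, 0, by simp, 1, one_pos, fun x r _ _ h => ?_⟩
  have hempty : {y | φ y = 0} ∩ ball x (1 / (2 * Λ) * r) = ∅ := by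
    refine eq_empty_of_forall_notMem fun y ⟨hy0, hy⟩ => ?_
    have hτ : 0 < ‖iteratedFDeriv ℝ 0 φ x‖ := norm_pos_iff.2 h.ne_zero
    have h1 := h.norm_sub_le hφ (Nat.zero_le k) (θ := 1 / (2 * Λ))
      ((div_le_one (by positivity)).2 (by linarith)) hy
    have h2 : iteratedFDeriv ℝ 0 φ y = 0 := by
      rw [← norm_eq_zero, norm_iteratedFDeriv_zero, norm_eq_zero]
      exact hy0
    have h3 : Λ * (1 / (2 * Λ)) = 1 / 2 := by field_simp
    rw [h2, zero_sub, norm_neg, h3] at h1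
    linarith
  rw [hempty, measure_empty]
  simp

variable {Ω : Set (Euc n)} {a : Fin n → Euc n → F →L[ℝ] F} {V : Euc n → F → F}

lemma LocalSolution.zeroMeasureBound_of_symbol_ne_zero (h : LocalSolution Ω a V φ)
    (hD : IsCompact D) (hDΩ : D ⊆ Ω) {j : ℕ} (hjk : j + 1 ≤ k)
    {x₀ : Euc n} (hx₀ : x₀ ∈ Ω) {t₀ : Euc n [×(j + 1)]→L[ℝ] F} {w : Fin j → Euc n}
    (hw : ∑ l, a l x₀ (t₀ (Fin.cons (EuclideanSpace.single l 1) w)) ≠ 0) :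
    ∃ O ∈ 𝓝 (x₀, t₀), ZeroMeasureBound D φ k m (j + 1) Λ fun x =>
      (x, ‖iteratedFDeriv ℝ (j + 1) φ x‖⁻¹ • iteratedFDeriv ℝ (j + 1) φ x) ∈ O := by
  set L : Euc n × (Euc n [×(j + 1)]→L[ℝ] F) → F := fun p =>
    ∑ l, a l p.1 (p.2 (Fin.cons (EuclideanSpace.single l 1) w)) with hL
  have hcont : ContinuousAt L (x₀, t₀) := by
    refine tendsto_finsetSum _ fun l _ => ?_
    have h1 : ContinuousAt (fun p : Euc n × (Euc n [×(j + 1)]→L[ℝ] F) => a l p.1) (x₀, t₀) :=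
      ((h.contDiffOn_symbol l).continuousOn.continuousAt (h.isOpen.mem_nhds hx₀)).comp
        continuousAt_fst
    have h2 : Continuous fun p : Euc n × (Euc n [×(j + 1)]→L[ℝ] F) =>
        p.2 (Fin.cons (EuclideanSpace.single l 1) w) :=
      (ContinuousMultilinearMap.apply ℝ (fun _ => Euc n) F _).continuous.comp continuous_snd
    exact h1.clm_apply h2.continuousAt
  set η : ℝ := ‖L (x₀, t₀)‖ / 2 with hη
  have hηpos : 0 < η := half_pos (norm_pos_iff.2 hw)
  obtain ⟨C, hC0, hC⟩ := h.norm_symbol_le j w hD hDΩ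
  refine ⟨{p | η < ‖L p‖}, hcont.norm.eventually (lt_mem_nhds (half_lt_self (norm_pos_iff.2 hw))),
    1, one_pos, 0, by simp, min 1 (η / (C * ((j + 1) * |Λ|) + 1)), by positivity, ?_⟩
  intro x r hr hx hs
  exfalso
  have hrpos := hs.pos
  have hΛ := hs.one_le hjk
  rw [abs_of_nonneg (by linarith)] at hr
  set τ := ‖iteratedFDeriv ℝ (j + 1) φ x‖ with hτdef
  have hτ : 0 < τ := norm_pos_iff.2 hs.ne_zero
  have hxball := mem_ball_self hs.pos (x := x)
  have h1 := hC x (hs.subset hxball)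
  have h2 : ∑ l ∈ Finset.range (j + 1), ‖iteratedFDeriv ℝ l φ x‖ ≤ (j + 1) * (Λ * r * τ) := by
    have := Finset.sum_le_card_nsmul (Finset.range (j + 1)) (fun l => ‖iteratedFDeriv ℝ l φ x‖)
      (Λ * r * τ) (fun l hl => by
        rw [Finset.mem_range] at hl
        refine (hs.norm_le hjk (l := l) (by omega) hxball).trans ?_
        gcongr
        exact pow_le_of_le_one hrpos.le (hr.trans (min_le_left _ _)) (by omega))
    simpa using this
  have h3 : L (x, τ⁻¹ • iteratedFDeriv ℝ (j + 1) φ x) = τ⁻¹ • ∑ l, a l x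
      (iteratedFDeriv ℝ (j + 1) φ x (Fin.cons (EuclideanSpace.single l 1) w)) := by
    simp [hL, Finset.smul_sum]
  have h4 : η < ‖L (x, τ⁻¹ • iteratedFDeriv ℝ (j + 1) φ x)‖ := hx
  rw [h3, norm_smul, Real.norm_of_nonneg (by positivity), ← div_eq_inv_mul, lt_div_iff₀ hτ] at h4
  have h5 : η * τ < C * ((j + 1) * (Λ * r * τ)) := h4.trans_le (h1.trans (by gcongr))
  have h6 : η < C * ((j + 1) * Λ) * r := by
    refine lt_of_mul_lt_mul_right ?_ hτ.le
    linarith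
  have h7 := hr.trans (min_le_right _ _)
  rw [le_div_iff₀ (by positivity)] at h7
  linarith

lemma LocalSolution.zeroMeasureBound_nhds (h : LocalSolution Ω a V φ)
    (hn : n = m + 2) (hD : IsCompact D) (hDΩ : D ⊆ Ω) {j : ℕ} (hjk : j + 1 ≤ k) (hΛ : 1 ≤ Λ)
    (ih : ∃ c : ℝ, 0 < c ∧ ∃ C : ℝ≥0∞, C ≠ ⊤ ∧ ∃ r₀ : ℝ, 0 < r₀ ∧ ∀ x r, 0 < r → r ≤ r₀ →
      (∃ i < j + 1, ScaleDominated D φ k i (((j + 1 : ℕ) + Λ) * (2 * Λ) ^ (j + 1)) x r) →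
      μH[(m : ℝ)] ({y | φ y = 0} ∩ ball x (c * r)) ≤ C * ENNReal.ofReal r ^ m)
    {x₀ : Euc n} (hx₀ : x₀ ∈ D) {t₀ : Euc n [×(j + 1)]→L[ℝ] F} (ht₀ : t₀ ≠ 0)
    (hsymm : IsSymmMultilinear t₀) :
    ∃ O ∈ 𝓝 (x₀, t₀), ZeroMeasureBound D φ k m (j + 1) Λ fun x =>
      (x, ‖iteratedFDeriv ℝ (j + 1) φ x‖⁻¹ • iteratedFDeriv ℝ (j + 1) φ x) ∈ O := by
  by_cases hsym : ∀ w : Fin j → Euc n,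
    ∑ l, a l x₀ (t₀ (Fin.cons (EuclideanSpace.single l 1) w)) = 0
  swap
  · push Not at hsym
    obtain ⟨w, hw⟩ := hsym
    exact h.zeroMeasureBound_of_symbol_ne_zero hD hDΩ hjk (hDΩ hx₀) hw
  have hell := h.elliptic x₀ (hDΩ hx₀)
  have hrank := finrank_multilinearKer_le hell ht₀ hsym
  obtain ⟨c, hc, C, hC, r₀, hr₀, ih⟩ := ih
  have hnhds : ∀ ε : ℝ, 0 < ε → (univ : Set (Euc n)) ×ˢ closedBall t₀ ε ∈ 𝓝 (x₀, t₀) :=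
    fun ε hε => prod_mem_nhds univ_mem (closedBall_mem_nhds _ hε)
  have hX : ∀ (θ x r), θ ≤ 1 / 2 → 0 < r → {y | φ y = 0} ∩ ball x (θ * r) ⊆ ball x r ∧
      ball x (θ * r) ⊆ ball x (r / 2) := by
    intro θ x r hθ hr
    have : ball x (θ * r) ⊆ ball x (r / 2) := ball_subset_ball (by nlinarith)
    exact ⟨inter_subset_right.trans (this.trans (ball_subset_ball (by linarith))), this⟩
  rcases Nat.lt_or_ge (Module.finrank ℝ (multilinearKer t₀)) m with hlt | hge
  · obtain ⟨d, rfl⟩ : ∃ d, m = d + 1 := Nat.exists_eq_succ_of_ne_zero (by omega)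
    obtain ⟨π, hπ⟩ := exists_continuousLinearMap_injOn (multilinearKer t₀) (d := d) (by omega)
    obtain ⟨ε, K, θ, hε, hK, hθ, hθ2, hdist⟩ := exists_dist_le_of_ker t₀ π hπ hΛ
    obtain ⟨M, hM, hmeas⟩ := exists_hausdorffMeasure_le_of_thin_scale d π hc hK
    refine ⟨_, hnhds ε hε, θ, hθ, (C + 1) * M, ENNReal.mul_ne_top (by simpa using hC) hM, r₀, hr₀,
      fun x r hr hxO hs => ?_⟩
    obtain ⟨s, hsc⟩ := hs.exists_scale h.contDiff (Nat.succ_pos j) hjk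
    obtain ⟨hX1, hX2⟩ := hX θ x r hθ2 hs.pos
    have ht := mem_closedBall_iff_norm.1 hxO.2
    refine hmeas _ s x r C hs.pos hX1 (fun y hy => ?_) (fun y hy hy0 => ?_) fun y hy y' hy' => ?_
    · have := hsc y (hX2 hy.2)
      exact ⟨this.1, this.2.1.trans (by linarith [hs.pos])⟩
    · have := hsc y (hX2 hy.2)
      refine le_trans (measure_mono ?_) (ih y (s y) hy0 ?_ (this.2.2.1 hy0))
      · exact inter_subset_inter_left _ inter_subset_left
      · linarith [hs.pos, this.2.1]
    · have h1 := hsc y (hX2 hy.2)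
      have h2 := hsc y' (hX2 hy'.2)
      refine hdist D φ k x r h.contDiff hjk hs ht y hy.2 y' hy'.2 _ _ h1.1 h2.1 ?_ ?_
      · simpa using h1.2.2.2.1 j (Nat.lt_succ_self j)
      · simpa using h2.2.2.2.1 j (Nat.lt_succ_self j)
  · obtain ⟨π, hπ⟩ := exists_continuousLinearMap_injOn (multilinearKer t₀) (d := m) (by omega)
    obtain ⟨ε, K, κ, θ, hε, hK, hκ, hθ, hθ2, hdist⟩ := exists_dist_le_of_zeros (Nat.succ_pos j) t₀ π
      (fun v hv => hπ v (mem_multilinearKer_of_apply_diag hell hsymm hsym (by omega) hv)) hΛ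
    obtain ⟨M, hM, hmeas⟩ := exists_hausdorffMeasure_le_of_graph_scale m π hc hκ
      (θ := 1 / (2 * ((j + 1 : ℕ) + Λ))) (by positivity) hK
    refine ⟨_, hnhds ε hε, θ, hθ, (C + 1) * M, ENNReal.mul_ne_top (by simpa using hC) hM, r₀, hr₀,
      fun x r hr hxO hs => ?_⟩
    obtain ⟨s, hsc⟩ := hs.exists_scale h.contDiff (Nat.succ_pos j) hjk
    obtain ⟨hX1, hX2⟩ := hX θ x r hθ2 hs.pos
    have ht := mem_closedBall_iff_norm.1 hxO.2
    refine hmeas _ s x r C hs.pos hX1 (fun y hy => ?_) (fun y hy hy0 => ?_) (fun y hy y' hy' => ?_)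
      fun y hy y' hy' => (hsc y (hX2 hy.2)).2.2.2.2 y' (hX2 hy'.2)
    · have := hsc y (hX2 hy.2)
      exact ⟨this.1, this.2.1.trans (by linarith [hs.pos])⟩
    · have := hsc y (hX2 hy.2)
      refine le_trans (measure_mono ?_) (ih y (s y) hy0 ?_ (this.2.2.1 hy0))
      · exact inter_subset_inter_left _ inter_subset_left
      · linarith [hs.pos, this.2.1]
    · have h1 := hsc y (hX2 hy.2)
      exact hdist D φ k x r h.contDiff hjk hs ht y hy.2 y' hy'.2 hy.1 hy'.1 _ h1.1 h1.2.2.2.1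

lemma LocalSolution.zeroMeasureBound [FiniteDimensional ℝ F] (h : LocalSolution Ω a V φ)
    (hn : n = m + 2) (hD : IsCompact D) (hDΩ : D ⊆ Ω) (j : ℕ) (hjk : j ≤ k) :
    ∀ Λ : ℝ, 1 ≤ Λ → ZeroMeasureBound D φ k m j Λ fun _ => True := by
  induction j using Nat.strong_induction_on with
  | _ j ih =>
  intro Λ hΛ
  rcases j with _ | j
  · exact zeroMeasureBound_zero h.contDiff hΛ
  have hΛ' : 1 ≤ ((j + 1 : ℕ) + Λ) * (2 * Λ) ^ (j + 1) := by
    refine one_le_mul_of_one_le_of_one_le ?_ (one_le_pow₀ (by linarith))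
    have : (0 : ℝ) ≤ (j + 1 : ℕ) := by positivity
    linarith
  have hunif := exists_uniform_zeroMeasureBound (j := j + 1) fun i hi =>
    ih i hi (by omega) _ hΛ'
  have hproper : ProperSpace (Euc n [×(j + 1)]→L[ℝ] F) := FiniteDimensional.proper ℝ _
  set S : Set (Euc n [×(j + 1)]→L[ℝ] F) := sphere 0 1 ∩ {t | IsSymmMultilinear t} with hS
  have hclosed : IsClosed {t : Euc n [×(j + 1)]→L[ℝ] F | IsSymmMultilinear t} := by
    simp only [IsSymmMultilinear, ofPred_forall]
    refine isClosed_iInter fun σ => isClosed_iInter fun w => isClosed_eq ?_ ?_ <;>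
    exact (ContinuousMultilinearMap.apply ℝ (fun _ => Euc n) F _).continuous
  have hScomp : IsCompact (D ×ˢ S) := hD.prod ((isCompact_sphere _ _).inter_right hclosed)
  have hall := hScomp.induction_on (p := fun O => ZeroMeasureBound D φ k m (j + 1) Λ fun x =>
      (x, ‖iteratedFDeriv ℝ (j + 1) φ x‖⁻¹ • iteratedFDeriv ℝ (j + 1) φ x) ∈ O)
    ⟨1, one_pos, 0, by simp, 1, one_pos, fun x r _ hx => hx.elim⟩
    (fun s t hst ht => ht.mono fun x hx => hst hx)
    (fun s t hs ht => hs.or ht)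
    (fun p hp => by
      obtain ⟨O, hO, hb⟩ := h.zeroMeasureBound_nhds hn hD hDΩ hjk hΛ hunif hp.1
        (norm_pos_iff.1 (by rw [mem_sphere_zero_iff_norm.1 hp.2.1]; exact one_pos)) hp.2.2
      exact ⟨O, mem_nhdsWithin_of_mem_nhds hO, hb⟩)
  obtain ⟨c, hc, C, hC, r₀, hr₀, hb⟩ := hall
  refine ⟨c, hc, C, hC, r₀, hr₀, fun x r hr _ hs =>
    hb x r hr ⟨hs.subset (mem_ball_self hs.pos), ?_, ?_⟩ hs⟩
  · rw [mem_sphere_zero_iff_norm]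
    exact norm_smul_inv_norm (𝕜 := ℝ) hs.ne_zero
  · intro σ w
    rw [smul_apply, smul_apply, isSymmMultilinear_iteratedFDeriv h.contDiff (j + 1) x σ w]

end MeasureBound

section LocallyFinite

variable {F : Type*} [NormedAddCommGroup F] [NormedSpace ℝ F] {n m : ℕ} {Ω : Set (Euc n)}
  {a : Fin n → Euc n → F →L[ℝ] F} {V : Euc n → F → F} {φ : Euc n → F}

lemma exists_scaleDominated (hφ : ContDiff ℝ (⊤ : ℕ∞) φ) {p : Euc n} {k : ℕ}
    (hk : iteratedFDeriv ℝ k φ p ≠ 0) (hlow : ∀ l < k, iteratedFDeriv ℝ l φ p = 0) {ρ : ℝ}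
    (hρ1 : ρ ≤ 1) :
    ∃ Λ : ℝ, 1 ≤ Λ ∧ ∀ r, 0 < r → r ≤ ρ → ScaleDominated (closedBall p ρ) φ k k Λ p r := by
  have hcont : Continuous fun y => ∑ l ∈ Finset.range (k + 2), ‖iteratedFDeriv ℝ l φ y‖ :=
    continuous_finsetSum _ fun l _ => (hφ.iteratedFDeriv_smooth l).continuous.norm
  obtain ⟨M, hM⟩ := (isCompact_closedBall p ρ).exists_bound_of_continuousOn hcont.continuousOn
  have hbound : ∀ l ≤ k + 1, ∀ y ∈ closedBall p ρ, ‖iteratedFDeriv ℝ l φ y‖ ≤ M := by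
    intro l hl y hy
    refine le_trans ?_ ((le_abs_self _).trans (hM y hy))
    exact Finset.single_le_sum (f := fun l => ‖iteratedFDeriv ℝ l φ y‖)
      (fun _ _ => norm_nonneg _) (Finset.mem_range.2 (by omega))
  set τ := ‖iteratedFDeriv ℝ k φ p‖ with hτdef
  have hτ : 0 < τ := norm_pos_iff.2 hk
  refine ⟨max 1 (M / τ), le_max_left _ _, fun r hr hrρ => ?_⟩
  have hsub : ball p r ⊆ closedBall p ρ := ball_subset_closedBall.trans (closedBall_subset_closedBall hrρ)
  have hM0 : 0 ≤ M := (norm_nonneg _).trans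
    (hbound 0 (by omega) p (hsub (mem_ball_self hr)))
  refine ⟨hr, hsub, hk, fun l hl y hy => ?_⟩
  have hMτ : M ≤ max 1 (M / τ) * τ := by
    calc M = M / τ * τ := by field_simp
      _ ≤ _ := by gcongr; exact le_max_right _ _
  have hdown : ∀ q ≤ k, ∀ z ∈ ball p r, ‖iteratedFDeriv ℝ (k - q) φ z‖ ≤ M * r ^ q := by
    intro q
    induction q with
    | zero => intro _ z hz; simpa using hbound k (by omega) z (hsub hz)
    | succ q ih =>
      intro hq z hz
      have e : k - (q + 1) + 1 = k - q := by omega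
      have h1 := norm_iteratedFDeriv_le_add hφ (l := k - (q + 1)) (convex_ball p r)
        (C := M * r ^ q) (fun u hu => by rw [e]; exact ih (by omega) u hu) (mem_ball_self hr) hz
      rw [hlow _ (by omega), norm_zero, zero_add] at h1
      calc _ ≤ _ := h1
        _ ≤ M * r ^ q * r := by gcongr; exact (mem_ball.1 hz).le
        _ = _ := by ring
  have hmain : r ^ l * ‖iteratedFDeriv ℝ l φ y‖ ≤ r ^ k * M := by
    rcases Nat.lt_or_ge k l with hkl | hkl
    · calc _ ≤ r ^ l * M := by gcongr; exact hbound l hl y (hsub hy)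
        _ ≤ r ^ k * M := by
          gcongr ?_ * M
          exact pow_le_pow_of_le_one hr.le (hrρ.trans hρ1) hkl.le
    · have h1 := hdown (k - l) (by omega) y hy
      have e : k - (k - l) = l := by omega
      rw [e] at h1
      have e2 : r ^ k = r ^ l * r ^ (k - l) := by rw [← pow_add]; congr 1; omega
      calc _ ≤ r ^ l * (M * r ^ (k - l)) := by gcongr
        _ = _ := by rw [e2]; ring
  calc _ ≤ _ := hmain
    _ ≤ r ^ k * (max 1 (M / τ) * τ) := by gcongr
    _ = _ := by ring

lemma LocalSolution.exists_hausdorffMeasure_lt_top [FiniteDimensional ℝ F]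
    (h : LocalSolution Ω a V φ) (hn : n = m + 2) {p : Euc n} (hp : p ∈ Ω)
    (hord : ∃ k, iteratedFDeriv ℝ k φ p ≠ 0) :
    ∃ r > 0, μH[(m : ℝ)] ({y | φ y = 0} ∩ ball p r) < ⊤ := by
  classical
  obtain ⟨ρ', hρ', hball⟩ := Metric.nhds_basis_closedBall.mem_iff.1 (h.isOpen.mem_nhds hp)
  set ρ := min ρ' 1 with hρ
  have hsub : closedBall p ρ ⊆ Ω :=
    (closedBall_subset_closedBall (min_le_left _ _)).trans hball
  obtain ⟨Λ, hΛ, hdom⟩ := exists_scaleDominated h.contDiff (Nat.find_spec hord)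
    (fun l hl => not_not.1 (Nat.find_min hord hl)) (ρ := ρ) (min_le_right _ _)
  obtain ⟨c, hc, C, hC, r₀, hr₀, hb⟩ := h.zeroMeasureBound hn (isCompact_closedBall p ρ) hsub
    (Nat.find hord) le_rfl Λ hΛ
  have hr : 0 < min ρ r₀ := by positivity
  refine ⟨c * min ρ r₀, by positivity, ?_⟩
  refine (hb p (min ρ r₀) (min_le_right _ _) trivial (hdom _ hr (min_le_left _ _))).trans_lt ?_
  exact ENNReal.mul_lt_top hC.lt_top (ENNReal.pow_lt_top ENNReal.ofReal_lt_top)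

end LocallyFinite

section Matrices

variable {n N : ℕ}

lemma ContDiffOn.exists_contDiff_eqOn_ball {F : Type*} [NormedAddCommGroup F] [NormedSpace ℝ F]
    {U : Set (Euc n)} (hU : IsOpen U) {φ : Euc n → F} (hφ : ContDiffOn ℝ (⊤ : ℕ∞) φ U)
    {p : Euc n} (hp : p ∈ U) :
    ∃ ρ > 0, ball p ρ ⊆ U ∧ ∃ ψ : Euc n → F, ContDiff ℝ (⊤ : ℕ∞) ψ ∧ EqOn ψ φ (ball p ρ) := by
  obtain ⟨R, hR, hball⟩ := Metric.nhds_basis_closedBall.mem_iff.1 (hU.mem_nhds hp)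
  let b : ContDiffBump p := ⟨R / 2, R, half_pos hR, half_lt_self hR⟩
  refine ⟨R / 2, half_pos hR, ?_, fun x => b x • φ x, ?_, fun x hx => ?_⟩
  · exact (ball_subset_ball (by linarith)).trans (ball_subset_closedBall.trans hball)
  · refine contDiff_iff_contDiffAt.2 fun x => ?_
    by_cases hx : x ∈ U
    · exact b.contDiff.contDiffAt.smul (hφ.contDiffAt (hU.mem_nhds hx))
    · have hx' : x ∉ tsupport b := by
        rw [b.tsupport_eq]
        exact fun h => hx (hball h)
      refine (contDiffAt_const (c := (0 : F))).congr_of_eventuallyEq ?_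
      filter_upwards [notMem_tsupport_iff_eventuallyEq.1 hx'] with y hy
      simp [hy]
  · have : b x = 1 := b.one_of_mem_closedBall (ball_subset_closedBall hx)
    simp [this]

lemma ellipticSymbol_of_isElliptic {A : Fin n → Euc n → Matrix (Fin N) (Fin N) ℝ}
    {U : Set (Euc n)} (hell : IsElliptic A U) {x : Euc n} (hx : x ∈ U) :
    EllipticSymbol fun l => LinearMap.toContinuousLinearMap (A l x).mulVecLin := by
  intro ξ hξ b hb
  refine Matrix.mulVec_injective_of_isUnit (hell x hx ξ hξ) ?_
  rw [Matrix.mulVec_zero, Matrix.sum_mulVec, ← hb]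
  simp [Matrix.smul_mulVec]

variable {A : Fin n → Euc n → Matrix (Fin N) (Fin N) ℝ} {U : Set (Euc n)}
  {V : Euc n → (Fin N → ℝ) → (Fin N → ℝ)} {φ : Euc n → (Fin N → ℝ)}

lemma exists_localSolution (hU : IsOpen U)
    (hA : ∀ j i l, ContDiffOn ℝ (⊤ : ℕ∞) (fun x => A j x i l) U) (hell : IsElliptic A U)
    (hV : ContDiffOn ℝ (⊤ : ℕ∞) (fun p : Euc n × (Fin N → ℝ) => V p.1 p.2) (U ×ˢ univ))
    (hV0 : ∀ x ∈ U, V x 0 = 0) (hφ : ContDiffOn ℝ (⊤ : ℕ∞) φ U)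
    (heq : ∀ x ∈ U, semilinApply A V φ x = 0) {p : Euc n} (hp : p ∈ U) :
    ∃ ρ > 0, ball p ρ ⊆ U ∧ ∃ ψ : Euc n → (Fin N → ℝ), EqOn ψ φ (ball p ρ) ∧
      LocalSolution (ball p ρ)
        (fun l x => LinearMap.toContinuousLinearMap (A l x).mulVecLin) V ψ := by
  obtain ⟨ρ, hρ, hsub, ψ, hψ, hEq⟩ := hφ.exists_contDiff_eqOn_ball hU hp
  refine ⟨ρ, hρ, hsub, ψ, hEq, isOpen_ball, hψ, fun l => ?_,
    hV.mono (prod_mono_left hsub), fun x hx => hV0 x (hsub hx),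
    fun x hx => ellipticSymbol_of_isElliptic hell (hsub hx), fun x hx => ?_⟩
  · refine ContDiffOn.mono ?_ hsub
    refine contDiffOn_clm_apply.2 fun y => contDiffOn_pi.2 fun i => ?_
    simp only [LinearMap.coe_toContinuousLinearMap', Matrix.mulVecLin_apply, Matrix.mulVec,
      dotProduct]
    exact ContDiffOn.sum fun q _ => (hA l i q).mul contDiffOn_const
  · have h1 : ψ =ᶠ[𝓝 x] φ := hEq.eventuallyEq_of_mem (isOpen_ball.mem_nhds hx)
    rw [h1.fderiv_eq, hEq hx]
    simpa [semilinApply] using heq x (hsub hx)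

end Matrices

/-- For a nontrivial smooth solution `φ` of a semilinear elliptic
first-order system respecting the zero section on an open connected `U ⊆ ℝⁿ`, `n ≥ 2`,
with the strong unique continuation property, the full zero set `N(φ)` is countably
`(n−2)`-`C^∞`-rectifiable and has locally finite `(n−2)`-dimensional Hausdorff measure;
in particular its Hausdorff dimension is at most `n − 2`. -/
theorem zero_set_countably_rectifiable_of_sucp
    (n N : ℕ) (hn : 2 ≤ n) (hN : 1 ≤ N)
    (U : Set (Euc n)) (hUopen : IsOpen U) (hUconn : IsConnected U)
    (A : Fin n → Euc n → Matrix (Fin N) (Fin N) ℝ)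
    (hA : ∀ j i l, ContDiffOn ℝ (⊤ : ℕ∞) (fun x => A j x i l) U)
    (hell : IsElliptic A U)
    (V : Euc n → (Fin N → ℝ) → (Fin N → ℝ))
    (hV : ContDiffOn ℝ (⊤ : ℕ∞) (fun p : Euc n × (Fin N → ℝ) => V p.1 p.2) (U ×ˢ univ))
    (hV0 : ∀ x ∈ U, V x 0 = 0)
    (hsucp : HasSUCP A V U)
    (φ : Euc n → (Fin N → ℝ)) (hφ : ContDiffOn ℝ (⊤ : ℕ∞) φ U)
    (heq : ∀ x ∈ U, semilinApply A V φ x = 0)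
    (hnontriv : ∃ x ∈ U, φ x ≠ 0) :
    CountablyCinfRectifiable (n - 2) {x ∈ U | φ x = 0} ∧
      (∀ p ∈ U, ∃ r > 0, μH[(n : ℝ) - 2] ({x ∈ U | φ x = 0} ∩ ball p r) < ⊤) ∧
      dimH {x ∈ U | φ x = 0} ≤ (n : ℝ≥0∞) - 2 := by
  obtain ⟨m, rfl⟩ : ∃ m, n = m + 2 := ⟨n - 2, by omega⟩
  have hord : ∀ y ∈ U, ∃ k, iteratedFDeriv ℝ k φ y ≠ 0 := by
    intro y hy
    by_contra! hcon
    obtain ⟨x, hx, hne⟩ := hnontriv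
    exact hne (hsucp U subset_rfl hUopen hUconn φ hφ heq ⟨y, hy, hcon⟩ x hx)
  have hloc := fun p (hp : p ∈ U) => exists_localSolution hUopen hA hell hV hV0 hφ heq hp
  have hord' : ∀ {p : Euc (m + 2)} {ρ : ℝ} {ψ : Euc (m + 2) → (Fin N → ℝ)}, ball p ρ ⊆ U →
      EqOn ψ φ (ball p ρ) → ∀ y ∈ ball p ρ, ∃ k, iteratedFDeriv ℝ k ψ y ≠ 0 := by
    intro p ρ ψ hsub hEq y hy
    obtain ⟨k, hk⟩ := hord y (hsub hy)
    refine ⟨k, ?_⟩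
    have h1 : ψ =ᶠ[𝓝 y] φ := hEq.eventuallyEq_of_mem (isOpen_ball.mem_nhds hy)
    rwa [(h1.iteratedFDeriv ℝ k).eq_of_nhds]
  have hrect : CountablyCinfRectifiable m {x ∈ U | φ x = 0} := by
    refine countablyCinfRectifiable_of_local fun p hp => ?_
    obtain ⟨ρ, hρ, hsub, ψ, hEq, hsol⟩ := hloc p hp.1
    refine ⟨ball p ρ, ball_mem_nhds p hρ,
      (hsol.countablyCinfRectifiable (hord' hsub hEq)).mono ?_⟩
    rintro x ⟨⟨-, hx0⟩, hx⟩
    exact ⟨hx, (hEq hx).trans hx0⟩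
  refine ⟨hrect, fun p hp => ?_, ?_⟩
  · obtain ⟨ρ, hρ, hsub, ψ, hEq, hsol⟩ := hloc p hp
    obtain ⟨r, hr, hfin⟩ := hsol.exists_hausdorffMeasure_lt_top rfl (mem_ball_self hρ)
      (hord' hsub hEq p (mem_ball_self hρ))
    refine ⟨min r ρ, lt_min hr hρ, ?_⟩
    have hcast : ((m + 2 : ℕ) : ℝ) - 2 = m := by push_cast; ring
    rw [hcast]
    refine (measure_mono ?_).trans_lt hfin
    rintro x ⟨⟨-, hx0⟩, hx⟩
    exact ⟨(hEq (ball_subset_ball (min_le_right _ _) hx)).trans hx0,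
      ball_subset_ball (min_le_left _ _) hx⟩
  · have hcast : ((m + 2 : ℕ) : ℝ≥0∞) - 2 = m := by
      push_cast
      exact ENNReal.add_sub_cancel_right (by simp)
    rw [hcast]
    exact hrect.dimH_le
end
end

section
/- Let n = 2 and N ≥ 1, let U ⊆ ℝ² be open and connected, and let (A₁, A₂, V) be a semilinear elliptic first-order system respecting the zero section on U which has the strong unique continuation property. Let φ : U → ℝ^N be a smooth solution of ∑ⱼ Aⱼ(x)(∂φ/∂xⱼ)(x) + V(x, φ(x)) = 0 with φ not identically zero. Then the zero set N(φ) is a discrete subset of U, i.e. every zero of φ is an isolated point of N(φ). -/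
open MeasureTheory Metric Set Filter Topology ENNReal NNReal

noncomputable section

section VanishingOrder

variable {E F G : Type*} [NormedAddCommGroup E] [NormedSpace ℝ E]
  [NormedAddCommGroup F] [NormedSpace ℝ F] [NormedAddCommGroup G] [NormedSpace ℝ G]
  {f g : E → F} {p : E} {k : ℕ}

/-- All derivatives of `g` of order less than `k` vanish at `p`. -/
def VanishesToOrder (k : ℕ) (g : E → F) (p : E) : Prop :=
  ∀ i < k, iteratedFDeriv ℝ i g p = 0

lemma ContDiffAt.fderiv_apply_top (hg : ContDiffAt ℝ (⊤ : ℕ∞) g p) (v : E) :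
    ContDiffAt ℝ (⊤ : ℕ∞) (fun x => fderiv ℝ g x v) p :=
  (hg.fderiv_right (m := (⊤ : ℕ∞)) (by simp)).clm_apply contDiffAt_const

lemma ContDiffAt.eventually_contDiffAt_nat {n : ℕ} (hg : ContDiffAt ℝ (⊤ : ℕ∞) g p) :
    ∀ᶠ x in 𝓝 p, ContDiffAt ℝ n g x :=
  (hg.of_le (by exact_mod_cast le_top)).eventually (by simp)

lemma ContDiffAt.eventually_differentiableAt (hg : ContDiffAt ℝ (⊤ : ℕ∞) g p) :
    ∀ᶠ x in 𝓝 p, DifferentiableAt ℝ g x :=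
  (hg.eventually_contDiffAt_nat (n := 1)).mono fun _ hx => hx.differentiableAt (by simp)

lemma ContDiffAt.iteratedFDeriv_succ_apply_last {i : ℕ} (hg : ContDiffAt ℝ (⊤ : ℕ∞) g p)
    (m : Fin (i + 1) → E) :
    iteratedFDeriv ℝ (i + 1) g p m =
      iteratedFDeriv ℝ i (fun x => fderiv ℝ g x (m (Fin.last i))) p (Fin.init m) := by
  rw [iteratedFDeriv_succ_apply_right]
  have h := (ContinuousLinearMap.apply ℝ F (m (Fin.last i))).iteratedFDeriv_comp_left
    (hg.fderiv_right (m := (⊤ : ℕ∞)) (by simp)) (i := i) (by exact_mod_cast le_top)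
  exact (congrArg (fun T => T (Fin.init m)) h).symm

namespace VanishesToOrder

lemma mono {l : ℕ} (h : VanishesToOrder k g p) (hl : l ≤ k) : VanishesToOrder l g p :=
  fun i hi => h i (hi.trans_le hl)

lemma congr (h : VanishesToOrder k g p) (hfg : f =ᶠ[𝓝 p] g) : VanishesToOrder k f p :=
  fun i hi => ((hfg.iteratedFDeriv ℝ i).eq_of_nhds).trans (h i hi)

lemma add (hf : ContDiffAt ℝ (⊤ : ℕ∞) f p) (hg : ContDiffAt ℝ (⊤ : ℕ∞) g p)
    (h : VanishesToOrder k f p) (h' : VanishesToOrder k g p) :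
    VanishesToOrder k (fun x => f x + g x) p := fun i hi => by
  rw [fun_iteratedFDeriv_add_apply (hf.of_le (by exact_mod_cast le_top))
    (hg.of_le (by exact_mod_cast le_top)), h i hi, h' i hi, add_zero]

lemma neg (h : VanishesToOrder k f p) : VanishesToOrder k (fun x => -f x) p := fun i hi => by
  have := iteratedFDeriv_neg_apply (𝕜 := ℝ) (i := i) (f := f) (x := p)
  rw [h i hi, neg_zero] at this
  exact this

lemma sum {ι : Type*} {s : Finset ι} {f : ι → E → F}
    (hf : ∀ j ∈ s, ContDiffAt ℝ (⊤ : ℕ∞) (f j) p) (h : ∀ j ∈ s, VanishesToOrder k (f j) p) :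
    VanishesToOrder k (fun x => ∑ j ∈ s, f j x) p := fun i hi => by
  rw [iteratedFDeriv_fun_sum_apply fun j hj => (hf j hj).of_le (by exact_mod_cast le_top)]
  exact Finset.sum_eq_zero fun j hj => h j hj i hi

lemma eq_zero (h : VanishesToOrder (k + 1) g p) : g p = 0 := by
  simpa using congrArg (fun T => T 0) (h 0 k.succ_pos)

lemma succ_iff (hg : ContDiffAt ℝ (⊤ : ℕ∞) g p) :
    VanishesToOrder (k + 1) g p ↔
      g p = 0 ∧ ∀ v, VanishesToOrder k (fun x => fderiv ℝ g x v) p := by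
  refine ⟨fun h => ⟨h.eq_zero, fun v i hi => ?_⟩, fun h i hi => ?_⟩
  · ext1 m
    have := hg.iteratedFDeriv_succ_apply_last (Fin.snoc m v : Fin (i + 1) → E)
    rw [h (i + 1) (by omega)] at this
    simpa using this.symm
  · ext1 m
    cases i with
    | zero => simpa using h.1
    | succ i => rw [hg.iteratedFDeriv_succ_apply_last, h.2 _ i (by omega)]; rfl

lemma fderiv_apply (hg : ContDiffAt ℝ (⊤ : ℕ∞) g p) (h : VanishesToOrder (k + 1) g p) (v : E) :
    VanishesToOrder k (fun x => fderiv ℝ g x v) p :=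
  ((succ_iff hg).1 h).2 v

lemma fderiv_clm_apply_eventuallyEq {a : E → F →L[ℝ] G} (ha : ContDiffAt ℝ (⊤ : ℕ∞) a p)
    (hg : ContDiffAt ℝ (⊤ : ℕ∞) g p) (v : E) :
    (fun x => fderiv ℝ (fun y => a y (g y)) x v) =ᶠ[𝓝 p]
      fun x => fderiv ℝ a x v (g x) + a x (fderiv ℝ g x v) := by
  filter_upwards [ha.eventually_differentiableAt, hg.eventually_differentiableAt] with x hax hgx
  rw [(hax.hasFDerivAt.clm_apply hgx.hasFDerivAt).fderiv]
  simp [add_comm]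

lemma clm_apply {a : E → F →L[ℝ] G} (ha : ContDiffAt ℝ (⊤ : ℕ∞) a p)
    (hg : ContDiffAt ℝ (⊤ : ℕ∞) g p) (h : VanishesToOrder k g p) :
    VanishesToOrder k (fun x => a x (g x)) p := by
  induction k generalizing a g with
  | zero => exact fun i hi => absurd hi (by omega)
  | succ k ih =>
    refine (succ_iff (ha.clm_apply hg)).2 ⟨by simp [h.eq_zero], fun v => ?_⟩
    refine congr ?_ (fderiv_clm_apply_eventuallyEq ha hg v)
    exact add ((ha.fderiv_apply_top v).clm_apply hg) (ha.clm_apply (hg.fderiv_apply_top v))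
      (ih (ha.fderiv_apply_top v) hg (h.mono k.le_succ))
      (ih ha (hg.fderiv_apply_top v) (h.fderiv_apply hg v))

lemma clm_apply_succ {a : E → F →L[ℝ] G} (ha : ContDiffAt ℝ (⊤ : ℕ∞) a p) (hap : a p = 0)
    (hg : ContDiffAt ℝ (⊤ : ℕ∞) g p) (h : VanishesToOrder k g p) :
    VanishesToOrder (k + 1) (fun x => a x (g x)) p := by
  induction k generalizing g with
  | zero =>
    refine (succ_iff (ha.clm_apply hg)).2 ⟨by simp [hap], fun v i hi => absurd hi (by omega)⟩
  | succ k ih =>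
    refine (succ_iff (ha.clm_apply hg)).2 ⟨by simp [hap], fun v => ?_⟩
    refine congr ?_ (fderiv_clm_apply_eventuallyEq ha hg v)
    exact add ((ha.fderiv_apply_top v).clm_apply hg) (ha.clm_apply (hg.fderiv_apply_top v))
      (clm_apply (ha.fderiv_apply_top v) hg h)
      (ih (hg.fderiv_apply_top v) (h.fderiv_apply hg v))

lemma _root_.ContDiffAt.comp_graph {W : E × F → G} {y : F}
    (hW : ContDiffAt ℝ (⊤ : ℕ∞) W (p, y)) (hg : ContDiffAt ℝ (⊤ : ℕ∞) g p) (hy : g p = y) :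
    ContDiffAt ℝ (⊤ : ℕ∞) (fun x => W (x, g x)) p := by
  subst hy
  exact hW.comp₂ contDiffAt_id hg

/-- If `g` vanishes to order `k` at `p`, then so does `x ↦ W (x, g x) - W (x, 0)`. -/
lemma comp_graph_sub {W : E × F → G} (hW : ContDiffAt ℝ (⊤ : ℕ∞) W (p, 0))
    (hg : ContDiffAt ℝ (⊤ : ℕ∞) g p) (h : VanishesToOrder k g p) :
    VanishesToOrder k (fun x => W (x, g x) - W (x, 0)) p := by
  induction k generalizing W with
  | zero => exact fun i hi => absurd hi (by omega)
  | succ k ih =>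
    have hg0 := h.eq_zero
    have hgraph : ContDiffAt ℝ (⊤ : ℕ∞) (fun x => (x, g x)) p := contDiffAt_id.prodMk hg
    have hzero : ContDiffAt ℝ (⊤ : ℕ∞) (fun x => (x, (0 : F))) p :=
      contDiffAt_id.prodMk contDiffAt_const
    refine (succ_iff ((hW.comp_graph hg hg0).sub (hW.comp_graph contDiffAt_const rfl))).2
      ⟨by simp [hg0], fun v => ?_⟩
    have hWv := hW.fderiv_apply_top ((v, 0) : E × F)
    have hWy : ContDiffAt ℝ (⊤ : ℕ∞)
        (fun z => (fderiv ℝ W z).comp (ContinuousLinearMap.inr ℝ E F)) (p, 0) :=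
      (hW.fderiv_right (m := (⊤ : ℕ∞)) (by simp)).clm_comp contDiffAt_const
    have key : (fun x => fderiv ℝ (fun x => W (x, g x) - W (x, 0)) x v) =ᶠ[𝓝 p]
        fun x => (fderiv ℝ W (x, g x) (v, 0) - fderiv ℝ W (x, 0) (v, 0)) +
          (fderiv ℝ W (x, g x)).comp (ContinuousLinearMap.inr ℝ E F) (fderiv ℝ g x v) := by
      have hWd := hW.eventually_differentiableAt
      have e1 : ∀ᶠ x in 𝓝 p, DifferentiableAt ℝ W (x, g x) :=
        hgraph.continuousAt.eventually (by simpa [hg0] using hWd)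
      have e2 : ∀ᶠ x in 𝓝 p, DifferentiableAt ℝ W (x, 0) :=
        hzero.continuousAt.eventually hWd
      filter_upwards [e1, e2, hg.eventually_differentiableAt] with x h1 h2 h3
      have d1 := h1.hasFDerivAt.comp (f := fun x => (x, g x)) x
        ((hasFDerivAt_id x).prodMk h3.hasFDerivAt)
      have d2 := h2.hasFDerivAt.comp (f := fun x => (x, (0 : F))) x
        ((hasFDerivAt_id x).prodMk (hasFDerivAt_const (0 : F) x))
      have d3 := congrArg (fun T => T v) (d1.sub d2).fderiv
      refine Eq.trans d3 ?_
      have : ((v, fderiv ℝ g x v) : E × F) = (v, 0) + (0, fderiv ℝ g x v) := by simp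
      simp only [sub_apply, ContinuousLinearMap.comp_apply,
        ContinuousLinearMap.prod_apply, ContinuousLinearMap.id_apply,
        zero_apply, ContinuousLinearMap.inr_apply]
      rw [this, map_add]
      abel
    refine congr ?_ key
    exact add ((hWv.comp_graph hg hg0).sub (hWv.comp_graph contDiffAt_const rfl))
      ((hWy.comp_graph hg hg0).clm_apply (hg.fderiv_apply_top v))
      (ih hWv (h.mono k.le_succ))
      (clm_apply (hWy.comp_graph hg hg0) (hg.fderiv_apply_top v) (h.fderiv_apply hg v))

/-- If the leading homogeneous part of the Taylor expansion of `g` at `p` has no zeros away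
from the origin, then `p` is at most an isolated zero of `g`. -/
lemma eventually_ne_zero [FiniteDimensional ℝ E] [CompleteSpace F]
    (hg : ContDiffAt ℝ (⊤ : ℕ∞) g p) (h : VanishesToOrder k g p)
    (hne : ∀ y : E, y ≠ 0 → iteratedFDeriv ℝ k g p (fun _ => y) ≠ 0) :
    ∀ᶠ x in 𝓝 p, x ≠ p → g x ≠ 0 := by
  set T := iteratedFDeriv ℝ k g p with hT
  have hTc : Continuous fun y : E => ‖T (fun _ => y)‖ := by fun_prop
  obtain ⟨c, hc, hcT⟩ := (isCompact_sphere (0 : E) 1).exists_forall_le' hTc.continuousOn (a := 0)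
    fun y hy => norm_pos_iff.2 (hne y (ne_of_mem_sphere hy one_ne_zero))
  have hlow (y : E) (hy : y ≠ 0) : c * ‖y‖ ^ k ≤ ‖T (fun _ => y)‖ := by
    have hy' : 0 < ‖y‖ := norm_pos_iff.2 hy
    have h1 := hcT (‖y‖⁻¹ • y) (by simp [norm_smul, hy'.ne'])
    rw [T.map_smul_univ (fun _ => ‖y‖⁻¹) (fun _ => y), norm_smul] at h1
    simp only [Finset.prod_const, Finset.card_univ, Fintype.card_fin, norm_pow, norm_inv,
      norm_norm, inv_pow] at h1
    rwa [inv_mul_eq_div, le_div_iff₀ (by positivity)] at h1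
  have hcont : ContinuousAt (fun x => ‖iteratedFDeriv ℝ (k + 1) g x‖) p :=
    (hg.iteratedFDeriv_right (m := 0) (i := k + 1) (by exact_mod_cast le_top)).continuousAt.norm
  set M := ‖iteratedFDeriv ℝ (k + 1) g p‖ + 1
  have hMpos : 0 < M := by positivity
  obtain ⟨r, hr, hball⟩ := Metric.eventually_nhds_iff_ball.1
    ((hg.eventually_contDiffAt_nat (n := k + 1)).and
      (hcont.eventually (gt_mem_nhds (lt_add_one _))))
  filter_upwards [ball_mem_nhds p (lt_min hr (div_pos hc hMpos))] with x hx hxp hgx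
  set y := x - p with hy
  have hy0 : y ≠ 0 := sub_ne_zero.2 hxp
  have hypos : 0 < ‖y‖ := norm_pos_iff.2 hy0
  have hyr : ‖y‖ < min r (c / M) := by simpa [hy, dist_eq_norm] using hx
  have hseg (t : ℝ) (ht : t ∈ Icc (0 : ℝ) 1) : p + t • y ∈ ball p r := by
    rw [mem_ball, dist_eq_norm, add_sub_cancel_left, norm_smul, Real.norm_of_nonneg ht.1]
    exact (mul_le_of_le_one_left hypos.le ht.2).trans_lt (hyr.trans_le (min_le_left _ _))
  have taylor := map_add_eq_sum_add_integral_iteratedFDeriv (f := g) (x := p) (y := y) (n := k)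
    fun t ht => mod_cast (hball _ (hseg t ht)).1
  rw [Finset.sum_range_succ, Finset.sum_eq_zero fun i hi => by
    rw [h i (Finset.mem_range.1 hi)]; simp, zero_add, hy, add_sub_cancel, hgx, ← smul_add, ← hy,
    ← hT, eq_comm, smul_eq_zero_iff_right (by positivity), add_eq_zero_iff_eq_neg] at taylor
  have hint : ‖∫ t in (0 : ℝ)..1, (1 - t) ^ k •
      iteratedFDeriv ℝ (k + 1) g (p + t • y) (fun _ => y)‖ ≤ M * ‖y‖ ^ (k + 1) := by
    refine (intervalIntegral.norm_integral_le_of_norm_le_const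
      (C := M * ‖y‖ ^ (k + 1)) fun t ht => ?_).trans (by simp)
    rw [uIoc_of_le zero_le_one] at ht
    rw [norm_smul, norm_pow, Real.norm_of_nonneg (sub_nonneg.2 ht.2)]
    refine (mul_le_of_le_one_left (norm_nonneg _)
      (pow_le_one₀ (sub_nonneg.2 ht.2) (by linarith [ht.1]))).trans ?_
    refine (ContinuousMultilinearMap.le_opNorm _ _).trans ?_
    simp only [Finset.prod_const, Finset.card_univ, Fintype.card_fin]
    gcongr
    exact (hball _ (hseg t (Ioc_subset_Icc_self ht))).2.le
  have h1 := hlow y hy0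
  rw [taylor, norm_neg] at h1
  have h2 : ‖y‖ * M < c := (lt_div_iff₀ hMpos).1 (hyr.trans_le (min_le_right _ _))
  have h3 : ‖y‖ * M * ‖y‖ ^ k < c * ‖y‖ ^ k := by gcongr
  have h4 : ‖y‖ * M * ‖y‖ ^ k = M * ‖y‖ ^ (k + 1) := by ring
  linarith

end VanishesToOrder

end VanishingOrder

section ConstantCoefficients

variable {F : Type*} [NormedAddCommGroup F] [NormedSpace ℝ F]

/-- The constant-coefficient first-order operator `g ↦ ∑ⱼ Cⱼ ∂g/∂xⱼ`. -/
def constCoeffApply {n : ℕ} (C : Fin n → F →L[ℝ] F) (g : Euc n → F) (x : Euc n) : F :=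
  ∑ j, C j (fderiv ℝ g x (EuclideanSpace.single j 1))

lemma ContDiffAt.constCoeffApply {n : ℕ} (C : Fin n → F →L[ℝ] F) {g : Euc n → F} {p : Euc n}
    (hg : ContDiffAt ℝ (⊤ : ℕ∞) g p) : ContDiffAt ℝ (⊤ : ℕ∞) (constCoeffApply C g) p :=
  ContDiffAt.sum fun _ _ => contDiffAt_const.clm_apply (hg.fderiv_apply_top _)

lemma constCoeffApply_fderiv_eventuallyEq {n : ℕ} (C : Fin n → F →L[ℝ] F) {g : Euc n → F}
    {p : Euc n} (hg : ContDiffAt ℝ (⊤ : ℕ∞) g p) (v : Euc n) :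
    constCoeffApply C (fun x => fderiv ℝ g x v) =ᶠ[𝓝 p]
      fun x => fderiv ℝ (constCoeffApply C g) x v := by
  have hd := (hg.fderiv_right (m := (⊤ : ℕ∞)) (by simp)).eventually_differentiableAt
  filter_upwards [hd, hg.eventually_contDiffAt_nat (n := 2)] with x hx hx2
  have hsymm : IsSymmSndFDerivAt ℝ g x := hx2.isSymmSndFDerivAt (by simp)
  have hder (w : Euc n) : HasFDerivAt (fun y => fderiv ℝ g y w)
      ((fderiv ℝ (fderiv ℝ g) x).flip w) x := by
    simpa using! hx.hasFDerivAt.clm_apply (hasFDerivAt_const w x)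
  have hL : HasFDerivAt (constCoeffApply C g)
      (∑ j, (C j).comp ((fderiv ℝ (fderiv ℝ g) x).flip (EuclideanSpace.single j 1))) x :=
    HasFDerivAt.fun_sum fun _ _ => (C _).hasFDerivAt.comp x (hder _)
  rw [hL.fderiv, _root_.constCoeffApply, (hder v).fderiv]
  simp only [sum_apply, ContinuousLinearMap.comp_apply,
    ContinuousLinearMap.flip_apply]
  exact Finset.sum_congr rfl fun _ _ => by rw [hsymm.eq]

/-- A linear map `ℝ² → F` of rank at most one satisfying the symbol equation of an elliptic
operator vanishes. -/
lemma linearMap_eq_zero_of_elliptic {C : Fin 2 → F →L[ℝ] F}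
    (hC : ∀ ζ : Euc 2, ζ ≠ 0 → ∀ w, ∑ j, ζ j • C j w = 0 → w = 0) (Y : Euc 2 →L[ℝ] F)
    {ξ : Euc 2} (hξ : ξ ≠ 0) (hYξ : Y ξ = 0)
    (hY : ∑ j, C j (Y (EuclideanSpace.single j 1)) = 0) : Y = 0 := by
  set η : Euc 2 := !₂[-ξ 1, ξ 0] with hη
  have hs : ξ 0 ^ 2 + ξ 1 ^ 2 ≠ 0 := by
    intro h
    refine hξ ?_
    ext i
    fin_cases i <;> simp <;> nlinarith [sq_nonneg (ξ 0), sq_nonneg (ξ 1)]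
  have he0 : (ξ 0 ^ 2 + ξ 1 ^ 2) • EuclideanSpace.single 0 1 = ξ 0 • ξ - ξ 1 • η := by
    ext i
    fin_cases i <;> simp [hη] <;> ring
  have he1 : (ξ 0 ^ 2 + ξ 1 ^ 2) • EuclideanSpace.single 1 1 = ξ 1 • ξ + ξ 0 • η := by
    ext i
    fin_cases i <;> simp [hη] <;> ring
  have hY0 : (ξ 0 ^ 2 + ξ 1 ^ 2) • Y (EuclideanSpace.single 0 1) = -ξ 1 • Y η := by
    rw [← map_smul, he0]; simp [hYξ]
  have hY1 : (ξ 0 ^ 2 + ξ 1 ^ 2) • Y (EuclideanSpace.single 1 1) = ξ 0 • Y η := by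
    rw [← map_smul, he1]; simp [hYξ]
  have hη0 : η ≠ 0 := by
    intro h
    apply hs
    have h0 : η 0 = 0 := by simp [h]
    have h1 : η 1 = 0 := by simp [h]
    simp only [hη] at h0 h1
    simp at h0 h1
    simp [h0, h1]
  have hYη : Y η = 0 := by
    refine hC η hη0 _ ?_
    have := congrArg (fun w => (ξ 0 ^ 2 + ξ 1 ^ 2) • w) hY
    simp only [Fin.sum_univ_two, smul_add, smul_zero, ← map_smul] at this
    rw [map_smul Y, map_smul Y, hY0, hY1] at this
    simpa [hη, Fin.sum_univ_two] using this
  rw [hYη, smul_zero, smul_eq_zero_iff_right hs] at hY0 hY1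
  refine ContinuousLinearMap.coe_injective
    ((EuclideanSpace.basisFun (Fin 2) ℝ).toBasis.ext fun i => ?_)
  fin_cases i
  · simpa using hY0
  · simpa using hY1

/-- In two dimensions, the leading part at `p` of an approximate solution of an elliptic
constant-coefficient system has no zeros away from the origin, unless it is zero. -/
lemma VanishesToOrder.succ_of_elliptic {C : Fin 2 → F →L[ℝ] F}
    (hC : ∀ ζ : Euc 2, ζ ≠ 0 → ∀ w, ∑ j, ζ j • C j w = 0 → w = 0) {ξ : Euc 2} (hξ : ξ ≠ 0)
    {p : Euc 2} {k : ℕ} {g : Euc 2 → F} (hg : ContDiffAt ℝ (⊤ : ℕ∞) g p)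
    (h : VanishesToOrder k g p) (hL : VanishesToOrder k (constCoeffApply C g) p)
    (hgξ : iteratedFDeriv ℝ k g p (fun _ => ξ) = 0) : VanishesToOrder (k + 1) g p := by
  induction k generalizing g with
  | zero =>
    exact (succ_iff hg).2 ⟨by simpa using hgξ, fun v i hi => absurd hi (by omega)⟩
  | succ k ih =>
    refine (succ_iff hg).2 ⟨h.eq_zero, fun v => ?_⟩
    refine ih (hg.fderiv_apply_top v) (h.fderiv_apply hg v)
      ((hL.fderiv_apply (hg.constCoeffApply C) v).congr
        (constCoeffApply_fderiv_eventuallyEq C hg v)) ?_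
    have hlast (w : Euc 2) : iteratedFDeriv ℝ k (fun x => fderiv ℝ g x w) p (fun _ => ξ) =
        iteratedFDeriv ℝ (k + 1) g p (Fin.snoc (fun _ : Fin k => ξ) w : Fin (k + 1) → Euc 2) := by
      rw [hg.iteratedFDeriv_succ_apply_last]
      simp
    set Y : Euc 2 →L[ℝ] F :=
      (((continuousMultilinearCurryRightEquiv' ℝ k (Euc 2) F)
        (iteratedFDeriv ℝ (k + 1) g p)) (fun _ => ξ) : Euc 2 →L[ℝ] F)
    have hYapp (w : Euc 2) :
        Y w = iteratedFDeriv ℝ k (fun x => fderiv ℝ g x w) p (fun _ => ξ) := by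
      rw [hlast]; rfl
    have hY : Y = 0 := by
      refine linearMap_eq_zero_of_elliptic hC Y hξ ?_ ?_
      · rw [hYapp, hlast]
        convert hgξ using 2
        ext1 i
        refine Fin.lastCases ?_ (fun i => ?_) i <;> simp
      · have hLk := congrArg (fun T => T fun _ => ξ) (hL k k.lt_succ_self)
        have hsm (j : Fin 2) : ContDiffAt ℝ (⊤ : ℕ∞)
            (fun x => fderiv ℝ g x (EuclideanSpace.single j 1)) p := hg.fderiv_apply_top _
        have e : iteratedFDeriv ℝ k (constCoeffApply C g) p = ∑ j, iteratedFDeriv ℝ k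
            (fun x => C j (fderiv ℝ g x (EuclideanSpace.single j 1))) p :=
          iteratedFDeriv_fun_sum_apply fun j _ =>
            (contDiffAt_const.clm_apply (hsm j)).of_le (by exact_mod_cast le_top)
        have e' (j : Fin 2) := (C j).iteratedFDeriv_comp_left (hsm j) (i := k)
          (by exact_mod_cast le_top)
        simp only [Function.comp_def] at e'
        simpa [e, e', hYapp] using hLk
    rw [← hYapp, hY]
    rfl

end ConstantCoefficients

/-- Smoothness of the coefficients of a matrix-valued map gives smoothness of the associated
map into continuous linear endomorphisms. -/
lemma exists_clm_eq_mulVec {N : ℕ} {E : Type*} [NormedAddCommGroup E] [NormedSpace ℝ E]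
    {A : E → Matrix (Fin N) (Fin N) ℝ} {U : Set E}
    (hA : ∀ i l, ContDiffOn ℝ (⊤ : ℕ∞) (fun x => A x i l) U) :
    ∃ a : E → (Fin N → ℝ) →L[ℝ] (Fin N → ℝ), ContDiffOn ℝ (⊤ : ℕ∞) a U ∧
      ∀ x w, a x w = (A x).mulVec w := by
  refine ⟨fun x => ∑ i, ∑ l, A x i l • (ContinuousLinearMap.single ℝ (fun _ : Fin N => ℝ) i).comp
    (ContinuousLinearMap.proj l), ?_, fun x w => ?_⟩
  · exact ContDiffOn.sum fun i _ => ContDiffOn.sum fun l _ => (hA i l).smul contDiffOn_const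
  · ext i
    simp [Matrix.mulVec, dotProduct, Pi.single_apply]

/-- For a nontrivial smooth solution `φ` of a semilinear elliptic
first-order system respecting the zero section on an open connected `U ⊆ ℝ²`, with the
strong unique continuation property, the zero set `N(φ)` is discrete in `U`: every zero
of `φ` is an isolated point of `N(φ)`. -/
theorem zero_set_discrete_dim_two_of_sucp
    (N : ℕ) (hN : 1 ≤ N)
    (U : Set (Euc 2)) (hUopen : IsOpen U) (hUconn : IsConnected U)
    (A : Fin 2 → Euc 2 → Matrix (Fin N) (Fin N) ℝ)
    (hA : ∀ j i l, ContDiffOn ℝ (⊤ : ℕ∞) (fun x => A j x i l) U)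
    (hell : IsElliptic A U)
    (V : Euc 2 → (Fin N → ℝ) → (Fin N → ℝ))
    (hV : ContDiffOn ℝ (⊤ : ℕ∞) (fun p : Euc 2 × (Fin N → ℝ) => V p.1 p.2) (U ×ˢ univ))
    (hV0 : ∀ x ∈ U, V x 0 = 0)
    (hsucp : HasSUCP A V U)
    (φ : Euc 2 → (Fin N → ℝ)) (hφ : ContDiffOn ℝ (⊤ : ℕ∞) φ U)
    (heq : ∀ x ∈ U, semilinApply A V φ x = 0)
    (hnontriv : ∃ x ∈ U, φ x ≠ 0) :
    ∀ p ∈ U, φ p = 0 → ∃ ε > 0, {x ∈ U | φ x = 0} ∩ ball p ε = {p} := by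
  intro p hp hφp
  have hUp : U ∈ 𝓝 p := hUopen.mem_nhds hp
  have hφs : ContDiffAt ℝ (⊤ : ℕ∞) φ p := hφ.contDiffAt hUp
  obtain ⟨k, hk, hk'⟩ : ∃ k, VanishesToOrder k φ p ∧ ¬ VanishesToOrder (k + 1) φ p := by
    by_contra! hcon
    have hall (k : ℕ) : VanishesToOrder k φ p := by
      induction k with
      | zero => exact fun i hi => absurd hi (by omega)
      | succ k ih => exact hcon k ih
    obtain ⟨x, hx, hφx⟩ := hnontriv
    exact hφx (hsucp U subset_rfl hUopen hUconn φ hφ heq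
      ⟨p, hp, fun k => hall (k + 1) k k.lt_succ_self⟩ x hx)
  choose a ha haA using fun j => exists_clm_eq_mulVec (hA j)
  have has (j : Fin 2) : ContDiffAt ℝ (⊤ : ℕ∞) (a j) p := (ha j).contDiffAt hUp
  have hell' : ∀ ζ : Euc 2, ζ ≠ 0 → ∀ w, ∑ j, ζ j • a j p w = 0 → w = 0 := by
    intro ζ hζ w hw
    refine Matrix.mulVec_injective_of_isUnit (hell p hp ζ hζ) ?_
    simpa [haA, Matrix.add_mulVec, Matrix.smul_mulVec] using hw
  have hL : VanishesToOrder k (constCoeffApply (fun j => a j p) φ) p := by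
    have hVp : ContDiffAt ℝ (⊤ : ℕ∞) (fun z : Euc 2 × (Fin N → ℝ) => V z.1 z.2) (p, 0) :=
      hV.contDiffAt (prod_mem_nhds hUp univ_mem)
    have hVφ : ContDiffAt ℝ (⊤ : ℕ∞) (fun x => V x (φ x) - V x 0) p :=
      (hVp.comp_graph hφs hφp).sub (hVp.comp_graph contDiffAt_const rfl)
    have hsm (j : Fin 2) : ContDiffAt ℝ (⊤ : ℕ∞)
        (fun x => (a j x - a j p) (fderiv ℝ φ x (EuclideanSpace.single j 1))) p :=
      ((has j).sub contDiffAt_const).clm_apply (hφs.fderiv_apply_top _)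
    have hvan (j : Fin 2) : VanishesToOrder k
        (fun x => (a j x - a j p) (fderiv ℝ φ x (EuclideanSpace.single j 1))) p := by
      cases k with
      | zero => exact fun i hi => absurd hi (by omega)
      | succ m =>
        exact .clm_apply_succ ((has j).sub contDiffAt_const) (sub_self _)
          (hφs.fderiv_apply_top _) (hk.fderiv_apply hφs _)
    refine .congr (VanishesToOrder.neg (.add (ContDiffAt.sum (s := Finset.univ) fun j _ => hsm j) hVφ
      (.sum (fun j _ => hsm j) fun j _ => hvan j) (.comp_graph_sub hVp hφs hk))) ?_
    filter_upwards [hUp] with x hx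
    have := heq x hx
    simp only [semilinApply, ← haA] at this
    simp only [constCoeffApply, sub_apply, Finset.sum_sub_distrib, hV0 x hx,
      sub_zero]
    rw [eq_neg_iff_add_eq_zero, ← this]
    abel
  have hev := hk.eventually_ne_zero hφs fun y hy hTy => hk' (hk.succ_of_elliptic hell' hy hφs hL hTy)
  obtain ⟨ε, hε, hball⟩ := Metric.eventually_nhds_iff_ball.1 hev
  refine ⟨ε, hε, subset_antisymm (fun x hx => ?_) ?_⟩
  · by_contra hxp
    exact hball x hx.2 hxp hx.1.2
  · rintro _ rfl
    exact ⟨⟨hp, hφp⟩, mem_ball_self hε⟩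
end
end
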